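/- There exists a constant R₀ > 0, depending only on the compact Alexandrov space X, such that for any finite simplicial complex K with subcomplex L and any point p ∈ X, any two continuous maps σ₀, σ₁: (K,L) → (X,p) satisfying d(σ₀(x), σ₁(x)) < R₀ for all x ∈ K are homotopic relative to L. -/

import Mathlib

open Metric Set

noncomputable section

namespace Collapse

/-- The comparison angle `∠̃κ` at the vertex opposite to the side of length `c` in a triangle
with side lengths `a`, `b`, `c` in the model plane of constant curvature `κ`. -/
noncomputable def cmpAngle (κ a b c : ℝ) : ℝ :=
  if κ = 0 then Real.arccos ((a ^ 2 + b ^ 2 - c ^ 2) / (2 * a * b))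
  else if 0 < κ then
    Real.arccos ((Real.cos (Real.sqrt κ * c) - Real.cos (Real.sqrt κ * a) *
        Real.cos (Real.sqrt κ * b)) / (Real.sin (Real.sqrt κ * a) * Real.sin (Real.sqrt κ * b)))
  else
    Real.arccos ((Real.cosh (Real.sqrt (-κ) * a) * Real.cosh (Real.sqrt (-κ) * b) -
        Real.cosh (Real.sqrt (-κ) * c)) /
      (Real.sinh (Real.sqrt (-κ) * a) * Real.sinh (Real.sqrt (-κ) * b)))

/-- Alexandrov's (1+3)-point comparison: curvature bounded below by `κ`. -/
def CurvGE (X : Type) [MetricSpace X] (κ : ℝ) : Prop :=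
  ∀ p a b c : X, a ≠ p → b ≠ p → c ≠ p →
    cmpAngle κ (dist p a) (dist p b) (dist a b) +
      cmpAngle κ (dist p b) (dist p c) (dist b c) +
      cmpAngle κ (dist p c) (dist p a) (dist c a) ≤ 2 * Real.pi

/-- An `n`-dimensional Alexandrov space of curvature `≥ κ`: a proper geodesic metric space
satisfying the comparison inequality, of Hausdorff dimension `n`. -/
structure IsAlexandrovSpace (X : Type) [MetricSpace X] (n : ℕ) (κ : ℝ) : Prop where
  proper : ProperSpace X
  midpoint : ∀ x y : X, ∃ m : X, dist x m = dist x y / 2 ∧ dist m y = dist x y / 2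
  curv : CurvGE X κ
  dim : dimH (Set.univ : Set X) = n

/-- A pair of `μ`-approximations `θ : M → X`, `η : X → M` between metric spaces,
with `|θ ∘ η, id_X| < μ`. -/
structure IsApproxPair {M X : Type} [MetricSpace M] [MetricSpace X] (μ : ℝ)
    (θ : M → X) (η : X → M) : Prop where
  dist_theta : ∀ a b : M, |dist (θ a) (θ b) - dist a b| < μ
  dist_eta : ∀ x y : X, |dist (η x) (η y) - dist x y| < μ
  dense_theta : ∀ x : X, ∃ a : M, dist (θ a) x < μ
  dense_eta : ∀ a : M, ∃ x : X, dist (η x) a < μ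
  comp : ∀ x : X, dist (θ (η x)) x < μ

/-- `p` is a critical point of the distance function `dist_q`: the differential of `dist_q`
at `p` is nonpositive, i.e. every comparison angle `∠̃κ q p x` is at most `π/2`. -/
def IsCriticalPt {X : Type} [MetricSpace X] (κ : ℝ) (q p : X) : Prop :=
  ∀ x : X, x ≠ p → cmpAngle κ (dist p q) (dist p x) (dist q x) ≤ Real.pi / 2

/-- A closed subset `E` is extremal: every point of `E` that is a local minimum on `E` of a
distance function `dist_q`, `q ∉ E`, is a critical point of `dist_q`. -/
def IsExtremal {X : Type} [MetricSpace X] (κ : ℝ) (E : Set X) : Prop :=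
  IsClosed E ∧ ∀ q : X, q ∉ E → ∀ p ∈ E,
    IsLocalMinOn (fun x => dist q x) E p → IsCriticalPt κ q p

/-- `X` has no proper nonempty extremal subsets. -/
def HasNoProperExtremal (X : Type) [MetricSpace X] (κ : ℝ) : Prop :=
  ∀ E : Set X, IsExtremal κ E → E = ∅ ∨ E = Set.univ

/-- The main part of an extremal subset: the complement in `E` of all proper extremal subsets. -/
def mainPart {X : Type} [MetricSpace X] (κ : ℝ) (E : Set X) : Set X :=
  E \ ⋃₀ {F : Set X | IsExtremal κ F ∧ F ⊂ E}

/-- A primitive extremal subset: an extremal subset containing no proper extremal subset with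
nonempty relative interior. -/
def IsPrimitiveExtremal {X : Type} [MetricSpace X] (κ : ℝ) (E : Set X) : Prop :=
  IsExtremal κ E ∧ ∀ F : Set X, IsExtremal κ F → F ⊂ E →
    ∀ V : Set X, IsOpen V → V ∩ E ⊆ F → V ∩ E = ∅

/-- `E` contains no proper nonempty extremal subsets. -/
def NoProperExtremalIn {X : Type} [MetricSpace X] (κ : ℝ) (E : Set X) : Prop :=
  ∀ F : Set X, IsExtremal κ F → F ⊂ E → F = ∅

end Collapse

namespace Collapse

/-- A finite abstract simplicial complex on the vertex set `Fin V`. -/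
structure FinSimpComplex (V : ℕ) where
  faces : Finset (Finset (Fin V))
  down : ∀ s ∈ faces, ∀ t : Finset (Fin V), t ⊆ s → t.Nonempty → t ∈ faces

/-- The geometric realization of `K`, as a subset of `ℝ^V`. -/
def FinSimpComplex.space {V : ℕ} (K : FinSimpComplex V) : Set (Fin V → ℝ) :=
  {x | (∀ i, 0 ≤ x i) ∧ (∑ i, x i) = 1 ∧ ∃ s ∈ K.faces, ∀ i, x i ≠ 0 ↔ i ∈ s}

/-- The (closed) geometric simplex of `K` spanned by the face `s`. -/
def FinSimpComplex.cell {V : ℕ} (K : FinSimpComplex V) (s : Finset (Fin V)) :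
    Set (Fin V → ℝ) :=
  {x | x ∈ K.space ∧ ∀ i, x i ≠ 0 → i ∈ s}


/-- The subset `K × {0} ∪ L × I` of `|K| × I`, for a subcomplex `L` of `K`. -/
def simpPairDomain {V : ℕ} (K L : FinSimpComplex V) :
    Set (↥K.space × ↥unitInterval) :=
  {z | z.2 = 0 ∨ (z.1 : Fin V → ℝ) ∈ L.space}

end Collapse

namespace Collapse


set_option maxHeartbeats 1000000
set_option linter.unusedVariables false
set_option autoImplicit false


section


/-- Local hyperbolic comparison (Stewart form), with midpoints. -/
structure Loc (X : Type) [MetricSpace X] (lam : ℝ) : Prop where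
  pos : 0 < lam
  mid : ∀ x y : X, ∃ m : X, dist x m = dist x y / 2 ∧ dist m y = dist x y / 2
  stew : ∀ x y Y m : X, dist x y + dist y Y = dist x Y → lam * dist x y ≤ 1 → lam * dist y Y ≤ 1 →
    lam * dist y m ≤ 1 →
    Real.sinh (lam * dist x y) * Real.cosh (lam * dist Y m) +
      Real.sinh (lam * dist y Y) * Real.cosh (lam * dist x m) ≤
      Real.sinh (lam * dist x Y) * Real.cosh (lam * dist y m)

theorem sinh_ratio {x a : ℝ} (hx : 0 ≤ x) (hxa : x ≤ a) : Real.sinh x * a ≤ x * Real.sinh a := by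
  rcases eq_or_lt_of_le hx with rfl | hx
  · simp
  have ha : 0 < a := lt_of_lt_of_le hx hxa
  have hc : ConvexOn ℝ (Set.Ici 0) Real.sinh := by
    apply MonotoneOn.convexOn_of_deriv (convex_Ici 0) Real.continuous_sinh.continuousOn
      Real.differentiable_sinh.differentiableOn
    rw [Real.deriv_sinh]
    intro u hu v hv huv
    simp only [interior_Ici, Set.mem_Ioi] at hu hv
    rw [Real.cosh_le_cosh, abs_of_pos hu, abs_of_pos hv]; exact huv
  have := hc.2 (show (0:ℝ) ∈ _ by simp) (show a ∈ _ by simp [ha.le])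
    (show 0 ≤ 1 - x / a by rw [sub_nonneg, div_le_one ha]; exact hxa)
    (show 0 ≤ x / a by positivity) (by ring)
  simp only [smul_eq_mul, mul_zero, zero_add, Real.sinh_zero] at this
  rw [div_mul_cancel₀ _ ha.ne'] at this
  rw [div_mul_eq_mul_div, le_div_iff₀ ha] at this
  exact this

theorem sin_ratio {x a : ℝ} (hx : 0 ≤ x) (hxa : x ≤ a) (ha1 : a ≤ 1) :
    x * Real.sin a ≤ Real.sin x * a := by
  rcases eq_or_lt_of_le hx with rfl | hx
  · simp
  have ha : 0 < a := lt_of_lt_of_le hx hxa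
  have hpi : (1 : ℝ) ≤ Real.pi := by linarith [Real.pi_gt_three]
  have hc : ConcaveOn ℝ (Set.Icc 0 Real.pi) Real.sin := strictConcaveOn_sin_Icc.concaveOn
  have := hc.2 (show (0:ℝ) ∈ _ by simp [Real.pi_pos.le])
    (show a ∈ _ by constructor <;> linarith)
    (show 0 ≤ 1 - x / a by rw [sub_nonneg, div_le_one ha]; exact hxa)
    (show 0 ≤ x / a by positivity) (by ring)
  simp only [smul_eq_mul, mul_zero, zero_add, Real.sin_zero] at this
  rw [div_mul_cancel₀ _ ha.ne'] at this
  rw [div_mul_eq_mul_div, div_le_iff₀ ha] at this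
  exact this

/-- hyperbolic cosine of the comparison angle -/
def cH (a b c : ℝ) : ℝ :=
  (Real.cosh a * Real.cosh b - Real.cosh c) / (Real.sinh a * Real.sinh b)

theorem cosh_sub_half (a b c : ℝ) : Real.cosh c - Real.cosh (a - b) =
    2 * Real.sinh ((c + a - b) / 2) * Real.sinh ((c - a + b) / 2) := by
  have h1 : c = (c + a - b) / 2 + (c - a + b) / 2 := by ring
  have h2 : a - b = (c + a - b) / 2 - (c - a + b) / 2 := by ring
  conv_lhs => rw [h2]
  conv_lhs => rw [h1]
  rw [← h1]
  rw [Real.cosh_sub]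
  conv_lhs => rw [h1, Real.cosh_add]
  rw [← h1]; ring

theorem cos_sub_half (a b c : ℝ) : Real.cos (a - b) - Real.cos c =
    2 * Real.sin ((c + a - b) / 2) * Real.sin ((c - a + b) / 2) := by
  have h1 : c = (c + a - b) / 2 + (c - a + b) / 2 := by ring
  have h2 : a - b = (c + a - b) / 2 - (c - a + b) / 2 := by ring
  have e1 := Real.cos_add ((c + a - b) / 2) ((c - a + b) / 2)
  have e2 := Real.cos_sub ((c + a - b) / 2) ((c - a + b) / 2)
  rw [← h1] at e1
  rw [← h2] at e2
  rw [e1, e2]; ring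

theorem one_sub_cH {a b c : ℝ} (ha : 0 < a) (hb : 0 < b) : 1 - cH a b c =
    2 * Real.sinh ((c + a - b) / 2) * Real.sinh ((c - a + b) / 2) / (Real.sinh a * Real.sinh b) := by
  have h1 := Real.sinh_pos_iff.2 ha
  have h2 := Real.sinh_pos_iff.2 hb
  rw [← cosh_sub_half, cH, Real.cosh_sub]
  field_simp
  ring

theorem cH_euclid {a b c : ℝ} (ha : 0 < a) (hb : 0 < b) (h1 : a ≤ b + c) (h2 : b ≤ a + c)
    (h3 : c ≤ a + b) : (a ^ 2 + b ^ 2 - c ^ 2) / (2 * a * b) ≤ cH a b c := by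
  have s1 := Real.sinh_pos_iff.2 ha
  have s2 := Real.sinh_pos_iff.2 hb
  have e : 1 - cH a b c ≤ 1 - (a ^ 2 + b ^ 2 - c ^ 2) / (2 * a * b) := by
    rw [one_sub_cH ha hb]
    have : 1 - (a ^ 2 + b ^ 2 - c ^ 2) / (2 * a * b) =
      2 * ((c + a - b) / 2) * ((c - a + b) / 2) / (a * b) := by field_simp; ring
    rw [this, div_le_div_iff₀ (by positivity) (by positivity)]
    have u1 := sinh_ratio (x := (c + a - b) / 2) (a := a) (by linarith) (by linarith)
    have u2 := sinh_ratio (x := (c - a + b) / 2) (a := b) (by linarith) (by linarith)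
    have := mul_le_mul u1 u2 (mul_nonneg (Real.sinh_nonneg_iff.2 (by linarith)) hb.le)
      (mul_nonneg (by linarith) s1.le)
    nlinarith
  linarith

theorem cH_sph {a b c : ℝ} (ha : 0 < a) (hb : 0 < b) (h1 : a ≤ b + c) (h2 : b ≤ a + c)
    (h3 : c ≤ a + b) (ha1 : a ≤ 1) (hb1 : b ≤ 1) :
    (Real.cos c - Real.cos a * Real.cos b) / (Real.sin a * Real.sin b) ≤ cH a b c := by
  have s1 := Real.sinh_pos_iff.2 ha
  have s2 := Real.sinh_pos_iff.2 hb
  have hpi : (1 : ℝ) < Real.pi := by linarith [Real.pi_gt_three]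
  have t1 := Real.sin_pos_of_pos_of_lt_pi ha (by linarith)
  have t2 := Real.sin_pos_of_pos_of_lt_pi hb (by linarith)
  have e : 1 - cH a b c ≤ 1 - (Real.cos c - Real.cos a * Real.cos b) / (Real.sin a * Real.sin b) := by
    rw [one_sub_cH ha hb]
    have : 1 - (Real.cos c - Real.cos a * Real.cos b) / (Real.sin a * Real.sin b) =
      2 * Real.sin ((c + a - b) / 2) * Real.sin ((c - a + b) / 2) / (Real.sin a * Real.sin b) := by
      rw [← cos_sub_half, Real.cos_sub]; field_simp; ring
    rw [this, div_le_div_iff₀ (by positivity) (by positivity)]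
    have u1 := sinh_ratio (x := (c + a - b) / 2) (a := a) (by linarith) (by linarith)
    have u2 := sinh_ratio (x := (c - a + b) / 2) (a := b) (by linarith) (by linarith)
    have v1 := sin_ratio (x := (c + a - b) / 2) (a := a) (by linarith) (by linarith) ha1
    have v2 := sin_ratio (x := (c - a + b) / 2) (a := b) (by linarith) (by linarith) hb1
    have key : ∀ x a : ℝ, 0 ≤ x → 0 < a → x ≤ a → a ≤ 1 →
        Real.sinh x * Real.sin a ≤ Real.sin x * Real.sinh a := by
      intro x a hx ha hxa ha1
      have u1 := sinh_ratio hx hxa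
      have v1 := sin_ratio hx hxa ha1
      have t1 := Real.sin_pos_of_pos_of_lt_pi ha (by linarith)
      have s1 := Real.sinh_pos_iff.2 ha
      have := mul_le_mul_of_nonneg_right u1 t1.le
      have := mul_le_mul_of_nonneg_right v1 s1.le
      nlinarith
    have w1 := key ((c + a - b) / 2) a (by linarith) ha (by linarith) ha1
    have w2 := key ((c - a + b) / 2) b (by linarith) hb (by linarith) hb1
    have := mul_le_mul w1 w2 (mul_nonneg (Real.sinh_nonneg_iff.2 (by linarith)) t2.le)
      (mul_nonneg (Real.sin_nonneg_of_nonneg_of_le_pi (by linarith) (by linarith)) s1.le)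
    nlinarith
  linarith

theorem cmpAngle_ge (κ : ℝ) : ∃ lam : ℝ, 0 < lam ∧ ∀ a b c : ℝ, 0 < a → 0 < b →
    a ≤ b + c → b ≤ a + c → c ≤ a + b → lam * a ≤ 1 → lam * b ≤ 1 →
    Real.arccos (cH (lam * a) (lam * b) (lam * c)) ≤ cmpAngle κ a b c := by
  rcases lt_trichotomy κ 0 with h | h | h
  · refine ⟨Real.sqrt (-κ), Real.sqrt_pos.2 (by linarith), fun a b c ha hb h1 h2 h3 h4 h5 => ?_⟩
    rw [cmpAngle, if_neg h.ne, if_neg (not_lt.2 h.le)]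
    rfl
  · refine ⟨1, one_pos, fun a b c ha hb h1 h2 h3 h4 h5 => ?_⟩
    rw [cmpAngle, if_pos h]
    simp only [one_mul]
    exact Real.antitone_arccos (cH_euclid ha hb h1 h2 h3)
  · have hs := Real.sqrt_pos.2 h
    refine ⟨Real.sqrt κ, hs, fun a b c ha hb h1 h2 h3 h4 h5 => ?_⟩
    rw [cmpAngle, if_neg h.ne', if_pos h]
    refine Real.antitone_arccos (cH_sph (by positivity) (by positivity) ?_ ?_ ?_ h4 h5)
    all_goals rw [← mul_add]; exact mul_le_mul_of_nonneg_left (by assumption) hs.le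

theorem cH_mem {a b c : ℝ} (ha : 0 < a) (hb : 0 < b) (h1 : a ≤ b + c) (h2 : b ≤ a + c)
    (h3 : c ≤ a + b) : -1 ≤ cH a b c ∧ cH a b c ≤ 1 := by
  have s1 := Real.sinh_pos_iff.2 ha
  have s2 := Real.sinh_pos_iff.2 hb
  constructor
  · rw [cH, le_div_iff₀ (by positivity)]
    have : Real.cosh c ≤ Real.cosh (a + b) := by
      rw [Real.cosh_le_cosh, abs_of_nonneg (by linarith), abs_of_nonneg (by linarith)]; exact h3
    rw [Real.cosh_add] at this
    linarith
  · have : 0 ≤ 1 - cH a b c := by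
      rw [one_sub_cH ha hb]
      have := Real.sinh_nonneg_iff.2 (show 0 ≤ (c + a - b) / 2 by linarith)
      have := Real.sinh_nonneg_iff.2 (show 0 ≤ (c - a + b) / 2 by linarith)
      positivity
    linarith

theorem loc_of_alexandrov {X : Type} [MetricSpace X] {n : ℕ} {κ : ℝ} (hX : IsAlexandrovSpace X n κ) :
    ∃ lam, Loc X lam := by
  obtain ⟨lam, hl, H⟩ := cmpAngle_ge κ
  refine ⟨lam, hl, hX.midpoint, ?_⟩
  intro x y Y m hb h1 h2 h3
  by_cases hxy : x = y
  · subst hxy; simp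
  by_cases hYy : Y = y
  · subst hYy; simp
  by_cases hmy : m = y
  · subst hmy
    simp only [dist_self, mul_zero, Real.cosh_zero, mul_one]
    rw [← hb, mul_add, Real.sinh_add, dist_comm Y m]
    linarith
  have p1 : 0 < dist y x := dist_pos.2 (Ne.symm hxy)
  have p2 : 0 < dist y Y := dist_pos.2 (Ne.symm hYy)
  have p3 : 0 < dist y m := dist_pos.2 (Ne.symm hmy)
  have hc := hX.curv y x Y m hxy hYy hmy
  rw [dist_comm x y] at hb h1
  have a1 := H (dist y x) (dist y Y) (dist x Y) p1 p2 (by linarith) (by linarith) (by linarith) h1 h2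
  have a2 := H (dist y Y) (dist y m) (dist Y m) p2 p3
    (by linarith [dist_triangle_right y Y m]) (by linarith [dist_triangle y Y m])
    (by linarith [dist_triangle_left Y m y]) h2 h3
  have a3 := H (dist y m) (dist y x) (dist m x) p3 p1
    (by linarith [dist_triangle_right y m x]) (by linarith [dist_triangle y m x])
    (by linarith [dist_triangle_left m x y]) h3 h1
  have e1 : cH (lam * dist y x) (lam * dist y Y) (lam * dist x Y) = -1 := by
    have s1 := Real.sinh_pos_iff.2 (mul_pos hl p1)
    have s2 := Real.sinh_pos_iff.2 (mul_pos hl p2)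
    rw [cH, ← hb, mul_add, Real.cosh_add]
    field_simp
    ring
  rw [e1, Real.arccos_neg_one] at a1
  have scal : ∀ u v w : ℝ, u ≤ v + w → lam * u ≤ lam * v + lam * w := fun u v w h => by
    rw [← mul_add]; exact mul_le_mul_of_nonneg_left h hl.le
  have m2 := cH_mem (mul_pos hl p2) (mul_pos hl p3) (c := lam * dist Y m)
    (scal _ _ _ (by linarith [dist_triangle_right y Y m])) (scal _ _ _ (by linarith [dist_triangle y Y m]))
    (scal _ _ _ (by linarith [dist_triangle_left Y m y]))
  have m3 := cH_mem (mul_pos hl p3) (mul_pos hl p1) (c := lam * dist m x)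
    (scal _ _ _ (by linarith [dist_triangle_right y m x])) (scal _ _ _ (by linarith [dist_triangle y m x]))
    (scal _ _ _ (by linarith [dist_triangle_left m x y]))
  set v2 := cH (lam * dist y Y) (lam * dist y m) (lam * dist Y m) with hv2
  set v3 := cH (lam * dist y m) (lam * dist y x) (lam * dist m x) with hv3
  have hle : Real.arccos v2 ≤ Real.pi - Real.arccos v3 := by linarith
  have hcos := Real.cos_le_cos_of_nonneg_of_le_pi (Real.arccos_nonneg v2)
    (by linarith [Real.arccos_nonneg v3]) hle
  rw [Real.cos_pi_sub, Real.cos_arccos m2.1 m2.2, Real.cos_arccos m3.1 m3.2] at hcos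
  have s1 := Real.sinh_pos_iff.2 (mul_pos hl p1)
  have s2 := Real.sinh_pos_iff.2 (mul_pos hl p2)
  have s3 := Real.sinh_pos_iff.2 (mul_pos hl p3)
  have q2 : v2 * (Real.sinh (lam * dist y Y) * Real.sinh (lam * dist y m)) =
      Real.cosh (lam * dist y Y) * Real.cosh (lam * dist y m) - Real.cosh (lam * dist Y m) := by
    rw [hv2, cH]; field_simp
  have q3 : v3 * (Real.sinh (lam * dist y m) * Real.sinh (lam * dist y x)) =
      Real.cosh (lam * dist y m) * Real.cosh (lam * dist y x) - Real.cosh (lam * dist m x) := by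
    rw [hv3, cH]; field_simp
  have hpos : 0 ≤ (v2 + v3) * (Real.sinh (lam * dist y x) * Real.sinh (lam * dist y Y) *
      Real.sinh (lam * dist y m)) := mul_nonneg (by linarith) (by positivity)
  have hexp : (v2 + v3) * (Real.sinh (lam * dist y x) * Real.sinh (lam * dist y Y) *
      Real.sinh (lam * dist y m)) = Real.sinh (lam * dist y x) *
      (Real.cosh (lam * dist y Y) * Real.cosh (lam * dist y m) - Real.cosh (lam * dist Y m)) +
      Real.sinh (lam * dist y Y) *
      (Real.cosh (lam * dist y m) * Real.cosh (lam * dist y x) - Real.cosh (lam * dist m x)) := by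
    rw [← q2, ← q3]; ring
  rw [hexp] at hpos
  rw [← hb, mul_add, Real.sinh_add, dist_comm x y, dist_comm x m]
  nlinarith

end


section

theorem cosh_ub {u : ℝ} (hu : |u| ≤ 1) : Real.cosh u ≤ 1 + u^2/2 + u^4/4 := by
  have h1 := Real.cosh_le_exp_half_sq u
  have h2 : u^2 ≤ 1 := by rw [← sq_abs]; exact pow_le_one₀ (abs_nonneg _) hu
  have h3 := Real.abs_exp_sub_one_sub_id_le (x := u^2/2) (by rw [abs_of_nonneg (by positivity)]; linarith)
  have h4 := (abs_le.1 h3).2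
  nlinarith

theorem cosh_lb (u : ℝ) : 1 + u^2/2 ≤ Real.cosh u := by
  have h1 : Real.cosh u = 1 + 2 * Real.sinh (u/2)^2 := by
    have := Real.cosh_two_mul (u/2)
    have h2 := Real.cosh_sq (u/2)
    rw [show 2 * (u/2) = u by ring] at this
    rw [this, h2]; ring
  have h2 : (u/2)^2 ≤ Real.sinh (u/2)^2 := by
    rw [← sq_abs, ← sq_abs (Real.sinh _), Real.abs_sinh]
    exact pow_le_pow_left₀ (abs_nonneg _) (Real.self_le_sinh_iff.2 (abs_nonneg _)) 2
  rw [h1]; nlinarith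

theorem sinh_lb3 {u : ℝ} (hu : 0 ≤ u) : u + u^3/6 ≤ Real.sinh u := by
  have hm : MonotoneOn (fun u : ℝ => Real.sinh u - (u + u^3/6)) (Ici 0) := by
    apply monotoneOn_of_deriv_nonneg (convex_Ici 0) (by fun_prop) (by fun_prop)
    intro x hx
    have hd : HasDerivAt (fun u : ℝ => Real.sinh u - (u + u^3/6)) (Real.cosh x - (1 + (3 * x^2)/6)) x := by
      have := ((hasDerivAt_pow 3 x).div_const 6)
      exact HasDerivAt.congr_deriv (HasDerivAt.fun_sub (Real.hasDerivAt_sinh x) (HasDerivAt.fun_add (hasDerivAt_id x) this)) (by norm_num)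
    rw [hd.deriv]; have := cosh_lb x; linarith
  have := hm (mem_Ici.2 le_rfl) hu hu
  simp at this; linarith

theorem sinh_ub5 {u : ℝ} (hu : 0 ≤ u) (hu1 : u ≤ 1) : Real.sinh u ≤ u + u^3/6 + u^5/20 := by
  have hm : MonotoneOn (fun u : ℝ => (u + u^3/6 + u^5/20) - Real.sinh u) (Icc 0 1) := by
    apply monotoneOn_of_deriv_nonneg (convex_Icc 0 1) (by fun_prop) (by fun_prop)
    intro x hx
    have hx' := interior_subset hx
    have hd : HasDerivAt (fun u : ℝ => (u + u^3/6 + u^5/20) - Real.sinh u) ((1 + (3 * x^2)/6 + (5*x^4)/20) - Real.cosh x) x := by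
      have h3 := ((hasDerivAt_pow 3 x).div_const 6)
      have h5 := ((hasDerivAt_pow 5 x).div_const 20)
      exact HasDerivAt.congr_deriv (HasDerivAt.fun_sub (HasDerivAt.fun_add (HasDerivAt.fun_add (hasDerivAt_id x) h3) h5) (Real.hasDerivAt_sinh x)) (by norm_num)
    rw [hd.deriv]; have := cosh_ub (u := x) (by rw [abs_of_nonneg hx'.1]; exact hx'.2); linarith
  have := hm (left_mem_Icc.2 zero_le_one) ⟨hu, hu1⟩ hu
  simp at this; linarith

theorem sinh_ub2 {u : ℝ} (hu : 0 ≤ u) (hu1 : u ≤ 1) : Real.sinh u ≤ 2 * u := by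
  have := sinh_ub5 hu hu1
  have h3 : u^3 ≤ u := by nlinarith [mul_nonneg hu hu, mul_nonneg (mul_nonneg hu hu) hu]
  have h5 : u^5 ≤ u := by
    have : u^5 = u^3 * u^2 := by ring
    have h2 : u^2 ≤ 1 := pow_le_one₀ hu hu1
    have h0 : 0 ≤ u^3 := by positivity
    nlinarith
  linarith

variable {X : Type} [MetricSpace X] {lam : ℝ}

theorem Loc.mi (h : Loc X lam) {x m Y q : X} (h1 : dist x m = dist x Y / 2) (h2 : dist m Y = dist x Y / 2)
    (h3 : lam * dist x Y ≤ 2) (h4 : lam * dist m q ≤ 1) :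
    Real.cosh (lam * dist x q) + Real.cosh (lam * dist Y q) ≤
      2 * Real.cosh (lam * dist x Y / 2) * Real.cosh (lam * dist m q) := by
  rcases eq_or_lt_of_le (dist_nonneg (x := x) (y := Y)) with h0 | h0
  · have e1 : x = m := dist_eq_zero.1 (by rw [h1, ← h0]; simp)
    have e2 : m = Y := dist_eq_zero.1 (by rw [h2, ← h0]; simp)
    subst e1; subst e2; simp; linarith
  have hl := h.pos
  have := h.stew x m Y q (by rw [h1, h2]; ring) (by rw [h1]; linarith) (by rw [h2]; linarith) h4
  rw [h1, h2] at this
  have hs : 0 < Real.sinh (lam * (dist x Y / 2)) := by rw [Real.sinh_pos_iff]; positivity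
  have h5 : Real.sinh (lam * dist x Y) = 2 * Real.sinh (lam * (dist x Y / 2)) * Real.cosh (lam * (dist x Y / 2)) := by
    rw [← Real.sinh_two_mul]; congr 1; ring
  rw [h5] at this
  rw [show lam * dist x Y / 2 = lam * (dist x Y / 2) by ring]
  refine le_of_mul_le_mul_left ?_ hs
  linarith

/-- chosen midpoint -/
def Loc.md (h : Loc X lam) (z y : X) : X := Classical.choose (h.mid z y)

theorem Loc.md1 (h : Loc X lam) (z y : X) : dist z (h.md z y) = dist z y / 2 := (Classical.choose_spec (h.mid z y)).1
theorem Loc.md2 (h : Loc X lam) (z y : X) : dist (h.md z y) y = dist z y / 2 := (Classical.choose_spec (h.mid z y)).2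

/-- contraction towards z -/
def Loc.ct (h : Loc X lam) (z : X) (k : ℕ) (y : X) : X := (h.md z)^[k] y

theorem Loc.ct_zero (h : Loc X lam) (z y : X) : h.ct z 0 y = y := rfl
theorem Loc.ct_succ (h : Loc X lam) (z : X) (k : ℕ) (y : X) : h.ct z (k+1) y = h.md z (h.ct z k y) :=
  Function.iterate_succ_apply' _ _ _
theorem Loc.ct_add (h : Loc X lam) (z : X) (j k : ℕ) (y : X) : h.ct z (j+k) y = h.ct z j (h.ct z k y) :=
  Function.iterate_add_apply _ _ _ _

theorem Loc.ct_dist (h : Loc X lam) (z : X) (k : ℕ) (y : X) : dist z (h.ct z k y) = dist z y / 2^k := by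
  induction k with
  | zero => simp [h.ct_zero]
  | succ k ih => rw [h.ct_succ, h.md1, ih, pow_succ]; field_simp

theorem Loc.ct_dist2 (h : Loc X lam) (z : X) (k : ℕ) (y : X) :
    dist (h.ct z k y) y ≤ dist z y - dist z y / 2^k := by
  induction k with
  | zero => simp [h.ct_zero]
  | succ k ih =>
    have h1 := dist_triangle (h.ct z (k+1) y) (h.ct z k y) y
    rw [h.ct_succ, h.md2, h.ct_dist] at h1
    rw [h.ct_succ]
    rw [pow_succ]
    have : dist z y / (2^k*2) = dist z y / 2^k / 2 := by field_simp
    rw [this]; linarith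

/-- squared hyperbolic chord -/
def Sh (lam : ℝ) (y z : X) : ℝ := Real.sinh (lam * dist y z / 2)^2

theorem Sh_cosh (lam : ℝ) (y z : X) : Real.cosh (lam * dist y z) = 1 + 2 * Sh lam y z := by
  have := Real.cosh_two_mul (lam * dist y z/2)
  have h2 := Real.cosh_sq (lam * dist y z/2)
  rw [show 2 * (lam * dist y z/2) = lam * dist y z by ring] at this
  rw [this, h2, Sh]; ring

theorem Loc.md_Sh (h : Loc X lam) (p y z : X) (hy : lam * dist p y ≤ 1/2) (hz : lam * dist p z ≤ 1/2) :
    Sh lam y z ≤ 4 * Real.cosh (lam * dist p y / 2) * Real.cosh (lam * dist p z / 2) * Sh lam (h.md p y) (h.md p z) := by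
  have hl := h.pos
  have b1 : lam * dist (h.md p z) y ≤ 1 := by
    have := dist_triangle_left (h.md p z) y p
    rw [h.md1] at this
    have h3 := mul_le_mul_of_nonneg_left this hl.le
    nlinarith [dist_nonneg (x := p) (y := z)]
  have b2 : lam * dist (h.md p y) (h.md p z) ≤ 1 := by
    have := dist_triangle_left (h.md p y) (h.md p z) p
    rw [h.md1, h.md1] at this
    have h3 := mul_le_mul_of_nonneg_left this hl.le
    nlinarith [dist_nonneg (x := p) (y := z), dist_nonneg (x := p) (y := y)]
  have m1 := h.mi (h.md1 p y) (h.md2 p y) (q := h.md p z) (by linarith) b2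
  have m2 := h.mi (h.md1 p z) (h.md2 p z) (q := y) (by linarith) b1
  rw [Sh_cosh lam (h.md p y)] at m1
  rw [h.md1 p z] at m1
  rw [Sh_cosh lam z y, dist_comm (h.md p z) y] at m2
  have e : Sh lam y z = Sh lam z y := by rw [Sh, Sh, dist_comm]
  rw [e]
  set a := lam * dist p y / 2
  set b := lam * dist p z / 2
  have ea : Real.cosh (lam * dist p y) = 2 * Real.cosh a ^ 2 - 1 := by
    rw [show lam * dist p y = 2 * a by simp only [a]; ring, Real.cosh_two_mul, Real.sinh_sq]; ring
  rw [show lam * (dist p z / 2) = b by simp only [b]; ring] at m1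
  rw [ea] at m2
  have ca := Real.one_le_cosh a
  have cb := Real.one_le_cosh b
  have m3 := mul_le_mul_of_nonneg_left m1 (by linarith : (0:ℝ) ≤ 2 * Real.cosh b)
  nlinarith [sq_nonneg (Real.cosh a - Real.cosh b)]

theorem Loc.ct_Sh (h : Loc X lam) (p y z : X) (hy : lam * dist p y ≤ 1/2) (hz : lam * dist p z ≤ 1/2) (k : ℕ) :
    Sh lam y z * (Real.sinh (lam * dist p (h.ct p k y)) * Real.sinh (lam * dist p (h.ct p k z))) ≤
    Sh lam (h.ct p k y) (h.ct p k z) * (Real.sinh (lam * dist p y) * Real.sinh (lam * dist p z)) := by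
  have hl := h.pos
  induction k with
  | zero => simp [h.ct_zero]
  | succ k ih =>
    rw [h.ct_succ, h.ct_succ]
    have hy' : lam * dist p (h.ct p k y) ≤ 1/2 := by
      rw [h.ct_dist]
      refine le_trans (mul_le_mul_of_nonneg_left (div_le_self dist_nonneg (one_le_pow₀ (by norm_num))) hl.le) hy
    have hz' : lam * dist p (h.ct p k z) ≤ 1/2 := by
      rw [h.ct_dist]
      refine le_trans (mul_le_mul_of_nonneg_left (div_le_self dist_nonneg (one_le_pow₀ (by norm_num))) hl.le) hz
    have s := h.md_Sh p _ _ hy' hz'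
    rw [h.md1, h.md1]
    set y' := h.ct p k y
    set z' := h.ct p k z
    set a := lam * dist p y' / 2 with ha
    set b := lam * dist p z' / 2 with hb
    rw [show lam * (dist p y' / 2) = a by simp only [a]; ring, show lam * (dist p z' / 2) = b by simp only [b]; ring]
    rw [show lam * dist p y' = 2 * a by simp only [a]; ring, show lam * dist p z' = 2 * b by simp only [b]; ring,
      Real.sinh_two_mul, Real.sinh_two_mul] at ih
    have ca := Real.one_le_cosh a
    have cb := Real.one_le_cosh b
    have s1 : 0 ≤ Real.sinh (lam * dist p y) := Real.sinh_nonneg_iff.2 (by positivity)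
    have s2 : 0 ≤ Real.sinh (lam * dist p z) := Real.sinh_nonneg_iff.2 (by positivity)
    have s3 := mul_le_mul_of_nonneg_right s (mul_nonneg s1 s2)
    have hpos : 0 < 4 * Real.cosh a * Real.cosh b := by positivity
    refine le_of_mul_le_mul_left ?_ hpos
    nlinarith

theorem Loc.ct_sep (h : Loc X lam) (p y z : X) (hy : lam * dist p y ≤ 1/2) (hz : lam * dist p z ≤ 1/2) (k : ℕ) :
    dist y z / 4 / 2^k ≤ dist (h.ct p k y) (h.ct p k z) := by
  have hl := h.pos
  by_cases hpy : p = y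
  · subst hpy
    have e : h.ct p k p = p := by
      apply Eq.symm; apply dist_eq_zero.1; rw [h.ct_dist]; simp
    rw [e, h.ct_dist]
    apply div_le_div_of_nonneg_right _ (by positivity)
    linarith [dist_nonneg (x := p) (y := z)]
  by_cases hpz : p = z
  · subst hpz
    have e : h.ct p k p = p := by
      apply Eq.symm; apply dist_eq_zero.1; rw [h.ct_dist]; simp
    rw [e, dist_comm (h.ct p k y) p, h.ct_dist, dist_comm y p]
    apply div_le_div_of_nonneg_right _ (by positivity)
    linarith [dist_nonneg (x := p) (y := y)]
  have hpy' : 0 < dist p y := dist_pos.2 hpy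
  have hpz' : 0 < dist p z := dist_pos.2 hpz
  have s := h.ct_Sh p y z hy hz k
  rw [h.ct_dist, h.ct_dist] at s
  have a1 : lam * (dist p y / 2^k) ≤ Real.sinh (lam * (dist p y / 2^k)) := Real.self_le_sinh_iff.2 (by positivity)
  have a2 : lam * (dist p z / 2^k) ≤ Real.sinh (lam * (dist p z / 2^k)) := Real.self_le_sinh_iff.2 (by positivity)
  have b1 := sinh_ub2 (u := lam * dist p y) (by positivity) (by linarith)
  have b2 := sinh_ub2 (u := lam * dist p z) (by positivity) (by linarith)
  have hb1 : 0 < Real.sinh (lam * dist p y) := Real.sinh_pos_iff.2 (by positivity)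
  have hb2 : 0 < Real.sinh (lam * dist p z) := Real.sinh_pos_iff.2 (by positivity)
  set w := dist (h.ct p k y) (h.ct p k z) with hw
  have hS1 : (lam * dist y z / 2)^2 ≤ Sh lam y z :=
    pow_le_pow_left₀ (by positivity) (Real.self_le_sinh_iff.2 (by positivity)) 2
  have hw1 : lam * w ≤ 1 := by
    have := dist_triangle_left (h.ct p k y) (h.ct p k z) p
    rw [h.ct_dist, h.ct_dist] at this
    have q1 : dist p y / 2^k ≤ dist p y := div_le_self dist_nonneg (one_le_pow₀ (by norm_num))
    have q2 : dist p z / 2^k ≤ dist p z := div_le_self dist_nonneg (one_le_pow₀ (by norm_num))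
    have h3 := mul_le_mul_of_nonneg_left (this.trans (add_le_add q1 q2)) hl.le
    linarith
  have hw0 : 0 ≤ w := dist_nonneg
  have hS2 : Sh lam (h.ct p k y) (h.ct p k z) ≤ (2 * (lam * w / 2))^2 :=
    pow_le_pow_left₀ (Real.sinh_nonneg_iff.2 (by positivity)) (sinh_ub2 (by positivity) (by linarith)) 2
  have c1 : (lam * dist y z / 2)^2 * ((lam * (dist p y / 2^k)) * (lam * (dist p z / 2^k))) ≤
      (2 * (lam * w / 2))^2 * ((2 * (lam * dist p y)) * (2 * (lam * dist p z))) := by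
    refine le_trans ?_ (s.trans ?_)
    · apply mul_le_mul hS1 (mul_le_mul a1 a2 (by positivity) (Real.sinh_nonneg_iff.2 (by positivity)))
        (by positivity) (by unfold Sh; positivity)
    · apply mul_le_mul hS2 (mul_le_mul b1 b2 hb2.le (by positivity)) (by positivity) (by positivity)
  have c2 : (dist y z / 4 / 2^k)^2 ≤ w^2 := by
    have hP : 0 < lam^4 * dist p y * dist p z := by positivity
    have e1 : (lam * dist y z / 2)^2 * ((lam * (dist p y / 2^k)) * (lam * (dist p z / 2^k))) =
      (lam^4 * dist p y * dist p z) * (4 * (dist y z / 4 / 2^k)^2) := by ring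
    have e2 : (2 * (lam * w / 2))^2 * ((2 * (lam * dist p y)) * (2 * (lam * dist p z))) =
      (lam^4 * dist p y * dist p z) * (4 * w^2) := by ring
    rw [e1, e2] at c1
    have := le_of_mul_le_mul_left c1 hP
    linarith
  exact le_of_sq_le_sq c2 hw0

end


section

variable {X : Type} [MetricSpace X] {lam : ℝ}

/-- separated finite set -/
def Sepd (F : Finset X) (s : ℝ) : Prop := ∀ x ∈ F, ∀ y ∈ F, x ≠ y → s ≤ dist x y

theorem Loc.transport [DecidableEq X] (h : Loc X lam) {F : Finset X} {z w : X} {R D s θ : ℝ} (hF : ∀ x ∈ F, dist z x ≤ R)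
    (hs : 0 < s) (hsep : Sepd F s) (hw : dist z w ≤ D) (hlam : lam * (R + D) ≤ 1/2) (hθ : 0 < θ) (hθR : θ ≤ R + D) :
    ∃ k : ℕ, (∀ x ∈ F, dist w (h.ct w k x) ≤ θ) ∧ (∀ x ∈ F, ∀ y ∈ F, x ≠ y →
      s * θ / (8 * (R + D)) ≤ dist (h.ct w k x) (h.ct w k y)) := by
  have hl := h.pos
  have hA : 0 < R + D := by linarith
  set A := R + D with hAdef
  have hex : ∃ k : ℕ, A / 2^k ≤ θ := by
    obtain ⟨k, hk⟩ := exists_pow_lt_of_lt_one (show 0 < θ / A by positivity) (show (1/2:ℝ) < 1 by norm_num)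
    refine ⟨k, ?_⟩
    rw [lt_div_iff₀ hA] at hk
    rw [one_div, inv_pow] at hk
    rw [div_eq_inv_mul]; exact hk.le
  classical
  set k := Nat.find hex with hk
  have hk1 : A / 2^k ≤ θ := Nat.find_spec hex
  have hk2 : θ / (2 * A) ≤ 1 / 2^k := by
    rw [div_le_div_iff₀ (by positivity) (by positivity)]
    rcases Nat.eq_zero_or_pos k with h0 | h0
    · rw [h0]; simp; linarith
    · have := Nat.find_min hex (m := k-1) (by omega)
      push Not at this
      rw [lt_div_iff₀ (by positivity)] at this
      have e : (2:ℝ)^k = 2^(k-1) * 2 := by rw [← pow_succ]; congr 1; omega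
      rw [e]; nlinarith
  have hFw : ∀ x ∈ F, dist w x ≤ A := fun x hx => by
    have := dist_triangle w z x; rw [dist_comm w z] at this; linarith [hF x hx]
  have hFl : ∀ x ∈ F, lam * dist w x ≤ 1/2 := fun x hx =>
    (mul_le_mul_of_nonneg_left (hFw x hx) hl.le).trans hlam
  refine ⟨k, fun x hx => ?_, fun x hx y hy hxy => ?_⟩
  · rw [h.ct_dist]
    exact (div_le_div_of_nonneg_right (hFw x hx) (by positivity)).trans hk1
  · refine le_trans ?_ (h.ct_sep w x y (hFl x hx) (hFl y hy) k)
    have h1 := hsep x hx y hy hxy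
    have e1 : s * θ / (8 * A) = (s/4) * (θ / (2 * A)) := by field_simp; norm_num
    have e2 : dist x y / 4 / 2^k = (dist x y/4) * (1 / 2^k) := by ring
    rw [e1, e2]
    apply mul_le_mul (by linarith) hk2 (by positivity) (by positivity)

theorem Loc.transport' [DecidableEq X] (h : Loc X lam) {F : Finset X} {z w : X} {R D s θ : ℝ} (hF : ∀ x ∈ F, dist z x ≤ R)
    (hs : 0 < s) (hsep : Sepd F s) (hw : dist z w ≤ D) (hlam : lam * (R + D) ≤ 1/2) (hθ : 0 < θ) (hθR : θ ≤ R + D) :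
    ∃ G : Finset X, G.card = F.card ∧ (∀ x ∈ G, dist w x ≤ θ) ∧ Sepd G (s * θ / (8 * (R + D))) := by
  obtain ⟨k, h1, h2⟩ := h.transport hF hs hsep hw hlam hθ hθR
  have hA : 0 < R + D := by linarith
  have hpos : 0 < s * θ / (8 * (R + D)) := by positivity
  refine ⟨F.image (h.ct w k), ?_, ?_, ?_⟩
  · apply Finset.card_image_of_injOn
    intro x hx y hy hxy
    by_contra hne
    have := h2 x hx y hy hne
    rw [hxy, dist_self] at this; linarith
  · intro x hx
    obtain ⟨y, hy, rfl⟩ := Finset.mem_image.1 hx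
    exact h1 y hy
  · intro x hx y hy hxy
    obtain ⟨x', hx', rfl⟩ := Finset.mem_image.1 hx
    obtain ⟨y', hy', rfl⟩ := Finset.mem_image.1 hy
    exact h2 x' hx' y' hy' (fun e => hxy (by rw [e]))

/-- local copies of a packing -/
theorem Loc.copies [DecidableEq X] (h : Loc X lam) {F : Finset X} {z : X} {R η : ℝ} (hR : 0 < R) (hη : 0 < η)
    (hF : ∀ x ∈ F, dist z x ≤ R) (hsep : Sepd F (η * R)) (hlam : lam * (4 * R) ≤ 1/2) (w : X) (θ : ℝ) (hθ : 0 < θ)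
    (hw : dist z w + θ ≤ 2 * R) :
    ∃ G : Finset X, G.card = F.card ∧ (∀ x ∈ G, dist w x ≤ θ / 2) ∧ Sepd G (4 * (η/192) * θ) := by
  have := dist_nonneg (x := z) (y := w)
  have hl := h.pos
  obtain ⟨G, g1, g2, g3⟩ := h.transport' hF (by positivity) hsep (D := 2 * R) (w := w) (by linarith) (by nlinarith)
    (θ := θ/2) (by linarith) (by linarith)
  refine ⟨G, g1, g2, fun x hx y hy hxy => ?_⟩
  refine le_trans (le_of_eq ?_) (g3 x hx y hy hxy)
  field_simp; norm_num

theorem Loc.power [DecidableEq X] (h : Loc X lam) {F : Finset X} {z : X} {R η : ℝ} (hR : 0 < R) (hη : 0 < η) (hη1 : η ≤ 1)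
    (hF : ∀ x ∈ F, dist z x ≤ R) (hsep : Sepd F (η * R)) (hlam : lam * (4 * R) ≤ 1/2) (j : ℕ) :
    ∀ (w : X) (θ : ℝ), 0 < θ → dist z w + θ ≤ 2 * R →
    ∃ G : Finset X, G.card = F.card ^ j ∧ (∀ x ∈ G, dist w x ≤ θ) ∧ Sepd G ((η/192)^j * θ) := by
  induction j with
  | zero =>
    intro w θ hθ hw
    refine ⟨{w}, by simp, ?_, ?_⟩
    · intro x hx; rw [Finset.mem_singleton.1 hx, dist_self]; exact hθ.le
    · intro x hx y hy hxy
      exact absurd ((Finset.mem_singleton.1 hx).trans (Finset.mem_singleton.1 hy).symm) hxy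
  | succ j ih =>
    intro w θ hθ hw
    set β := η/192 with hβ
    have hβ0 : 0 < β := by positivity
    have hβ1 : β ≤ 1/192 := by rw [hβ]; linarith
    obtain ⟨G, g1, g2, g3⟩ := h.copies hR hη hF hsep hlam w θ hθ hw
    rw [← hβ] at g3
    have hsub : ∀ u : X, ∃ Gu : Finset X, u ∈ G → (Gu.card = F.card ^ j ∧ (∀ x ∈ Gu, dist u x ≤ β * θ) ∧ Sepd Gu (β^j * (β * θ))) := by
      intro u
      by_cases hu : u ∈ G
      · obtain ⟨Gu, q⟩ := ih u (β * θ) (by positivity) (by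
          have := dist_triangle z w u; nlinarith [g2 u hu])
        exact ⟨Gu, fun _ => q⟩
      · exact ⟨∅, fun h => absurd h hu⟩
    choose Gu hGu using hsub
    have hdis : ∀ u ∈ G, ∀ v ∈ G, u ≠ v → ∀ x ∈ Gu u, ∀ y ∈ Gu v, 2 * β * θ ≤ dist x y := by
      intro u hu v hv huv x hx y hy
      have a1 := g3 u hu v hv huv
      have a2 := (hGu u hu).2.1 x hx
      have a3 := (hGu v hv).2.1 y hy
      have := dist_triangle4 u x y v
      rw [dist_comm y v] at this
      linarith
    have hβj : β^(j+1) ≤ β := by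
      rw [pow_succ]
      have : β^j ≤ 1 := pow_le_one₀ hβ0.le (by linarith)
      nlinarith
    refine ⟨G.biUnion Gu, ?_, ?_, ?_⟩
    · rw [Finset.card_biUnion, Finset.sum_congr rfl (fun u hu => (hGu u hu).1), Finset.sum_const, g1, pow_succ]
      · simp [mul_comm]
      · intro u hu v hv huv
        rw [Function.onFun, Finset.disjoint_left]
        intro x hx hy
        have := hdis u hu v hv huv x hx x hy
        rw [dist_self] at this
        have : 0 < 2 * β * θ := by positivity
        linarith
    · intro x hx
      obtain ⟨u, hu, hx⟩ := Finset.mem_biUnion.1 hx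
      have := dist_triangle w u x
      have a2 := (hGu u hu).2.1 x hx
      nlinarith [g2 u hu]
    · intro x hx y hy hxy
      obtain ⟨u, hu, hx⟩ := Finset.mem_biUnion.1 hx
      obtain ⟨v, hv, hy⟩ := Finset.mem_biUnion.1 hy
      by_cases huv : u = v
      · subst huv
        have := (hGu u hu).2.2 x hx y hy hxy
        rw [pow_succ, mul_assoc]; exact this
      · have := hdis u hu v hv huv x hx y hy
        nlinarith

theorem Loc.cover_sum [DecidableEq X] (h : Loc X lam) {F : Finset X} {z : X} {R η : ℝ} (hR : 0 < R) (hη : 0 < η) (hη1 : η ≤ 1)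
    (hF : ∀ x ∈ F, dist z x ≤ R) (hsep : Sepd F (η * R)) (hlam : lam * (4 * R) ≤ 1/2) (d : ℕ)
    (hbig : 1 ≤ F.card * (η/192)^d) {ι : Type} [DecidableEq ι] (T : Finset ι) (c : ι → X) (ρ : ι → ℝ) (hρ : ∀ i ∈ T, 0 < ρ i)
    (hcov : ∀ x : X, ∃ i ∈ T, dist (c i) x ≤ ρ i) :
    ((η/192) * R)^d ≤ ∑ i ∈ T, ρ i ^ d := by
  classical
  set β := η/192 with hβ
  have hβ0 : 0 < β := by positivity
  have hβ1 : β ≤ 1/192 := by rw [hβ]; linarith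
  obtain ⟨r, hr, hrT⟩ : ∃ r > 0, ∀ i ∈ T, r ≤ ρ i := by
    by_cases hT : T.Nonempty
    · exact ⟨T.inf' hT ρ, (Finset.lt_inf'_iff hT).2 hρ, fun i hi => Finset.inf'_le _ hi⟩
    · rw [Finset.not_nonempty_iff_eq_empty] at hT
      exact ⟨1, one_pos, by simp [hT]⟩
  let I : X → ℝ → Finset ι := fun w θ => T.filter (fun i => ∃ x, dist (c i) x ≤ ρ i ∧ dist w x ≤ θ)
  have key : ∀ j : ℕ, ∀ (w : X) (θ : ℝ), 0 < θ → dist z w + θ ≤ 2 * R → θ * β^j ≤ r →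
      (β * θ)^d ≤ ∑ i ∈ I w θ, ρ i ^ d := by
    intro j
    induction j with
    | zero =>
      intro w θ hθ hw hj
      simp at hj
      obtain ⟨i, hi, hx⟩ := hcov w
      have hmem : i ∈ I w θ := Finset.mem_filter.2 ⟨hi, w, hx, by simp [hθ.le]⟩
      have h1 : (β * θ)^d ≤ ρ i ^ d := pow_le_pow_left₀ (by positivity) (by nlinarith [hrT i hi]) d
      refine h1.trans (Finset.single_le_sum (f := fun i => ρ i ^ d) (fun k hk => ?_) hmem)
      have := hρ k (Finset.mem_filter.1 hk).1
      positivity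
    | succ j ih =>
      intro w θ hθ hw hj
      by_cases hc : ∃ i ∈ I w θ, β * θ ≤ ρ i
      · obtain ⟨i, hmem, hi⟩ := hc
        have h1 : (β * θ)^d ≤ ρ i ^ d := pow_le_pow_left₀ (by positivity) hi d
        refine h1.trans (Finset.single_le_sum (f := fun i => ρ i ^ d) (fun k hk => ?_) hmem)
        have := hρ k (Finset.mem_filter.1 hk).1
        positivity
      push Not at hc
      obtain ⟨G, g1, g2, g3⟩ := h.copies hR hη hF hsep hlam w θ hθ hw
      rw [← hβ] at g3
      have hsub : ∀ u ∈ G, I u (β * θ) ⊆ I w θ := by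
        intro u hu i hi
        obtain ⟨hi, x, hx1, hx2⟩ := Finset.mem_filter.1 hi
        refine Finset.mem_filter.2 ⟨hi, x, hx1, ?_⟩
        have := dist_triangle w u x
        nlinarith [g2 u hu]
      have hdisj : (G : Set X).PairwiseDisjoint (fun u => I u (β * θ)) := by
        intro u hu v hv huv
        rw [Function.onFun, Finset.disjoint_left]
        intro i hiu hiv
        have hlt := hc i (hsub u hu hiu)
        obtain ⟨_, x, hx1, hx2⟩ := Finset.mem_filter.1 hiu
        obtain ⟨_, y, hy1, hy2⟩ := Finset.mem_filter.1 hiv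
        have a1 := g3 u hu v hv huv
        have := dist_triangle4 u x y v
        have a4 := dist_triangle_left x y (c i)
        rw [dist_comm y v] at this
        linarith
      have h1 : ∑ u ∈ G, (β * (β * θ))^d ≤ ∑ u ∈ G, ∑ i ∈ I u (β * θ), ρ i ^ d := by
        apply Finset.sum_le_sum
        intro u hu
        apply ih u (β * θ) (by positivity)
        · have := dist_triangle z w u; nlinarith [g2 u hu]
        · calc β * θ * β^j = θ * β^(j+1) := by ring
            _ ≤ r := hj
      rw [← Finset.sum_biUnion hdisj, Finset.sum_const, nsmul_eq_mul, g1] at h1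
      have h2 : ∑ i ∈ G.biUnion (fun u => I u (β * θ)), ρ i ^ d ≤ ∑ i ∈ I w θ, ρ i ^ d := by
        apply Finset.sum_le_sum_of_subset_of_nonneg
        · exact Finset.biUnion_subset.2 hsub
        · intro k hk _
          have := hρ k (Finset.mem_filter.1 hk).1
          positivity
      have h3 : (β * θ)^d ≤ F.card * (β * (β * θ))^d := by
        rw [mul_pow β (β * θ), ← mul_assoc]
        exact le_mul_of_one_le_left (by positivity) hbig
      linarith
  obtain ⟨j, hj⟩ := exists_pow_lt_of_lt_one (show 0 < r / R by positivity) (show β < 1 by linarith)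
  rw [lt_div_iff₀ hR] at hj
  refine (key j z R hR (by simp; linarith) (by linarith)).trans ?_
  apply Finset.sum_le_sum_of_subset_of_nonneg (Finset.filter_subset _ _)
  intro k hk _
  have := hρ k hk
  positivity

end


section

variable {X : Type} [MetricSpace X] {lam : ℝ}

open MeasureTheory in
theorem small_covers [CompactSpace X] [Nonempty X] (d : ℕ) (hd : dimH (Set.univ : Set X) < d) {ε : ℝ} (hε : 0 < ε) :
    ∃ (T : Finset ℕ) (c : ℕ → X) (ρ : ℕ → ℝ), (∀ i ∈ T, 0 < ρ i) ∧ (∀ x : X, ∃ i ∈ T, dist (c i) x ≤ ρ i) ∧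
      ∑ i ∈ T, ρ i ^ d < ε := by
  classical
  borelize X
  have h0 : μH[((d:NNReal):ℝ)] (Set.univ : Set X) = 0 := hausdorffMeasure_of_dimH_lt (by simpa using hd)
  rw [Measure.hausdorffMeasure_apply] at h0
  have h1 := le_of_eq h0
  have h2 := (iSup₂_le_iff.1 h1) 1 one_pos
  have hε2 : (0:ENNReal) < ENNReal.ofReal (ε/2) := by simp; linarith
  have h3 := lt_of_le_of_lt h2 hε2
  simp only [iInf_lt_iff] at h3
  obtain ⟨t, ht, htd, hsum⟩ := h3
  obtain ⟨e, he, hesum⟩ := ENNReal.exists_pos_sum_of_countable hε2.ne' ℕ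
  have hρ : ∀ n, ∃ ρ : ℝ, Metric.diam (t n) < ρ ∧ ρ^d < Metric.diam (t n)^d + e n := by
    intro n
    have hc : ContinuousAt (fun r : ℝ => r^d) (Metric.diam (t n)) := (continuous_pow d).continuousAt
    have hev : ∀ᶠ r in nhds (Metric.diam (t n)), r^d < Metric.diam (t n)^d + e n :=
      hc.eventually_lt continuousAt_const (by have := he n; simpa using this)
    have := (hev.filter_mono nhdsWithin_le_nhds).and (self_mem_nhdsWithin (s := Set.Ioi (Metric.diam (t n))))
    obtain ⟨r, hr⟩ := this.exists
    exact ⟨r, hr.2, hr.1⟩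
  choose ρ hρ1 hρ2 using hρ
  have hc : ∀ n, ∃ c : X, (t n).Nonempty → c ∈ t n := by
    intro n
    by_cases hn : (t n).Nonempty
    · exact ⟨hn.some, fun _ => hn.some_mem⟩
    · exact ⟨Classical.arbitrary X, fun h => absurd h hn⟩
  choose c hc using hc
  have hpos : ∀ n, 0 < ρ n := fun n => lt_of_le_of_lt Metric.diam_nonneg (hρ1 n)
  have hfin : ∀ n, Metric.ediam (t n) ≠ ⊤ := fun n => ne_top_of_le_ne_top ENNReal.one_ne_top (htd n)
  have hcov : (Set.univ : Set X) ⊆ ⋃ n, ball (c n) (ρ n) := by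
    intro x _
    obtain ⟨n, hn⟩ := Set.mem_iUnion.1 (ht (Set.mem_univ x))
    refine Set.mem_iUnion.2 ⟨n, ?_⟩
    rw [mem_ball]
    exact lt_of_le_of_lt (Metric.dist_le_diam_of_mem' (hfin n) hn (hc n ⟨x, hn⟩)) (hρ1 n)
  obtain ⟨T, hT⟩ := isCompact_univ.elim_finite_subcover _ (fun n => isOpen_ball) hcov
  refine ⟨T, c, ρ, fun i _ => hpos i, fun x => ?_, ?_⟩
  · obtain ⟨i, hi, hx⟩ := Set.mem_iUnion₂.1 (hT (Set.mem_univ x))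
    exact ⟨i, hi, by rw [dist_comm]; exact (mem_ball.1 hx).le⟩
  · have hle : ∀ n, ENNReal.ofReal (ρ n^d) ≤ (⨆ _ : (t n).Nonempty, Metric.ediam (t n) ^ ((d:NNReal):ℝ)) + e n := by
      intro n
      have : ENNReal.ofReal (ρ n^d) ≤ ENNReal.ofReal (Metric.diam (t n)^d + e n) := ENNReal.ofReal_le_ofReal (hρ2 n).le
      refine this.trans ?_
      rw [ENNReal.ofReal_add (by positivity) (by positivity), ENNReal.ofReal_coe_nnreal]
      gcongr
      by_cases hn : (t n).Nonempty
      · rw [iSup_pos hn, ENNReal.ofReal_pow Metric.diam_nonneg, Metric.diam, ENNReal.ofReal_toReal (hfin n)]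
        simp
      · have : t n = ∅ := Set.not_nonempty_iff_eq_empty.1 hn
        have hd0 : d ≠ 0 := by rintro rfl; simp at hd
        rw [this]; simp [hd0]
    have h4 : ENNReal.ofReal (∑ i ∈ T, ρ i ^ d) < ENNReal.ofReal ε := by
      rw [ENNReal.ofReal_sum_of_nonneg (fun i _ => by have := hpos i; positivity)]
      calc _ ≤ ∑ i ∈ T, ((⨆ _ : (t i).Nonempty, Metric.ediam (t i) ^ ((d:NNReal):ℝ)) + e i) := Finset.sum_le_sum (fun i _ => hle i)
        _ ≤ ∑' i, ((⨆ _ : (t i).Nonempty, Metric.ediam (t i) ^ ((d:NNReal):ℝ)) + e i) := ENNReal.sum_le_tsum T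
        _ = _ := ENNReal.tsum_add
        _ < ENNReal.ofReal (ε/2) + ENNReal.ofReal (ε/2) := ENNReal.add_lt_add hsum hesum
        _ = ENNReal.ofReal ε := by rw [← ENNReal.ofReal_add (by positivity) (by positivity)]; simp
    exact (ENNReal.ofReal_lt_ofReal_iff hε).1 h4

theorem Loc.pack [CompactSpace X] (h : Loc X lam) {d : ℕ} (hd : dimH (Set.univ : Set X) < d)
    {F : Finset X} {z : X} {R η : ℝ} (hR : 0 < R) (hη : 0 < η) (hη1 : η ≤ 1)
    (hF : ∀ x ∈ F, dist z x ≤ R) (hsep : Sepd F (η * R)) (hlam : lam * (4 * R) ≤ 1/2) :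
    F.card * (η/192)^d < 1 := by
  classical
  by_contra hcon
  push Not at hcon
  haveI : Nonempty X := ⟨z⟩
  obtain ⟨T, c, ρ, h1, h2, h3⟩ := small_covers (X := X) d hd (ε := ((η/192)*R)^d) (by positivity)
  exact absurd (h.cover_sum hR hη hη1 hF hsep hlam d hcon T c ρ h1 h2) (not_le.2 h3)

end


section

variable {X : Type} [MetricSpace X] {lam : ℝ}

theorem Loc.expo [CompactSpace X] (h : Loc X lam) {d : ℕ} (hd : dimH (Set.univ : Set X) < d)
    (p : X) {r : ℝ} (hr : 0 < r) (hlam : lam * (4 * r) ≤ 1/2) :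
    ∃ e : ℕ, (∀ (z : X) (R η : ℝ) (F : Finset X), 0 < R → dist p z + R ≤ r → 0 < η → η ≤ 1 →
        (∀ x ∈ F, dist z x ≤ R) → Sepd F (η * R) → F.card * (η/192)^e ≤ 1) ∧
      (∀ C : ℝ, ∃ (δ : ℝ) (F : Finset X), 0 < δ ∧ δ ≤ 1 ∧ (∀ x ∈ F, dist p x ≤ r) ∧ Sepd F (δ * r) ∧
        C * δ < F.card * δ^e) := by
  classical
  have hl := h.pos
  let P : ℕ → Prop := fun e => ∃ C : ℝ, ∀ δ : ℝ, 0 < δ → δ ≤ 1 → ∀ F : Finset X, (∀ x ∈ F, dist p x ≤ r) → Sepd F (δ * r) →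
    F.card * δ^e ≤ C
  have hP : ∃ e, P e := by
    refine ⟨d, 192^d, fun δ h0 h1 F hF hs => ?_⟩
    have := h.pack hd hr h0 h1 hF hs hlam
    rw [div_pow, ← mul_div_assoc, div_lt_one (by positivity)] at this
    exact this.le
  set e := Nat.find hP with he
  have hPe : P e := Nat.find_spec hP
  refine ⟨e, ?_, ?_⟩
  · intro z R η F hR hz hη hη1 hF hs
    obtain ⟨C, hC⟩ := hPe
    set β := η/192 with hβ
    have hβ0 : 0 < β := by positivity
    have hpz := dist_nonneg (x := p) (y := z)
    have hRr : R ≤ r := by linarith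
    have hb : ∀ j : ℕ, (F.card * β^e)^j * (R/r)^e ≤ C := by
      intro j
      obtain ⟨G, g1, g2, g3⟩ := h.power hR hη hη1 hF hs (by nlinarith) j z R hR (by simp; linarith)
      rw [← hβ] at g3
      have hβj : β^j ≤ 1 := pow_le_one₀ hβ0.le (by rw [hβ]; linarith)
      have hRr1 : R / r ≤ 1 := by rw [div_le_one hr]; exact hRr
      have := hC (β^j * (R/r)) (by positivity) (by
        calc β^j * (R/r) ≤ 1 * 1 := mul_le_mul hβj hRr1 (by positivity) (by norm_num)
          _ = 1 := by norm_num) G (fun x hx => by have := dist_triangle p z x; linarith [g2 x hx]) (by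
          have e1 : β^j * (R/r) * r = β^j * R := by field_simp
          rw [e1]; exact g3)
      rw [g1] at this
      refine le_trans (le_of_eq ?_) this
      push_cast
      rw [mul_pow, mul_pow, ← pow_mul, ← pow_mul, mul_comm e j]; ring
    by_contra hcon
    push Not at hcon
    obtain ⟨j, hj⟩ := pow_unbounded_of_one_lt (C / (R/r)^e) hcon
    rw [div_lt_iff₀ (by positivity)] at hj
    linarith [hb j]
  · intro C
    rcases Nat.eq_zero_or_pos e with h0 | h0
    · have hC : 0 < |C| + 1 := by positivity
      refine ⟨1 / (|C| + 1), {p}, by positivity, ?_, ?_, ?_, ?_⟩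
      · rw [div_le_one hC]; linarith [abs_nonneg C]
      · intro x hx; rw [Finset.mem_singleton.1 hx, dist_self]; exact hr.le
      · intro x hx y hy hxy
        exact absurd ((Finset.mem_singleton.1 hx).trans (Finset.mem_singleton.1 hy).symm) hxy
      · rw [h0]; simp
        rw [← div_eq_mul_inv, div_lt_one hC]; linarith [le_abs_self C]
    · have := Nat.find_min hP (m := e - 1) (by omega)
      simp only [P] at this
      push Not at this
      obtain ⟨δ, h1, h2, F, h3, h4, h5⟩ := this C
      refine ⟨δ, F, h1, h2, h3, h4, ?_⟩
      have e1 : δ^e = δ^(e-1) * δ := by rw [← pow_succ]; congr 1; omega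
      rw [e1, ← mul_assoc]
      exact mul_lt_mul_of_pos_right h5 h1

end


section

variable {X : Type} [MetricSpace X] {lam : ℝ}

def Far (lam : ℝ) (p y z : X) : Prop :=
  (1/4096) * (Real.sinh (lam * dist p y) * Real.sinh (lam * dist p z)) ≤ Sh lam y z

def Ann (p : X) (r : ℝ) (k : ℕ) (q : X) : Prop := r / 2^(k+1) < dist p q ∧ dist p q ≤ r / 2^k

theorem Loc.far_ct (h : Loc X lam) {p y z : X} (hy0 : 0 < dist p y) (hz0 : 0 < dist p z)
    (hy : lam * dist p y ≤ 1/2) (hz : lam * dist p z ≤ 1/2) (hf : Far lam p y z) (k : ℕ) :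
    Far lam p (h.ct p k y) (h.ct p k z) := by
  have hl := h.pos
  have a := h.ct_Sh p y z hy hz k
  unfold Far at hf ⊢
  have s1 : 0 < Real.sinh (lam * dist p y) := Real.sinh_pos_iff.2 (by positivity)
  have s2 : 0 < Real.sinh (lam * dist p z) := Real.sinh_pos_iff.2 (by positivity)
  have s3 : 0 ≤ Real.sinh (lam * dist p (h.ct p k y)) := Real.sinh_nonneg_iff.2 (by positivity)
  have s4 : 0 ≤ Real.sinh (lam * dist p (h.ct p k z)) := Real.sinh_nonneg_iff.2 (by positivity)
  have hp := mul_pos s1 s2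
  have b := mul_le_mul_of_nonneg_right hf (mul_nonneg s3 s4)
  refine le_of_mul_le_mul_right ?_ hp
  linarith

theorem Loc.ann_ct (h : Loc X lam) {p y : X} {r : ℝ} {k : ℕ} (hy : Ann p r k y) (j : ℕ) : Ann p r (k+j) (h.ct p j y) := by
  unfold Ann at *
  rw [h.ct_dist]
  have e1 : r / 2^(k+j+1) = r / 2^(k+1) / 2^j := by rw [div_div, ← pow_add]; congr 2; omega
  have e2 : r / 2^(k+j) = r / 2^k / 2^j := by rw [div_div, ← pow_add]
  rw [e1, e2]
  exact ⟨div_lt_div_of_pos_right hy.1 (by positivity), div_le_div_of_nonneg_right hy.2 (by positivity)⟩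

theorem far_dist (hl : 0 < lam) {p y z : X} {r : ℝ} (hr : 0 < r) (hlr : lam * r ≤ 1/2) {k : ℕ} (hy : Ann p r k y) (hz : Ann p r k z)
    (hf : Far lam p y z) : (1/128) * (r/2^k) ≤ dist y z := by
  unfold Far Sh at hf
  set R := r/2^k with hR
  have hRr : R ≤ r := by rw [hR]; apply div_le_self hr.le; exact one_le_pow₀ (by norm_num)
  have hR0 : 0 < R := by positivity
  have e : r / 2^(k+1) = R / 2 := by rw [hR, pow_succ]; field_simp
  have y1 := hy.1
  have z1 := hz.1
  have y2 := hy.2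
  have z2 := hz.2
  rw [e] at y1 z1
  rw [← hR] at y2 z2
  have hd : dist y z ≤ 2 * R := by have := dist_triangle_left y z p; linarith
  have s1 : lam * (R/2) ≤ Real.sinh (lam * dist p y) :=
    (mul_le_mul_of_nonneg_left y1.le hl.le).trans (Real.self_le_sinh_iff.2 (by positivity))
  have s2 : lam * (R/2) ≤ Real.sinh (lam * dist p z) :=
    (mul_le_mul_of_nonneg_left z1.le hl.le).trans (Real.self_le_sinh_iff.2 (by positivity))
  have s3 : Real.sinh (lam * dist y z / 2) ≤ lam * dist y z := by
    have := sinh_ub2 (u := lam * dist y z / 2) (by positivity) (by nlinarith)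
    linarith
  have s4 : 0 ≤ Real.sinh (lam * dist y z / 2) := Real.sinh_nonneg_iff.2 (by positivity)
  have h1 : lam * (R/2) * (lam * (R/2)) ≤ Real.sinh (lam * dist p y) * Real.sinh (lam * dist p z) :=
    mul_le_mul s1 s2 (by positivity) (le_trans (by positivity) s1)
  have h2 : (lam * (R/128))^2 ≤ (lam * dist y z)^2 := by
    have : Real.sinh (lam * dist y z / 2)^2 ≤ (lam * dist y z)^2 := pow_le_pow_left₀ s4 s3 2
    nlinarith
  have h3 := abs_le_of_sq_le_sq h2 (by positivity)
  have h4 := (abs_le.1 (abs_le_of_sq_le_sq h2 (by positivity))).2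
  have h5 := le_of_mul_le_mul_left h4 hl
  linarith

theorem near_dist (hl : 0 < lam) {p y z : X} {r : ℝ} (hr : 0 < r) (hlr : lam * r ≤ 1/2) {k : ℕ} (hy : Ann p r k y) (hz : Ann p r k z)
    (hf : ¬ Far lam p y z) : dist y z ≤ (1/16) * (r/2^k) := by
  unfold Far Sh at hf
  push Not at hf
  set R := r/2^k with hR
  have hRr : R ≤ r := by rw [hR]; apply div_le_self hr.le; exact one_le_pow₀ (by norm_num)
  have hR0 : 0 < R := by positivity
  have y2 := hy.2
  have z2 := hz.2
  rw [← hR] at y2 z2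
  have hlR : lam * R ≤ 1/2 := (mul_le_mul_of_nonneg_left hRr hl.le).trans hlr
  have s1 : Real.sinh (lam * dist p y) ≤ 2 * (lam * R) := by
    have := mul_le_mul_of_nonneg_left y2 hl.le
    have := sinh_ub2 (u := lam * dist p y) (by positivity) (by linarith)
    linarith
  have s2 : Real.sinh (lam * dist p z) ≤ 2 * (lam * R) := by
    have := mul_le_mul_of_nonneg_left z2 hl.le
    have := sinh_ub2 (u := lam * dist p z) (by positivity) (by linarith)
    linarith
  have s3 : lam * dist y z / 2 ≤ Real.sinh (lam * dist y z / 2) := Real.self_le_sinh_iff.2 (by positivity)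
  have s4 : 0 ≤ Real.sinh (lam * dist p z) := Real.sinh_nonneg_iff.2 (by positivity)
  have h1 : Real.sinh (lam * dist p y) * Real.sinh (lam * dist p z) ≤ 2 * (lam * R) * (2 * (lam * R)) :=
    mul_le_mul s1 s2 s4 (by positivity)
  have h2 : (lam * dist y z)^2 ≤ (lam * (R/16))^2 := by
    have : (lam * dist y z / 2)^2 ≤ Real.sinh (lam * dist y z / 2)^2 := pow_le_pow_left₀ (by positivity) s3 2
    nlinarith
  have h4 := (abs_le.1 (abs_le_of_sq_le_sq h2 (by positivity))).2
  have h5 := le_of_mul_le_mul_left h4 hl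
  linarith

theorem exists_ann {p q : X} {r : ℝ} (hr : 0 < r) (hq : 0 < dist p q) (hqr : dist p q ≤ r) : ∃ k, Ann p r k q := by
  classical
  have hex : ∃ k : ℕ, r / 2^(k+1) < dist p q := by
    obtain ⟨k, hk⟩ := exists_pow_lt_of_lt_one (show 0 < dist p q / r by positivity) (show (1/2:ℝ) < 1 by norm_num)
    refine ⟨k, ?_⟩
    rw [lt_div_iff₀ hr, one_div, inv_pow] at hk
    refine lt_of_le_of_lt ?_ hk
    rw [div_eq_inv_mul]
    apply mul_le_mul_of_nonneg_right _ hr.le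
    apply inv_anti₀ (by positivity)
    exact pow_le_pow_right₀ (by norm_num) (by omega)
  refine ⟨Nat.find hex, Nat.find_spec hex, ?_⟩
  rcases Nat.eq_zero_or_pos (Nat.find hex) with h0 | h0
  · rw [h0]; simpa using hqr
  · have := Nat.find_min hex (m := Nat.find hex - 1) (by omega)
    push Not at this
    rwa [Nat.sub_add_cancel h0] at this

theorem ann_lt {p q q' : X} {r : ℝ} (hr : 0 < r) {k k' : ℕ} (h1 : Ann p r k q) (h2 : Ann p r k' q') (hd : dist p q' ≤ dist p q) :
    k ≤ k' := by
  by_contra hcon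
  push Not at hcon
  have a := h1.2
  have b := h2.1
  have : r / 2^k ≤ r / 2^(k'+1) := div_le_div_of_nonneg_left hr.le (by positivity) (pow_le_pow_right₀ (by norm_num) (by omega))
  linarith

theorem Loc.coloring [CompactSpace X] (h : Loc X lam) {d : ℕ} (hd : dimH (Set.univ : Set X) < d) (p : X) :
    ∃ (ρ : ℝ) (A : Finset X) (cls : X → X), 0 < ρ ∧ (∀ q, 0 < dist p q → dist p q ≤ ρ → cls q ∈ A) ∧
      ∀ q q', 0 < dist p q' → dist p q' ≤ dist p q → dist p q ≤ ρ → cls q = cls q' →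
        dist q q' ≤ dist p q - dist p q' / 2 := by
  classical
  have hl := h.pos
  obtain ⟨r, hr, hlr⟩ : ∃ r : ℝ, 0 < r ∧ lam * (4 * r) ≤ 1/2 := ⟨1/(8*lam), by positivity, by field_simp; norm_num⟩
  have hlr' : lam * r ≤ 1/2 := by nlinarith
  let Good : ℕ → Finset X → Prop := fun k F => (∀ x ∈ F, Ann p r k x) ∧ ∀ x ∈ F, ∀ y ∈ F, x ≠ y → Far lam p x y
  have hbd : ∀ k F, Good k F → (F.card : ℝ) ≤ (128*192)^d := by
    intro k F hF
    have hR0 : 0 < r / 2^k := by positivity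
    have hRr : r / 2^k ≤ r := by apply div_le_self hr.le; exact one_le_pow₀ (by norm_num)
    have := h.pack hd hR0 (show (0:ℝ) < 1/128 by norm_num) (by norm_num) (fun x hx => (hF.1 x hx).2)
      (fun x hx y hy hxy => far_dist hl hr hlr' (hF.1 x hx) (hF.1 y hy) (hF.2 x hx y hy hxy)) (by nlinarith)
    rw [div_div, div_pow, one_pow, mul_one_div, div_lt_one (by positivity)] at this
    exact this.le
  let S : Set ℕ := {c | ∃ k F, Good k F ∧ F.card = c}
  have hSb : BddAbove S := by
    refine ⟨⌈((128*192)^d : ℝ)⌉₊, ?_⟩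
    rintro c ⟨k, F, hF, rfl⟩
    exact_mod_cast (hbd k F hF).trans (Nat.le_ceil _)
  have hSn : S.Nonempty := ⟨0, 0, ∅, ⟨by simp, by simp⟩, by simp⟩
  obtain ⟨k0, A, hA, hAc⟩ := Nat.sSup_mem hSn hSb
  have hmax : ∀ k F, Good k F → F.card ≤ A.card := fun k F hF => by
    rw [hAc]; exact le_csSup hSb ⟨k, F, hF, rfl⟩
  have ann_pos : ∀ k x, Ann p r k x → 0 < dist p x := fun k x hx => lt_trans (by positivity) hx.1
  have ann_lam : ∀ k x, Ann p r k x → lam * dist p x ≤ 1/2 := fun k x hx => by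
    have hRr : r / 2^k ≤ r := by apply div_le_self hr.le; exact one_le_pow₀ (by norm_num)
    exact (mul_le_mul_of_nonneg_left (hx.2.trans hRr) hl.le).trans hlr'
  have key : ∀ q k, Ann p r (k0 + k) q → ∃ a ∈ A, ∀ i, ¬ Far lam p (h.ct p i q) (h.ct p (k+i) a) := by
    intro q k hq
    by_contra hcon
    push Not at hcon
    have hc2 : ∀ a, ∃ i, a ∈ A → Far lam p (h.ct p i q) (h.ct p (k+i) a) := by
      intro a
      by_cases ha : a ∈ A
      · obtain ⟨i, hi⟩ := hcon a ha; exact ⟨i, fun _ => hi⟩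
      · exact ⟨0, fun h => absurd h ha⟩
    choose i hi using hc2
    set I := A.sup i
    have hI : ∀ a ∈ A, Far lam p (h.ct p I q) (h.ct p (k+I) a) := by
      intro a ha
      have hle : i a ≤ I := Finset.le_sup ha
      have e1 : h.ct p I q = h.ct p (I - i a) (h.ct p (i a) q) := by rw [← h.ct_add]; congr 1; omega
      have e2 : h.ct p (k+I) a = h.ct p (I - i a) (h.ct p (k + i a) a) := by rw [← h.ct_add]; congr 1; omega
      rw [e1, e2]
      have a1 := h.ann_ct hq (i a)
      have a2 := h.ann_ct (hA.1 a ha) (k + i a)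
      exact h.far_ct (ann_pos _ _ a1) (ann_pos _ _ a2) (ann_lam _ _ a1) (ann_lam _ _ a2) (hi a ha) _
    have hA2 : ∀ a ∈ A, ∀ b ∈ A, a ≠ b → Far lam p (h.ct p (k+I) a) (h.ct p (k+I) b) := by
      intro a ha b hb hab
      have a1 := hA.1 a ha
      have a2 := hA.1 b hb
      exact h.far_ct (ann_pos _ _ a1) (ann_pos _ _ a2) (ann_lam _ _ a1) (ann_lam _ _ a2) (hA.2 a ha b hb hab) _
    have hself : ∀ x, 0 < dist p x → ¬ Far lam p x x := by
      intro x hx hf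
      unfold Far Sh at hf
      have : 0 < Real.sinh (lam * dist p x) := Real.sinh_pos_iff.2 (by positivity)
      simp at hf
      nlinarith
    have hsymm : ∀ x y, Far lam p x y → Far lam p y x := by
      intro x y hf
      unfold Far Sh at *
      rw [dist_comm y x]; linarith
    have hq' := h.ann_ct hq I
    set q' := h.ct p I q with hq'def
    have hnot : q' ∉ A.image (h.ct p (k+I)) := by
      intro hmem
      obtain ⟨a, ha, hae⟩ := Finset.mem_image.1 hmem
      have := hI a ha
      rw [hae] at this
      exact hself q' (ann_pos _ _ hq') this
    have hcard : (insert q' (A.image (h.ct p (k+I)))).card = A.card + 1 := by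
      rw [Finset.card_insert_of_notMem hnot, Finset.card_image_of_injOn]
      intro a ha b hb hab
      by_contra hne
      have := hA2 a ha b hb hne
      have hab' : h.ct p (k+I) a = h.ct p (k+I) b := hab
      rw [hab'] at this
      exact hself _ (ann_pos _ _ (h.ann_ct (hA.1 b hb) (k+I))) this
    have hgood : Good (k0 + k + I) (insert q' (A.image (h.ct p (k+I)))) := by
      constructor
      · intro x hx
        rcases Finset.mem_insert.1 hx with rfl | hx
        · exact hq'
        · obtain ⟨a, ha, rfl⟩ := Finset.mem_image.1 hx
          have := h.ann_ct (hA.1 a ha) (k+I)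
          rwa [← add_assoc] at this
      · intro x hx y hy hxy
        rcases Finset.mem_insert.1 hx with rfl | hx
        · rcases Finset.mem_insert.1 hy with rfl | hy
          · exact absurd rfl hxy
          · obtain ⟨a, ha, rfl⟩ := Finset.mem_image.1 hy
            exact hI a ha
        · obtain ⟨b, hb, rfl⟩ := Finset.mem_image.1 hx
          rcases Finset.mem_insert.1 hy with rfl | hy
          · exact hsymm _ _ (hI b hb)
          · obtain ⟨a, ha, rfl⟩ := Finset.mem_image.1 hy
            exact hA2 b hb a ha (fun e => hxy (by rw [e]))
    have := hmax _ _ hgood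
    omega
  have hkey2 : ∀ q, ∃ a, 0 < dist p q → dist p q ≤ r / 2^k0 → a ∈ A ∧ ∃ k, Ann p r (k0 + k) q ∧
      ∀ i, ¬ Far lam p (h.ct p i q) (h.ct p (k+i) a) := by
    intro q
    by_cases hq : 0 < dist p q ∧ dist p q ≤ r / 2^k0
    · have hRr : r / 2^k0 ≤ r := by apply div_le_self hr.le; exact one_le_pow₀ (by norm_num)
      obtain ⟨K, hK⟩ := exists_ann hr hq.1 (hq.2.trans hRr)
      have hle : k0 ≤ K := by
        by_contra hcon
        have : r / 2^k0 ≤ r / 2^(K+1) := div_le_div_of_nonneg_left hr.le (by positivity) (pow_le_pow_right₀ (by norm_num) (by omega))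
        linarith [hK.1, hq.2]
      obtain ⟨k, rfl⟩ := Nat.exists_eq_add_of_le hle
      obtain ⟨a, ha, hai⟩ := key q k hK
      exact ⟨a, fun _ _ => ⟨ha, k, hK, hai⟩⟩
    · exact ⟨p, fun h1 h2 => absurd ⟨h1, h2⟩ hq⟩
  choose cls hcls using hkey2
  refine ⟨r / 2^k0, A, cls, by positivity, fun q h1 h2 => (hcls q h1 h2).1, ?_⟩
  intro q q' hq'0 hle hqr hc
  obtain ⟨haA, k, hk, hki⟩ := hcls q (hq'0.trans_le hle) hqr
  obtain ⟨_, k', hk', hki'⟩ := hcls q' hq'0 (hle.trans hqr)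
  rw [← hc] at hki'
  have hkk := ann_lt hr hk hk' hle
  obtain ⟨j, hj⟩ := Nat.exists_eq_add_of_le hkk
  have hj' : k' = k + j := by omega
  subst hj'
  set a := cls q
  have f1 := hki j
  have f2 := hki' 0
  rw [h.ct_zero, Nat.add_zero] at f2
  have A1 : Ann p r (k0 + (k+j)) (h.ct p j q) := by have := h.ann_ct hk j; rwa [add_assoc] at this
  have A2 : Ann p r (k0 + (k+j)) (h.ct p (k+j) a) := h.ann_ct (hA.1 a haA) (k+j)
  have d1 := near_dist hl hr hlr' A1 A2 f1
  have d2 := near_dist hl hr hlr' hk' A2 f2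
  have d3 := h.ct_dist2 p j q
  rw [← h.ct_dist] at d3
  have lb := hk'.1
  have e : r / 2^(k0 + (k+j)+1) = r / 2^(k0 + (k+j)) / 2 := by rw [pow_succ]; field_simp
  rw [e] at lb
  have t1 := dist_triangle_right (h.ct p j q) q' (h.ct p (k+j) a)
  have t2 := dist_triangle p (h.ct p j q) q'
  have t3 := dist_triangle_left q q' (h.ct p j q)
  linarith

end


section

variable {X : Type} [MetricSpace X] {lam : ℝ}

theorem stew_num {u v W V g E : ℝ} (hu : 0 ≤ u) (hv : 0 ≤ v) (hg : 0 ≤ g) (huE : u ≤ E) (hvE : v ≤ E) (hgE : g ≤ E) (hE : E ≤ 1/2)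
    (h : Real.sinh u * Real.cosh W + Real.sinh v * Real.cosh V ≤ Real.sinh (u + v) * Real.cosh g) :
    u * W^2 + v * V^2 ≤ (u + v) * (g^2 + u * v) + 10 * E^5 := by
  have hE0 : 0 ≤ E := hu.trans huE
  have a1 := sinh_lb3 hu
  have a2 := sinh_lb3 hv
  have a3 := sinh_ub5 (u := u + v) (by linarith) (by linarith)
  have b1 := cosh_lb W
  have b2 := cosh_lb V
  have b3 := cosh_ub (u := g) (by rw [abs_of_nonneg hg]; linarith)
  have c1 : (u + u^3/6) * (1 + W^2/2) ≤ Real.sinh u * Real.cosh W :=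
    mul_le_mul a1 b1 (by positivity) (le_trans (by positivity) a1)
  have c2 : (v + v^3/6) * (1 + V^2/2) ≤ Real.sinh v * Real.cosh V :=
    mul_le_mul a2 b2 (by positivity) (le_trans (by positivity) a2)
  have c3 : Real.sinh (u+v) * Real.cosh g ≤ ((u+v) + (u+v)^3/6 + (u+v)^5/20) * (1 + g^2/2 + g^4/4) :=
    mul_le_mul a3 b3 (le_trans (by positivity) (cosh_lb g)) (by positivity)
  set c := u + v with hc
  have hc0 : 0 ≤ c := by positivity
  have hc2 : c ≤ 2 * E := by linarith
  have p1 : 0 ≤ u^3 * W^2 := by positivity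
  have p2 : 0 ≤ v^3 * V^2 := by positivity
  have hcc : c^3 = u^3 + v^3 + 3 * (c * (u * v)) := by rw [hc]; ring
  have m1 : c^5 ≤ (2*E)^5 := pow_le_pow_left₀ hc0 hc2 5
  have m2 : c^3 * g^2 ≤ (2*E)^3 * E^2 := mul_le_mul (pow_le_pow_left₀ hc0 hc2 3) (pow_le_pow_left₀ hg hgE 2) (by positivity) (by positivity)
  have m3 : c * g^4 ≤ (2*E) * E^4 := mul_le_mul hc2 (pow_le_pow_left₀ hg hgE 4) (by positivity) (by positivity)
  have hE2 : E^2 ≤ 1/4 := by nlinarith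
  have hE4 : E^4 ≤ 1/16 := by nlinarith
  have m4 : c^3 * g^4 ≤ (2*E)^3 * E^4 := mul_le_mul (pow_le_pow_left₀ hc0 hc2 3) (pow_le_pow_left₀ hg hgE 4) (by positivity) (by positivity)
  have m5 : c^5 * g^2 ≤ (2*E)^5 * E^2 := mul_le_mul m1 (pow_le_pow_left₀ hg hgE 2) (by positivity) (by positivity)
  have m6 : c^5 * g^4 ≤ (2*E)^5 * E^4 := mul_le_mul m1 (pow_le_pow_left₀ hg hgE 4) (by positivity) (by positivity)
  have hE5 : 0 ≤ E^5 := by positivity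
  have n4 : (2*E)^3 * E^4 ≤ 2 * E^5 := by nlinarith
  have n5 : (2*E)^5 * E^2 ≤ 8 * E^5 := by nlinarith
  have n6 : (2*E)^5 * E^4 ≤ 2 * E^5 := by nlinarith
  have e1 : (2*E)^5 = 32 * E^5 := by ring
  have e2 : (2*E)^3 * E^2 = 8 * E^5 := by ring
  have e3 : (2*E) * E^4 = 2 * E^5 := by ring
  have tot : (u + u^3/6) * (1 + W^2/2) + (v + v^3/6) * (1 + V^2/2) ≤ (c + c^3/6 + c^5/20) * (1 + g^2/2 + g^4/4) := by linarith
  have ex : (c + c^3/6 + c^5/20) * (1 + g^2/2 + g^4/4) = c + c^3/6 + c^5/20 + c * g^2 / 2 + c * g^4/4 + c^3 * g^2/12 + c^3 * g^4/24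
    + c^5 * g^2/40 + c^5 * g^4/80 := by ring
  rw [ex] at tot
  nlinarith

theorem Loc.estew (h : Loc X lam) {x y Y m : X} {D : ℝ} (h1 : dist x y + dist y Y = dist x Y) (h2 : dist x y ≤ D) (h3 : dist y Y ≤ D)
    (h4 : dist y m ≤ D) (hD : lam * (2 * D) ≤ 1) :
    dist x y * dist Y m^2 + dist y Y * dist x m^2 ≤ (dist x y + dist y Y) * (dist y m^2 + dist x y * dist y Y) + 10 * lam^2 * D^5 := by
  have hl := h.pos
  have hx := mul_le_mul_of_nonneg_left h2 hl.le
  have hy := mul_le_mul_of_nonneg_left h3 hl.le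
  have hm := mul_le_mul_of_nonneg_left h4 hl.le
  have := h.stew x y Y m h1 (by linarith) (by linarith) (by linarith)
  rw [← h1, mul_add] at this
  have := stew_num (E := lam * D) (by positivity) (by positivity) (by positivity) hx hy hm (by linarith) this
  have hl3 : 0 < lam^3 := by positivity
  refine le_of_mul_le_mul_left ?_ hl3
  nlinarith

theorem btw_of_mid {A : Type} [MetricSpace A] [CompactSpace A] {f : A → ℝ} (hf : Continuous f)
    (hm : ∀ x y, ∃ m, dist x m = dist x y / 2 ∧ dist m y = dist x y / 2 ∧ (f x + f y) / 2 ≤ f m) (x y : A) (t : ℝ) (ht0 : 0 ≤ t) (ht1 : t ≤ 1) :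
    ∃ w, dist x w = t * dist x y ∧ dist w y = (1-t) * dist x y ∧ (1-t) * f x + t * f y ≤ f w := by
  have hdy : ∀ n : ℕ, ∀ (x y : A) (j : ℕ), j ≤ 2^n →
      ∃ w, dist x w = (j/2^n : ℝ) * dist x y ∧ dist w y = (1-(j/2^n:ℝ)) * dist x y ∧ (1-(j/2^n:ℝ)) * f x + (j/2^n:ℝ) * f y ≤ f w := by
    intro n
    induction n with
    | zero =>
      intro x y j hj
      have : j = 0 ∨ j = 1 := by simp at hj; omega
      rcases this with rfl | rfl
      · exact ⟨x, by simp, by simp, by simp⟩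
      · exact ⟨y, by simp, by simp, by simp⟩
    | succ n ih =>
      intro x y j hj
      obtain ⟨m, m1, m2, m3⟩ := hm x y
      have hp : (0:ℝ) < 2^n := by positivity
      by_cases hjn : j ≤ 2^n
      · obtain ⟨w, w1, w2, w3⟩ := ih x m j hjn
        have e : (j/2^(n+1) : ℝ) = (j/2^n : ℝ) / 2 := by rw [pow_succ]; field_simp
        have hs0 : 0 ≤ (j/2^n : ℝ) := by positivity
        rw [e]
        set s := (j/2^n : ℝ)
        have w1' : dist x w = s/2 * dist x y := by rw [w1, m1]; ring
        have hle : dist w y ≤ (1 - s/2) * dist x y := by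
          have := dist_triangle w m y
          rw [w2, m1, m2] at this; linarith
        have hge := dist_triangle x w y
        refine ⟨w, w1', by linarith, by nlinarith⟩
      · push Not at hjn
        obtain ⟨i, rfl⟩ := Nat.exists_eq_add_of_lt hjn
        rw [pow_succ] at hj
        obtain ⟨w, w1, w2, w3⟩ := ih m y (i+1) (by omega)
        have e : (((2^n + i + 1 : ℕ):ℝ)/2^(n+1) : ℝ) = (1 + ((i+1:ℕ)/2^n : ℝ)) / 2 := by rw [pow_succ]; push_cast; field_simp; ring
        have hs1 : ((i+1:ℕ)/2^n : ℝ) ≤ 1 := by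
          rw [div_le_one hp]
          have : i + 1 ≤ 2^n := by omega
          exact_mod_cast this
        rw [e]
        set s := ((i+1:ℕ)/2^n : ℝ)
        have w2' : dist w y = (1 - (1+s)/2) * dist x y := by rw [w2, m2]; ring
        have hle : dist x w ≤ (1+s)/2 * dist x y := by
          have := dist_triangle x m w
          rw [w1, m1, m2] at this; linarith
        have hge := dist_triangle x w y
        refine ⟨w, by linarith, w2', by nlinarith⟩
  let K : Set (ℝ × A) := {a | a.1 ∈ Icc (0:ℝ) 1 ∧ dist x a.2 = a.1 * dist x y ∧ dist a.2 y = (1-a.1) * dist x y ∧ (1-a.1) * f x + a.1 * f y ≤ f a.2}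
  have hKc : IsClosed K := by
    have c1 : IsClosed {a : ℝ × A | a.1 ∈ Icc (0:ℝ) 1} := isClosed_Icc.preimage continuous_fst
    have c2 : IsClosed {a : ℝ × A | dist x a.2 = a.1 * dist x y} := isClosed_eq (by fun_prop) (by fun_prop)
    have c3 : IsClosed {a : ℝ × A | dist a.2 y = (1-a.1) * dist x y} := isClosed_eq (by fun_prop) (by fun_prop)
    have c4 : IsClosed {a : ℝ × A | (1-a.1) * f x + a.1 * f y ≤ f a.2} := isClosed_le (by fun_prop) (by fun_prop)
    exact c1.inter (c2.inter (c3.inter c4))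
  have hKk : IsCompact K := (isCompact_Icc.prod isCompact_univ).of_isClosed_subset hKc (fun a ha => ⟨ha.1, Set.mem_univ _⟩)
  have himg : IsClosed (Prod.fst '' K) := (hKk.image continuous_fst).isClosed
  have htm : t ∈ Prod.fst '' K := by
    rw [← himg.closure_eq, Metric.mem_closure_iff]
    intro ε hε
    obtain ⟨n, hn⟩ := exists_pow_lt_of_lt_one hε (show (1/2:ℝ) < 1 by norm_num)
    have hp : (0:ℝ) < 2^n := by positivity
    have f1 := Nat.floor_le (show 0 ≤ t * 2^n by positivity)
    have f2 := Nat.lt_floor_add_one (t * 2^n)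
    set j := ⌊t * 2^n⌋₊
    have hj : (j:ℝ) ≤ 2^n := by nlinarith
    obtain ⟨w, w1, w2, w3⟩ := hdy n x y j (by exact_mod_cast hj)
    refine ⟨j/2^n, ⟨(j/2^n, w), ⟨⟨by positivity, (div_le_one hp).2 hj⟩, w1, w2, w3⟩, rfl⟩, ?_⟩
    rw [Real.dist_eq]
    refine lt_of_le_of_lt ?_ hn
    have e : t - j/2^n = (t*2^n - j) * (1/2)^n := by rw [one_div, inv_pow]; field_simp
    rw [e, abs_mul, abs_of_pos (show (0:ℝ) < (1/2)^n by positivity)]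
    apply mul_le_of_le_one_left (by positivity)
    rw [abs_le]; constructor <;> linarith
  obtain ⟨⟨t', w⟩, hw, rfl⟩ := htm
  exact ⟨w, hw.2⟩

theorem Loc.between [CompactSpace X] (h : Loc X lam) (x y : X) (t : ℝ) (ht0 : 0 ≤ t) (ht1 : t ≤ 1) :
    ∃ w, dist x w = t * dist x y ∧ dist w y = (1-t) * dist x y := by
  obtain ⟨w, h1, h2, _⟩ := btw_of_mid (f := fun _ : X => (0:ℝ)) continuous_const (fun x y => by
    obtain ⟨m, a, b⟩ := h.mid x y
    exact ⟨m, a, b, by simp⟩) x y t ht0 ht1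
  exact ⟨w, h1, h2⟩

theorem Loc.angle_tr (h : Loc X lam) {z y q : X} {e : ℝ} (hzq : lam * dist z q ≤ 1/2) (hzy : lam * dist z y ≤ 1/2) (he : 0 ≤ e)
    (h0 : Real.cosh (lam * dist z y) * Real.cosh (lam * dist z q) - e ≤ Real.cosh (lam * dist q y)) (k : ℕ) :
    Real.cosh (lam * dist z y) * Real.cosh (lam * dist z (h.ct z k q)) - e/2^k ≤ Real.cosh (lam * dist (h.ct z k q) y) := by
  have hl := h.pos
  induction k with
  | zero => simpa [h.ct_zero] using h0
  | succ k ih =>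
    rw [h.ct_succ]
    set w := h.ct z k q with hw
    have hd : dist z w ≤ dist z q := by rw [hw, h.ct_dist]; exact div_le_self dist_nonneg (one_le_pow₀ (by norm_num))
    have hdl := mul_le_mul_of_nonneg_left hd hl.le
    have m1 := h.md1 z w
    have m2 := h.md2 z w
    set m := h.md z w
    have hz0 := mul_nonneg hl.le (dist_nonneg (x := z) (y := w))
    have hmy : lam * dist m y ≤ 1 := by
      have := mul_le_mul_of_nonneg_left (dist_triangle_left m y z) hl.le
      rw [m1] at this
      nlinarith
    have := h.mi m1 m2 (by linarith) hmy
    rw [show lam * dist z w / 2 = lam * dist z m by rw [m1]; ring] at this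
    have hc : Real.cosh (lam * dist z w) = 2 * Real.cosh (lam * dist z m)^2 - 1 := by
      rw [show lam * dist z w = 2 * (lam * dist z m) by rw [m1]; ring, Real.cosh_two_mul, Real.cosh_sq]; ring
    rw [hc] at ih
    have hC := Real.one_le_cosh (lam * dist z m)
    set C := Real.cosh (lam * dist z m)
    set L := Real.cosh (lam * dist z y)
    have he' : e/2^(k+1) = e/2^k/2 := by rw [pow_succ]; field_simp
    rw [he']
    have hek : 0 ≤ e/2^k := by positivity
    set e' := e/2^k
    by_contra hcon
    push Not at hcon
    nlinarith

end


section

variable {X : Type} [MetricSpace X] {lam : ℝ}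

theorem pyth_num {a b c m : ℝ} (ha : 0 ≤ a) (ha1 : a ≤ 1/10) (hb : 0 ≤ b) (hba : b ≤ 3/2 * a) (hc : 0 ≤ c) (hca : c ≤ 5/2 * a)
    (h1 : Real.cosh a * Real.cosh b - m ≤ Real.cosh c) (h2 : Real.cosh c ≤ Real.cosh a * Real.cosh b + m) :
    |c^2 - a^2 - b^2| ≤ 2 * m + 20 * a^4 := by
  have a1 := cosh_lb a
  have a2 := cosh_ub (u := a) (by rw [abs_of_nonneg ha]; linarith)
  have b1 := cosh_lb b
  have b2 := cosh_ub (u := b) (by rw [abs_of_nonneg hb]; linarith)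
  have c1 := cosh_lb c
  have c2 := cosh_ub (u := c) (by rw [abs_of_nonneg hc]; linarith)
  have l1 : (1 + a^2/2) * (1 + b^2/2) ≤ Real.cosh a * Real.cosh b := mul_le_mul a1 b1 (by positivity) (le_trans (by positivity) a1)
  have l2 : Real.cosh a * Real.cosh b ≤ (1 + a^2/2 + a^4/4) * (1 + b^2/2 + b^4/4) :=
    mul_le_mul a2 b2 (le_trans (by positivity) b1) (by positivity)
  have q1 : b^2 ≤ (3/2*a)^2 := pow_le_pow_left₀ hb hba 2
  have q2 : b^4 ≤ (3/2*a)^4 := pow_le_pow_left₀ hb hba 4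
  have q3 : c^4 ≤ (5/2*a)^4 := pow_le_pow_left₀ hc hca 4
  have q4 : 0 ≤ a^2 * b^2 := by positivity
  have e1 : (3/2*a)^2 = 9/4 * a^2 := by ring
  have e2 : (3/2*a)^4 = 81/16 * a^4 := by ring
  have e3 : (5/2*a)^4 = 625/16 * a^4 := by ring
  rw [e1] at q1; rw [e2] at q2; rw [e3] at q3
  have sa : a^2 ≤ 1/100 := by nlinarith
  have sa4 : a^4 = a^2 * a^2 := by ring
  have ha4 : 0 ≤ a^4 := by positivity
  have q5 : a^2 * b^2 ≤ 9/4 * a^4 := by rw [sa4]; nlinarith [sq_nonneg a]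
  have q6 : a^2 * b^4 ≤ a^4 := by nlinarith [sq_nonneg a, sq_nonneg (b^2)]
  have q7 : a^4 * b^2 ≤ a^4 := by nlinarith
  have q8 : a^4 * b^4 ≤ a^4 := by nlinarith
  rw [abs_le]
  constructor <;> nlinarith

theorem Loc.sep2 (h : Loc X lam) {q p y u w : X} {l t s : ℝ} (hl0 : 0 < l) (hll : lam * (16 * l) ≤ 1)
    (hQ1 : l ≤ dist q y) (hQ2 : dist q y ≤ 2 * l) (hP1 : l ≤ dist p y) (hP2 : dist p y ≤ 2 * l)
    (ht0 : 0 ≤ t) (ht1 : t ≤ 1/2) (hs0 : 0 ≤ s) (hs1 : s ≤ 1/2)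
    (hu1 : dist q u = t * dist q y) (hu2 : dist u y = (1 - t) * dist q y)
    (hw1 : dist p w = s * dist p y) (hw2 : dist w y = (1 - s) * dist p y) (hd : dist p q ≤ 3 * l)
    (hPQ : |dist p y - dist q y| ≤ 9/10 * dist p q) :
    19/400 * dist p q^2 - 655360 * lam^2 * l^4 ≤ dist u w^2 := by
  have hl := h.pos
  have st1 := h.estew (x := q) (y := u) (Y := y) (m := p) (D := 8 * l) (by rw [hu1, hu2]; ring) (by rw [hu1]; nlinarith) (by rw [hu2]; nlinarith)
    (by have := dist_triangle u q p
        rw [dist_comm u q, hu1, dist_comm q p] at this; nlinarith) (by linarith)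
  have st2 := h.estew (x := p) (y := w) (Y := y) (m := u) (D := 8 * l) (by rw [hw1, hw2]; ring) (by rw [hw1]; nlinarith) (by rw [hw2]; nlinarith)
    (by have h1 := dist_triangle4 w p q u
        rw [dist_comm w p, hw1, hu1] at h1; nlinarith) (by linarith)
  rw [hu1, hu2, dist_comm y p, dist_comm q p] at st1
  rw [hw1, hw2, dist_comm y u, hu2, dist_comm p u, dist_comm w u] at st2
  set Q := dist q y
  set P := dist p y
  set d := dist p q
  have e1 : (8 * l)^5 = 32768 * l^4 * l := by ring
  rw [e1] at st1 st2
  have r1 : t * P^2 + (1-t) * d^2 ≤ dist u p^2 + t * (1-t) * Q^2 + 327680 * lam^2 * l^4 := by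
    have hQ0 : 0 < Q := by linarith
    refine le_of_mul_le_mul_left ?_ hQ0
    have : 327680 * lam^2 * l^4 * l ≤ 327680 * lam^2 * l^4 * Q := mul_le_mul_of_nonneg_left hQ1 (by positivity)
    nlinarith
  have r2 : s * ((1-t) * Q)^2 + (1-s) * dist u p^2 ≤ dist u w^2 + s * (1-s) * P^2 + 327680 * lam^2 * l^4 := by
    have hP0 : 0 < P := by linarith
    refine le_of_mul_le_mul_left ?_ hP0
    have : 327680 * lam^2 * l^4 * l ≤ 327680 * lam^2 * l^4 * P := mul_le_mul_of_nonneg_left hP1 (by positivity)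
    nlinarith
  have r3 := mul_le_mul_of_nonneg_left r1 (show 0 ≤ 1 - s by linarith)
  have hK : 0 ≤ 327680 * lam^2 * l^4 := by positivity
  set K := 327680 * lam^2 * l^4
  have e2 : 655360 * lam^2 * l^4 = 2 * K := by simp only [K]; ring
  rw [e2]
  have hPQ2 : (P - Q)^2 ≤ (9/10 * d)^2 := by
    rw [← sq_abs (P-Q)]; exact pow_le_pow_left₀ (abs_nonneg _) hPQ 2
  have main : (1-s)*(1-t)*(d^2 - (P-Q)^2) - 2 * K ≤ dist u w^2 := by
    have hsK : 0 ≤ s * K := by positivity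
    have id1 : (1-s) * (t * P^2 + (1-t) * d^2) + s * ((1-t)*Q)^2 - (1-s) * (t * (1-t) * Q^2) - s * (1-s) * P^2
      = (1-s)*(1-t)*(d^2 - (P-Q)^2) + ((1-s)*P - (1-t)*Q)^2 := by ring
    nlinarith [sq_nonneg ((1-s)*P - (1-t)*Q)]
  have hpos : 0 ≤ d^2 - (P-Q)^2 := by nlinarith [sq_nonneg d]
  have hst : 1/4 ≤ (1-s)*(1-t) := by nlinarith
  nlinarith

theorem PQ_num {l ζ ζ' P Q d ν : ℝ} (hl : 0 < l) (hz : 0 ≤ ζ) (hz1 : ζ ≤ 3/2 * l) (hz' : 0 ≤ ζ') (hz1' : ζ' ≤ 3/2 * l)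
    (hP0 : 0 ≤ P) (hQ0 : 0 ≤ Q) (hν : ν ≤ 1/200) (hν0 : 0 ≤ ν) (hP : |P^2 - l^2 - ζ^2| ≤ ν * l^2) (hQ : |Q^2 - l^2 - ζ'^2| ≤ ν * l^2)
    (hd : |ζ - ζ'| ≤ d) (hνd : 25 * (ν * l) ≤ d) : |P - Q| ≤ 9/10 * d := by
  rw [abs_le] at hP hQ
  have hl2 : 0 < l^2 := by positivity
  have z2 : ζ^2 ≤ 9/4 * l^2 := by nlinarith
  have z2' : ζ'^2 ≤ 9/4 * l^2 := by nlinarith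
  have p1 : ζ ≤ 17/20 * P := by
    refine le_of_abs_le (abs_le_of_sq_le_sq ?_ (by positivity))
    nlinarith
  have p2 : ζ' ≤ 17/20 * Q := by
    refine le_of_abs_le (abs_le_of_sq_le_sq ?_ (by positivity))
    nlinarith
  have p3 : 49/50 * l ≤ P := by
    refine le_of_abs_le (abs_le_of_sq_le_sq ?_ (by positivity))
    nlinarith
  have p4 : 49/50 * l ≤ Q := by
    refine le_of_abs_le (abs_le_of_sq_le_sq ?_ (by positivity))
    nlinarith
  have hd0 : 0 ≤ d := (abs_nonneg _).trans hd
  have key : |P - Q| * (P + Q) ≤ 9/10 * d * (P + Q) := by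
    have e : |P - Q| * (P + Q) = |P^2 - Q^2| := by
      rw [show P^2 - Q^2 = (P - Q) * (P + Q) by ring, abs_mul, abs_of_nonneg (show 0 ≤ P + Q by linarith)]
    rw [e]
    have e2 : |ζ^2 - ζ'^2| ≤ d * (ζ + ζ') := by
      rw [show ζ^2 - ζ'^2 = (ζ - ζ') * (ζ + ζ') by ring, abs_mul, abs_of_nonneg (show 0 ≤ ζ + ζ' by linarith)]
      exact mul_le_mul_of_nonneg_right hd (by linarith)
    have e3 : d * (ζ + ζ') ≤ d * (17/20 * (P + Q)) := mul_le_mul_of_nonneg_left (by linarith) hd0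
    have e4 : 2 * (ν * l^2) ≤ 1/20 * d * (P + Q) := by
      have : 2 * (ν * l^2) ≤ 1/20 * d * (49/25 * l) := by nlinarith
      refine this.trans (mul_le_mul_of_nonneg_left (by linarith) (by positivity))
    rw [abs_le] at e2 ⊢
    constructor <;> nlinarith
  exact le_of_mul_le_mul_right key (by nlinarith)

end


section

variable {X : Type} [MetricSpace X] {lam : ℝ}

theorem exists_scale {l R : ℝ} (hl : 0 < l) (hlR : l ≤ R) : ∃ k : ℕ, R / 2^k ≤ l ∧ l / 2 < R / 2^k := by
  classical
  have hR : 0 < R := hl.trans_le hlR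
  have hex : ∃ k : ℕ, R / 2^k ≤ l := by
    obtain ⟨k, hk⟩ := exists_pow_lt_of_lt_one (show 0 < l / R by positivity) (show (1/2:ℝ) < 1 by norm_num)
    refine ⟨k, ?_⟩
    rw [lt_div_iff₀ hR, one_div, inv_pow] at hk
    rw [div_eq_inv_mul]; exact hk.le
  refine ⟨Nat.find hex, Nat.find_spec hex, ?_⟩
  rcases Nat.eq_zero_or_pos (Nat.find hex) with h0 | h0
  · rw [h0]; simp; linarith
  · have := Nat.find_min hex (m := Nat.find hex - 1) (by omega)
    push Not at this
    have e : (2:ℝ)^(Nat.find hex) = 2^(Nat.find hex - 1) * 2 := by rw [← pow_succ]; congr 1; omega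
    rw [e, ← div_div]; linarith

theorem Loc.core_pt (h : Loc X lam) {δ R l : ℝ} (hδ : 0 < δ) (hδ1 : δ ≤ 1) (hR : 0 < R) (hlR : lam * (2 * R) ≤ 1/2)
    {x y z : X} (hl0 : 0 < l) (hl1 : l ≤ δ * R / 4000) (hl2 : lam * l ≤ δ / 40000) (hzx : dist z x = l) (hzy : dist z y = l)
    (hxy : dist x y = 2 * l) {k : ℕ} (hk1 : R / 2^k ≤ l) (hk2 : l / 2 < R / 2^k) {q : X} (hq1 : R / 2 ≤ dist z q) (hq2 : dist z q ≤ 3/2 * R)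
    (hcx : Real.cosh (lam * dist q z) - δ * R * lam^2 / 2000 * l ≤ Real.cosh (lam * dist q x))
    (hcy : Real.cosh (lam * dist q z) - δ * R * lam^2 / 2000 * l ≤ Real.cosh (lam * dist q y)) :
    dist z (h.ct z k q) ≤ 3/2 * l ∧ l/4 ≤ dist z (h.ct z k q) ∧
    |dist (h.ct z k q) y^2 - l^2 - dist z (h.ct z k q)^2| ≤ δ/400 * l^2 := by
  have hl := h.pos
  have hzq : lam * dist z q ≤ 3/8 := by nlinarith
  have hll0 : 0 < lam * l := by positivity
  set e0 := δ * R * lam^2 / 2000 * l + 2 * lam^2 * l^2 with he0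
  have he0n : 0 ≤ e0 := by positivity
  have hC2 : Real.cosh (lam * dist z q) ≤ 2 := by
    have h0 : 0 ≤ lam * dist z q := by positivity
    have := cosh_ub (u := lam * dist z q) (by rw [abs_of_nonneg h0]; linarith)
    have h2 : (lam * dist z q)^2 ≤ 1 := pow_le_one₀ h0 (by linarith)
    have h4 : (lam * dist z q)^4 ≤ 1 := pow_le_one₀ h0 (by linarith)
    linarith
  have hC1 := Real.one_le_cosh (lam * dist z q)
  have hL : Real.cosh (lam * l) ≤ 1 + lam^2 * l^2 := by
    have := cosh_ub (u := lam * l) (by rw [abs_of_pos hll0]; linarith)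
    have h4 : (lam * l)^4 ≤ (lam * l)^2 := pow_le_pow_of_le_one hll0.le (by linarith) (by norm_num)
    nlinarith
  have hE : Real.cosh (lam * l) * Real.cosh (lam * dist z q) - e0 ≤ Real.cosh (lam * dist z q) - δ * R * lam^2 / 2000 * l := by
    have : 0 ≤ lam^2 * l^2 := by positivity
    rw [he0]; nlinarith
  rw [dist_comm q z] at hcx hcy
  have ey := h.angle_tr (z := z) (y := y) (q := q) (e := e0) (by linarith) (by rw [hzy]; linarith) he0n (by rw [hzy]; linarith) k
  have ex := h.angle_tr (z := z) (y := x) (q := q) (e := e0) (by linarith) (by rw [hzx]; linarith) he0n (by rw [hzx]; linarith) k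
  have hct := h.ct_dist z k q
  set q' := h.ct z k q with hq'
  rw [hzy] at ey
  rw [hzx] at ex
  have z1 : dist z q' ≤ 3/2 * l := by
    rw [hct]
    calc dist z q / 2^k ≤ (3/2 * R) / 2^k := div_le_div_of_nonneg_right hq2 (by positivity)
      _ = 3/2 * (R / 2^k) := by ring
      _ ≤ _ := by linarith
  have z2 : l/4 ≤ dist z q' := by
    rw [hct]
    calc l/4 ≤ (R / 2^k)/2 := by linarith
      _ = (R/2)/2^k := by ring
      _ ≤ _ := div_le_div_of_nonneg_right hq1 (by positivity)
  refine ⟨z1, z2, ?_⟩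
  have hzq' : lam * dist z q' ≤ 1 := by nlinarith
  have hmi := h.mi (x := x) (m := z) (Y := y) (q := q') (by rw [dist_comm x z, hzx, hxy]; ring) (by rw [hzy, hxy]; ring)
    (by rw [hxy]; nlinarith) hzq'
  rw [hxy, show lam * (2 * l) / 2 = lam * l by ring, dist_comm x q', dist_comm y q'] at hmi
  have hm : e0 / 2^k ≤ δ * lam^2 * l^2 / 1000 := by
    have e1 : e0 / 2^k = (e0 / R) * (R / 2^k) := by field_simp
    have e2 : e0 / R ≤ δ * lam^2 * l / 1000 := by
      rw [div_le_iff₀ hR, he0]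
      have : lam^2 * l * l ≤ lam^2 * l * (δ * R / 4000) := mul_le_mul_of_nonneg_left hl1 (by positivity)
      nlinarith
    rw [e1]
    calc e0 / R * (R / 2^k) ≤ (δ * lam^2 * l / 1000) * l := mul_le_mul e2 hk1 (by positivity) (by positivity)
      _ = _ := by ring
  have hP : dist q' y ≤ 5/2 * l := by
    have := dist_triangle_left q' y z; linarith
  have := pyth_num (a := lam * l) (b := lam * dist z q') (c := lam * dist q' y) (m := e0/2^k) hll0.le (by linarith) (by positivity)
    (by nlinarith) (by positivity) (by nlinarith) ey (by linarith)
  have e3 : (lam * dist q' y)^2 - (lam * l)^2 - (lam * dist z q')^2 = lam^2 * (dist q' y^2 - l^2 - dist z q'^2) := by ring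
  rw [e3, abs_mul, abs_of_pos (show 0 < lam^2 by positivity)] at this
  refine le_of_mul_le_mul_left ?_ (show 0 < lam^2 by positivity)
  refine this.trans ?_
  have s1 : (lam * l)^2 ≤ δ/1000000 := by nlinarith
  have s2 : (lam * l)^4 ≤ δ/1000000 * (lam * l)^2 := by
    calc (lam * l)^4 = (lam * l)^2 * (lam * l)^2 := by ring
      _ ≤ _ := mul_le_mul_of_nonneg_right s1 (by positivity)
  have s3 : 0 ≤ δ * (lam^2 * l^2) := by positivity
  nlinarith

theorem Loc.core [CompactSpace X] (h : Loc X lam) {δ R l : ℝ} (hδ : 0 < δ) (hδ1 : δ ≤ 1) (hR : 0 < R) (hlR : lam * (2 * R) ≤ 1/2)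
    {x y z : X} (hl0 : 0 < l) (hl1 : l ≤ δ * R / 4000) (hl2 : lam * l ≤ δ / 40000) (hzx : dist z x = l) (hzy : dist z y = l)
    (hxy : dist x y = 2 * l) (S : Finset X) (hS : ∀ q ∈ S, R / 2 ≤ dist z q ∧ dist z q ≤ 3/2 * R) (hsep : Sepd S (δ * R))
    (hc : ∀ q ∈ S, Real.cosh (lam * dist q z) - δ * R * lam^2 / 2000 * l ≤ Real.cosh (lam * dist q x) ∧
      Real.cosh (lam * dist q z) - δ * R * lam^2 / 2000 * l ≤ Real.cosh (lam * dist q y)) :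
    ∃ G : Finset X, S.card / δ ≤ G.card ∧ (∀ u ∈ G, dist z u ≤ 4 * l) ∧ Sepd G (δ / 400 * (4 * l)) := by
  classical
  have hl := h.pos
  have hll0 : 0 < lam * l := by positivity
  obtain ⟨k, hk1, hk2⟩ := exists_scale hl0 (show l ≤ R by nlinarith)
  set T := ⌈1/δ⌉₊ with hT
  have hT1 : 1/δ ≤ T := Nat.le_ceil _
  have hT2 : (T:ℝ) ≤ 2/δ := by
    have : (T:ℝ) < 1/δ + 1 := Nat.ceil_lt_add_one (by positivity)
    have h1 : 1 ≤ 1/δ := by rw [le_div_iff₀ hδ]; linarith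
    have e : 2/δ = 1/δ + 1/δ := by ring
    linarith
  have hT0 : (0:ℝ) < T := lt_of_lt_of_le (by positivity) hT1
  have hpt := fun q hq => h.core_pt hδ hδ1 hR hlR hl0 hl1 hl2 hzx hzy hxy hk1 hk2 (hS q hq).1 (hS q hq).2 (hc q hq).1 (hc q hq).2
  have hbt : ∀ a : X × ℕ, ∃ u : X, a.2 < T → dist (h.ct z k a.1) u = (a.2/(2*T):ℝ) * dist (h.ct z k a.1) y ∧
      dist u y = (1-(a.2/(2*T):ℝ)) * dist (h.ct z k a.1) y := by
    intro a
    by_cases ha : a.2 < T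
    · have ha' : (a.2:ℝ) < T := by exact_mod_cast ha
      obtain ⟨u, hu⟩ := h.between (h.ct z k a.1) y (a.2/(2*T):ℝ) (by positivity) (by rw [div_le_one (by positivity)]; linarith)
      exact ⟨u, fun _ => hu⟩
    · exact ⟨y, fun h => absurd h ha⟩
  choose u hu using hbt
  have htj : ∀ j : ℕ, j < T → 0 ≤ (j/(2*T):ℝ) ∧ (j/(2*T):ℝ) ≤ 1/2 := by
    intro j hj
    have : (j:ℝ) < T := by exact_mod_cast hj
    refine ⟨by positivity, ?_⟩
    rw [div_le_iff₀ (by positivity)]; linarith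
  have hP : ∀ q ∈ S, l ≤ dist (h.ct z k q) y ∧ dist (h.ct z k q) y ≤ 2 * l := by
    intro q hq
    obtain ⟨a1, a2, a3⟩ := hpt q hq
    rw [abs_le] at a3
    have hl2 : 0 < l^2 := by positivity
    have hz2 : dist z (h.ct z k q)^2 ≤ (3/2*l)^2 := pow_le_pow_left₀ dist_nonneg a1 2
    have hz3 : (l/4)^2 ≤ dist z (h.ct z k q)^2 := pow_le_pow_left₀ (by positivity) a2 2
    constructor
    · refine le_of_abs_le (abs_le_of_sq_le_sq ?_ dist_nonneg); nlinarith
    · refine le_of_abs_le (abs_le_of_sq_le_sq ?_ (by positivity)); nlinarith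
  have hsepd : ∀ a ∈ S ×ˢ Finset.range T, ∀ b ∈ S ×ˢ Finset.range T, a ≠ b → δ / 400 * (4 * l) ≤ dist (u a) (u b) := by
    rintro ⟨q, i⟩ ha ⟨p, j⟩ hb hab
    rw [Finset.mem_product, Finset.mem_range] at ha hb
    obtain ⟨hq, hi⟩ := ha
    obtain ⟨hp, hj⟩ := hb
    simp only at hq hi hp hj
    obtain ⟨u1, u2⟩ := hu (q,i) hi
    obtain ⟨w1, w2⟩ := hu (p,j) hj
    simp only at u1 u2 w1 w2
    by_cases hqp : q = p
    · subst hqp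
      have hij : i ≠ j := fun e => hab (by rw [e])
      have h1 : 1 ≤ |(i:ℝ) - j| := by
        have : (1:ℤ) ≤ |(i:ℤ) - j| := Int.one_le_abs (by omega)
        exact_mod_cast this
      have h2 := abs_dist_sub_le (u (q,i)) (u (q,j)) y
      rw [u2, w2] at h2
      have e : (1-(i/(2*T):ℝ)) * dist (h.ct z k q) y - (1-(j/(2*T):ℝ)) * dist (h.ct z k q) y = -((i:ℝ) - j) * (dist (h.ct z k q) y / (2*T)) := by
        field_simp; ring
      rw [e, abs_mul, abs_neg, abs_of_nonneg (show 0 ≤ dist (h.ct z k q) y / (2*T) by positivity)] at h2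
      have h3 : δ * l / 4 ≤ dist (h.ct z k q) y / (2*T) := by
        rw [le_div_iff₀ (by positivity)]
        have h4 : δ * T ≤ 2 := by rw [le_div_iff₀ hδ] at hT2; linarith
        have := (hP q hq).1
        nlinarith
      have h5 : 0 ≤ δ * l := by positivity
      nlinarith
    · obtain ⟨a1, a2, a3⟩ := hpt q hq
      obtain ⟨b1, b2, b3⟩ := hpt p hp
      have hd1 : δ * l / 8 ≤ dist (h.ct z k p) (h.ct z k q) := by
        have s1 := h.ct_sep z p q (by nlinarith [(hS p hp).2]) (by nlinarith [(hS q hq).2]) k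
        refine le_trans ?_ s1
        have s2 := hsep p hp q hq (Ne.symm hqp)
        calc δ * l / 8 = δ/4 * (l/2) := by ring
          _ ≤ δ/4 * (R/2^k) := mul_le_mul_of_nonneg_left hk2.le (by positivity)
          _ = (δ * R)/4/2^k := by ring
          _ ≤ _ := by gcongr
      have hd2 : dist (h.ct z k p) (h.ct z k q) ≤ 3 * l := by
        have := dist_triangle_left (h.ct z k p) (h.ct z k q) z; linarith
      have hzz : |dist z (h.ct z k p) - dist z (h.ct z k q)| ≤ dist (h.ct z k p) (h.ct z k q) := by
        rw [dist_comm z, dist_comm z]; exact abs_dist_sub_le _ _ _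
      have hPQ := PQ_num (ν := δ/400) hl0 dist_nonneg b1 dist_nonneg a1 (dist_nonneg (x := h.ct z k p) (y := y)) (dist_nonneg (x := h.ct z k q) (y := y))
        (by linarith) (by positivity) b3 a3 hzz (by
          refine le_trans ?_ hd1
          have : 0 < δ * l := by positivity
          linarith)
      obtain ⟨Q1, Q2⟩ := hP q hq
      obtain ⟨P1, P2⟩ := hP p hp
      have fin := h.sep2 (q := h.ct z k q) (p := h.ct z k p) (y := y) (u := u (q,i)) (w := u (p,j)) (l := l) (t := i/(2*T)) (s := j/(2*T)) hl0
        (by linarith) Q1 Q2 P1 P2 (htj i hi).1 (htj i hi).2 (htj j hj).1 (htj j hj).2 u1 u2 w1 w2 hd2 hPQ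
      have s0 : (δ * l / 8)^2 ≤ dist (h.ct z k p) (h.ct z k q)^2 := pow_le_pow_left₀ (by positivity) hd1 2
      have s1 : (lam * l)^2 ≤ (δ/40000)^2 := pow_le_pow_left₀ hll0.le hl2 2
      have s2 : lam^2 * l^4 ≤ (δ/40000)^2 * l^2 := by
        calc lam^2 * l^4 = (lam * l)^2 * l^2 := by ring
          _ ≤ _ := mul_le_mul_of_nonneg_right s1 (by positivity)
      have s3 : 0 ≤ δ^2 * l^2 := by positivity
      refine le_of_abs_le (abs_le_of_sq_le_sq ?_ dist_nonneg)
      nlinarith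
  have hpos : 0 < δ / 400 * (4 * l) := by positivity
  refine ⟨(S ×ˢ Finset.range T).image u, ?_, ?_, ?_⟩
  · rw [Finset.card_image_of_injOn, Finset.card_product, Finset.card_range]
    · push_cast
      rw [div_eq_mul_one_div]
      exact mul_le_mul_of_nonneg_left hT1 (by positivity)
    · intro a ha b hb hab
      by_contra hne
      have := hsepd a ha b hb hne
      have hab' : u a = u b := hab
      rw [hab', dist_self] at this
      linarith
  · intro v hv
    obtain ⟨⟨q, i⟩, ha, rfl⟩ := Finset.mem_image.1 hv
    rw [Finset.mem_product, Finset.mem_range] at ha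
    obtain ⟨hq, hi⟩ := ha
    simp only at hq hi
    obtain ⟨u1, u2⟩ := hu (q,i) hi
    simp only at u1 u2
    have t1 := dist_triangle z (h.ct z k q) (u (q,i))
    have := (hpt q hq).1
    have := (hP q hq).2
    have := (htj i hi).2
    have := (htj i hi).1
    nlinarith
  · intro v hv w hw hvw
    obtain ⟨a, ha, rfl⟩ := Finset.mem_image.1 hv
    obtain ⟨b, hb, rfl⟩ := Finset.mem_image.1 hw
    exact hsepd a ha b hb (fun e => hvw (by rw [e]))

end


section

variable {X : Type} [MetricSpace X] {lam : ℝ}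

theorem cosh_tan (a b : ℝ) : Real.cosh b + Real.sinh b * (a - b) ≤ Real.cosh a := by
  have h1 := Real.add_one_le_exp (a - b)
  have h2 := Real.add_one_le_exp (-(a - b))
  have e1 : Real.exp a = Real.exp b * Real.exp (a - b) := by rw [← Real.exp_add]; congr 1; ring
  have e2 : Real.exp (-a) = Real.exp (-b) * Real.exp (-(a - b)) := by rw [← Real.exp_add]; congr 1; ring
  have p1 := mul_le_mul_of_nonneg_left h1 (Real.exp_pos b).le
  have p2 := mul_le_mul_of_nonneg_left h2 (Real.exp_pos (-b)).le
  rw [← e1] at p1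
  rw [← e2] at p2
  rw [Real.cosh_eq, Real.cosh_eq, Real.sinh_eq]
  linarith

theorem cosh_lip {a b B : ℝ} (ha : 0 ≤ a) (hb : 0 ≤ b) (haB : a ≤ B) (hbB : b ≤ B) :
    |Real.cosh a - Real.cosh b| ≤ Real.sinh B * |a - b| := by
  have h1 := cosh_tan a b
  have h2 := cosh_tan b a
  have sa := Real.sinh_nonneg_iff.2 ha
  have sb := Real.sinh_nonneg_iff.2 hb
  have sa2 : Real.sinh a ≤ Real.sinh B := Real.sinh_le_sinh.2 haB
  have sb2 : Real.sinh b ≤ Real.sinh B := Real.sinh_le_sinh.2 hbB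
  have p0 := abs_nonneg (a - b)
  have p1 := le_abs_self (a - b)
  have p2 := neg_abs_le (a - b)
  rw [abs_le]
  constructor <;> nlinarith

theorem six_min {a b c d e f : ℝ} (ha : 0 < a) (hb : 0 < b) (hc : 0 < c) (hd : 0 < d) (he : 0 < e) (hf : 0 < f) :
    ∃ ρ : ℝ, 0 < ρ ∧ ρ ≤ a ∧ ρ ≤ b ∧ ρ ≤ c ∧ ρ ≤ d ∧ ρ ≤ e ∧ ρ ≤ f := by
  refine ⟨min a (min b (min c (min d (min e f)))), by positivity, ?_⟩
  simp

/-- the concave profile -/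
def bmp (lam A : ℝ) (p q x : X) : ℝ :=
  (Real.cosh (lam * dist q x) - Real.cosh (lam * dist q p)) - A * (Real.cosh (lam * dist q x) - Real.cosh (lam * dist q p))^2

theorem bmp_lip [CompactSpace X] (hl : 0 < lam) {A : ℝ} (hA : 0 ≤ A) (p : X) : ∃ L : ℝ, 0 ≤ L ∧ ∀ q x y : X, |bmp lam A p q x - bmp lam A p q y| ≤ L * dist x y := by
  obtain ⟨M, hM⟩ : ∃ M : ℝ, ∀ x y : X, dist x y ≤ M := by
    obtain ⟨M, hM⟩ := Metric.isBounded_iff.1 (isCompact_univ (X := X)).isBounded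
    exact ⟨M, fun x y => hM (Set.mem_univ x) (Set.mem_univ y)⟩
  have hM0 : 0 ≤ M := dist_nonneg.trans (hM p p)
  set B := lam * M with hB
  have hB0 : 0 ≤ B := by positivity
  have hsB := Real.sinh_nonneg_iff.2 hB0
  have hcB := Real.one_le_cosh B
  have hb : ∀ q x : X, lam * dist q x ≤ B := fun q x => mul_le_mul_of_nonneg_left (hM q x) hl.le
  have hg : ∀ q x y : X, |Real.cosh (lam * dist q x) - Real.cosh (lam * dist q y)| ≤ Real.sinh B * lam * dist x y := by
    intro q x y
    refine (cosh_lip (by positivity) (by positivity) (hb q x) (hb q y)).trans ?_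
    rw [← mul_sub, abs_mul, abs_of_pos hl, mul_assoc]
    apply mul_le_mul_of_nonneg_left _ hsB
    apply mul_le_mul_of_nonneg_left _ hl.le
    rw [dist_comm q x, dist_comm q y]; exact abs_dist_sub_le _ _ _
  set G := Real.sinh B * lam * M with hG
  have hG0 : 0 ≤ G := by positivity
  refine ⟨Real.sinh B * lam * (1 + 2 * A * G), by positivity, fun q x y => ?_⟩
  have g1 := hg q x y
  have g2 : |Real.cosh (lam * dist q x) - Real.cosh (lam * dist q p)| ≤ G := (hg q x p).trans (mul_le_mul_of_nonneg_left (hM x p) (by positivity))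
  have g3 : |Real.cosh (lam * dist q y) - Real.cosh (lam * dist q p)| ≤ G := (hg q y p).trans (mul_le_mul_of_nonneg_left (hM y p) (by positivity))
  unfold bmp
  set u := Real.cosh (lam * dist q x)
  set v := Real.cosh (lam * dist q y)
  set w := Real.cosh (lam * dist q p)
  have e : (u - w) - A * (u - w)^2 - ((v - w) - A * (v - w)^2) = (u - v) * (1 - A * ((u - w) + (v - w))) := by ring
  rw [e, abs_mul]
  have h1 : |1 - A * ((u - w) + (v - w))| ≤ 1 + 2 * A * G := by
    rw [abs_le] at *
    constructor <;> nlinarith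
  calc |u - v| * |1 - A * ((u - w) + (v - w))| ≤ (Real.sinh B * lam * dist x y) * (1 + 2 * A * G) :=
        mul_le_mul g1 h1 (abs_nonneg _) (by positivity)
    _ = _ := by ring

/-- one-variable estimate for the profile -/
theorem prof_num {A u v w s : ℝ} (hA : 0 ≤ A) (hu : A * |u| ≤ 1/4) (hv : A * |v| ≤ 1/4) (hw : A * |w| ≤ 1/4) (hs : 0 ≤ s) (h : (u + v)/2 ≤ w + s) :
    ((u - A * u^2) + (v - A * v^2))/2 ≤ (w - A * w^2) + 2 * s - A * ((u - v)/2)^2 := by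
  have hu1 := mul_le_mul_of_nonneg_left (neg_abs_le u) hA
  have hv1 := mul_le_mul_of_nonneg_left (neg_abs_le v) hA
  have hw1 := mul_le_mul_of_nonneg_left (neg_abs_le w) hA
  have hu2 := mul_le_mul_of_nonneg_left (le_abs_self u) hA
  have hv2 := mul_le_mul_of_nonneg_left (le_abs_self v) hA
  have hw2 := mul_le_mul_of_nonneg_left (le_abs_self w) hA
  set m := (u+v)/2 with hm
  have e : ((u - A * u^2) + (v - A * v^2))/2 = (m - A * m^2) - A * ((u - v)/2)^2 := by rw [hm]; ring
  rw [e]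
  have hAm : A * m = (A * u + A * v)/2 := by rw [hm]; ring
  have e2 : (m - A * m^2) - (w - A * w^2) = (m - w) * (1 - (A * m + A * w)) := by ring
  have k1 : 1/2 ≤ 1 - (A * m + A * w) := by linarith
  have k2 : 1 - (A * m + A * w) ≤ 2 := by linarith
  have : (m - w) * (1 - (A * m + A * w)) ≤ 2 * s := by
    by_cases hmw : m ≤ w
    · nlinarith
    · push Not at hmw; nlinarith
  linarith

theorem prof_num2 {A u v w s : ℝ} (hA : 0 ≤ A) (hu : A * |u| ≤ 1/4) (hv : A * |v| ≤ 1/4) (hw : A * |w| ≤ 1/4) (hs : 0 ≤ s) (h : (u + v)/2 ≤ w - s) :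
    ((u - A * u^2) + (v - A * v^2))/2 ≤ (w - A * w^2) - s/2 := by
  have hu1 := mul_le_mul_of_nonneg_left (neg_abs_le u) hA
  have hv1 := mul_le_mul_of_nonneg_left (neg_abs_le v) hA
  have hw1 := mul_le_mul_of_nonneg_left (neg_abs_le w) hA
  have hu2 := mul_le_mul_of_nonneg_left (le_abs_self u) hA
  have hv2 := mul_le_mul_of_nonneg_left (le_abs_self v) hA
  have hw2 := mul_le_mul_of_nonneg_left (le_abs_self w) hA
  set m := (u+v)/2 with hm
  have e : ((u - A * u^2) + (v - A * v^2))/2 = (m - A * m^2) - A * ((u - v)/2)^2 := by rw [hm]; ring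
  rw [e]
  have hAm : A * m = (A * u + A * v)/2 := by rw [hm]; ring
  have e2 : (m - A * m^2) - (w - A * w^2) = (m - w) * (1 - (A * m + A * w)) := by ring
  have k1 : 1/2 ≤ 1 - (A * m + A * w) := by linarith
  have : (m - w) * (1 - (A * m + A * w)) ≤ -(s/2) := by nlinarith
  have : 0 ≤ A * ((u-v)/2)^2 := by positivity
  linarith

theorem Loc.fam [CompactSpace X] (h : Loc X lam) (p : X) {r δ R : ℝ} {e : ℕ} (hr : 0 < r)
    (hi : ∀ (z : X) (R η : ℝ) (F : Finset X), 0 < R → dist p z + R ≤ r → 0 < η → η ≤ 1 →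
        (∀ x ∈ F, dist z x ≤ R) → Sepd F (η * R) → F.card * (η/192)^e ≤ 1)
    (hδ : 0 < δ) (hδ1 : δ ≤ 1) (hR : 0 < R) (hlR : lam * (2 * R) ≤ 1/2) (S : Finset X) (hSne : S.Nonempty)
    (hS : ∀ q ∈ S, 7/8 * R ≤ dist p q ∧ dist p q ≤ 9/8 * R) (hsep : Sepd S (δ * R)) (hcount : 1 < S.card/δ * (δ/400/192)^e) :
    ∃ (f : X → ℝ) (ρ L c : ℝ), 0 < ρ ∧ ρ ≤ R/8 ∧ 0 ≤ L ∧ 0 < c ∧ (∀ x y, |f x - f y| ≤ L * dist x y) ∧ f p = 0 ∧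
      (∀ x, dist p x ≤ ρ → (∀ q ∈ S, dist q x ≤ dist p q - dist p x / 4) → f x ≤ - c * dist p x) ∧
      (∀ x y z, dist p x ≤ ρ → dist p y ≤ ρ → dist p z ≤ ρ → x ≠ y → dist x z = dist x y / 2 → dist z y = dist x y / 2 →
        (f x + f y)/2 < f z) := by
  have hl := h.pos
  set N : ℝ := S.card + 1 with hN
  have hN0 : 0 < N := by positivity
  set c := δ * R * lam^2 / 4000 with hc
  have hc0 : 0 < c := by positivity
  set A := 16 * lam^2 * N / c^2 with hA
  have hA0 : 0 < A := by positivity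
  obtain ⟨ρ, hρ0, hρ1, hρ2, hρ3, hρ4, hρ5, hρ6⟩ := six_min (a := R/8) (b := δ * R / 4000) (c := δ/(40000 * lam)) (d := c/(8 * lam^2 * N)) (e := 1/(4 * A * lam)) (f := r/5)
    (by positivity) (by positivity) (by positivity) (by positivity) (by positivity) (by positivity)
  rw [le_div_iff₀ (by positivity)] at hρ3 hρ4 hρ5
  obtain ⟨L, hL0, hL⟩ := bmp_lip (X := X) hl hA0.le p
  have hdq : ∀ q ∈ S, ∀ x, dist p x ≤ ρ → R/2 ≤ dist x q ∧ dist x q ≤ 3/2 * R := by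
    intro q hq x hx
    obtain ⟨a1, a2⟩ := hS q hq
    have t1 := dist_triangle p x q
    have t2 := dist_triangle_left x q p
    constructor <;> linarith
  have hdl : ∀ q ∈ S, ∀ x, dist p x ≤ ρ → lam * dist q x ≤ 3/8 := by
    intro q hq x hx
    have := (hdq q hq x hx).2
    rw [dist_comm x q] at this; nlinarith
  have hpp : dist p p ≤ ρ := by rw [dist_self]; exact hρ0.le
  have hgb : ∀ q ∈ S, ∀ x, dist p x ≤ ρ → A * |Real.cosh (lam * dist q x) - Real.cosh (lam * dist q p)| ≤ 1/4 := by
    intro q hq x hx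
    have h1 := cosh_lip (a := lam * dist q x) (b := lam * dist q p) (B := 1/2) (by positivity) (by positivity) (by linarith [hdl q hq x hx])
      (by linarith [hdl q hq p hpp])
    have h2 : Real.sinh (1/2) ≤ 1 := by have := sinh_ub2 (u := 1/2) (by norm_num) (by norm_num); linarith
    have h3 : |lam * dist q x - lam * dist q p| ≤ lam * ρ := by
      rw [← mul_sub, abs_mul, abs_of_pos hl]
      apply mul_le_mul_of_nonneg_left _ hl.le
      have := abs_dist_sub_le x p q
      rw [dist_comm x q, dist_comm p q, dist_comm x p] at this
      linarith
    have h4 : |Real.cosh (lam * dist q x) - Real.cosh (lam * dist q p)| ≤ lam * ρ := by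
      have : 0 ≤ |lam * dist q x - lam * dist q p| := abs_nonneg _
      nlinarith
    have := mul_le_mul_of_nonneg_left h4 hA0.le
    nlinarith
  refine ⟨fun x => ∑ q ∈ S, bmp lam A p q x, ρ, S.card * L, lam^2 * R / 8, hρ0, hρ1, by positivity, by positivity, ?_, ?_, ?_, ?_⟩
  · intro x y
    rw [← Finset.sum_sub_distrib]
    refine (Finset.abs_sum_le_sum_abs _ _).trans ?_
    refine (Finset.sum_le_sum (fun q _ => hL q x y)).trans ?_
    rw [Finset.sum_const, nsmul_eq_mul, mul_assoc]
  · simp [bmp]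
  · intro x hx hq
    have hterm : ∀ q ∈ S, bmp lam A p q x ≤ - (lam^2 * R / 8) * dist p x := by
      intro q hqS
      unfold bmp
      have h1 := cosh_tan (lam * dist q p) (lam * dist q x)
      have h2 : lam * (R/2) ≤ Real.sinh (lam * dist q x) := by
        have := (hdq q hqS x hx).1
        rw [dist_comm x q] at this
        exact (mul_le_mul_of_nonneg_left this hl.le).trans (Real.self_le_sinh_iff.2 (by positivity))
      have h3 := hq q hqS
      rw [dist_comm p q] at h3
      have h4 : lam * (dist p x/4) ≤ lam * dist q p - lam * dist q x := by nlinarith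
      have h5 : lam * (R/2) * (lam * (dist p x/4)) ≤ Real.sinh (lam * dist q x) * (lam * dist q p - lam * dist q x) :=
        mul_le_mul h2 h4 (by positivity) (le_trans (by positivity) h2)
      have h6 : 0 ≤ A * (Real.cosh (lam * dist q x) - Real.cosh (lam * dist q p))^2 := by positivity
      nlinarith
    refine (Finset.sum_le_sum hterm).trans ?_
    rw [Finset.sum_const, nsmul_eq_mul]
    have h1 : (1:ℝ) ≤ S.card := by exact_mod_cast hSne.card_pos
    have h2 : 0 ≤ lam^2 * R / 8 * dist p x := by positivity
    nlinarith
  · intro x y z hx hy hz hxy hm1 hm2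
    set l := dist x y / 2 with hldef
    have hl0 : 0 < l := by have := dist_pos.2 hxy; positivity
    have hlρ : l ≤ ρ := by have := dist_triangle_left x y p; rw [hldef]; linarith
    have hmx : dist x y = 2 * l := by rw [hldef]; ring
    have hll : lam * l ≤ δ/40000 := by nlinarith
    have hll0 : 0 < lam * l := by positivity
    set m := 4 * lam^2 * l^2 with hm
    have hMI : ∀ q ∈ S, Real.cosh (lam * dist q x) + Real.cosh (lam * dist q y) ≤ 2 * Real.cosh (lam * dist q z) + m := by
      intro q hq
      have hqz := hdl q hq z hz
      have hmi := h.mi (x := x) (m := z) (Y := y) (q := q) hm1 hm2 (by rw [hmx]; linarith) (by rw [dist_comm]; linarith)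
      rw [hmx, show lam * (2 * l)/2 = lam * l by ring, dist_comm x q, dist_comm y q, dist_comm z q] at hmi
      have hC2 : Real.cosh (lam * dist q z) ≤ 2 := by
        have h0 : 0 ≤ lam * dist q z := by positivity
        have := cosh_ub (u := lam * dist q z) (by rw [abs_of_nonneg h0]; linarith)
        have h2 : (lam * dist q z)^2 ≤ 1 := pow_le_one₀ h0 (by linarith)
        have h4 : (lam * dist q z)^4 ≤ 1 := pow_le_one₀ h0 (by linarith)
        linarith
      have hC1 := Real.one_le_cosh (lam * dist q z)
      have hL : Real.cosh (lam * l) ≤ 1 + lam^2 * l^2 := by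
        have := cosh_ub (u := lam * l) (by rw [abs_of_pos hll0]; linarith)
        have h4 : (lam * l)^4 ≤ (lam * l)^2 := pow_le_pow_of_le_one hll0.le (by linarith) (by norm_num)
        nlinarith
      have : 0 ≤ lam^2 * l^2 := by positivity
      rw [hm]; nlinarith
    have hm0 : 0 ≤ m := by positivity
    have hall : ∀ q ∈ S, (bmp lam A p q x + bmp lam A p q y)/2 ≤ bmp lam A p q z + m := by
      intro q hq
      have := prof_num (s := m/2) hA0.le (hgb q hq x hx) (hgb q hq y hy) (hgb q hq z hz) (by positivity) (by linarith [hMI q hq])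
      unfold bmp
      refine this.trans ?_
      have : 0 ≤ A * ((Real.cosh (lam * dist q x) - Real.cosh (lam * dist q p) - (Real.cosh (lam * dist q y) - Real.cosh (lam * dist q p))) / 2) ^ 2 := mul_nonneg hA0.le (sq_nonneg _)
      linarith
    have hsp : ∃ q0 ∈ S, (bmp lam A p q0 x + bmp lam A p q0 y)/2 ≤ bmp lam A p q0 z + m - N * m := by
      by_contra hcon
      push Not at hcon
      have hcase : ∀ q ∈ S, Real.cosh (lam * dist q z) - 2 * c * l ≤ Real.cosh (lam * dist q x) ∧
          Real.cosh (lam * dist q z) - 2 * c * l ≤ Real.cosh (lam * dist q y) := by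
        intro q hq
        have hlt := hcon q hq
        have hA' : |Real.cosh (lam * dist q x) - Real.cosh (lam * dist q y)| < c * l := by
          by_contra hge
          push Not at hge
          have := prof_num (s := m/2) hA0.le (hgb q hq x hx) (hgb q hq y hy) (hgb q hq z hz) (by positivity) (by linarith [hMI q hq])
          unfold bmp at hlt
          have e1 : ((Real.cosh (lam * dist q x) - Real.cosh (lam * dist q p) - (Real.cosh (lam * dist q y) - Real.cosh (lam * dist q p))) / 2) ^ 2
            = |Real.cosh (lam * dist q x) - Real.cosh (lam * dist q y)|^2 / 4 := by rw [sq_abs]; ring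
          rw [e1] at this
          have h2 : (c * l)^2 ≤ |Real.cosh (lam * dist q x) - Real.cosh (lam * dist q y)|^2 := pow_le_pow_left₀ (by positivity) hge 2
          have h3 : A * ((c*l)^2/4) = N * m := by rw [hA, hm]; field_simp; ring
          have h4 : A * ((c*l)^2/4) ≤ A * (|Real.cosh (lam * dist q x) - Real.cosh (lam * dist q y)|^2 / 4) :=
            mul_le_mul_of_nonneg_left (by linarith) hA0.le
          linarith
        have hB' : Real.cosh (lam * dist q z) - c * l < (Real.cosh (lam * dist q x) + Real.cosh (lam * dist q y))/2 := by
          by_contra hge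
          push Not at hge
          have := prof_num2 (s := c * l) hA0.le (hgb q hq x hx) (hgb q hq y hy) (hgb q hq z hz) (by positivity) (by linarith)
          unfold bmp at hlt
          have h3 : N * m ≤ c * l / 2 := by
            have : l * (8 * lam^2 * N) ≤ c := le_trans (mul_le_mul_of_nonneg_right hlρ (mul_nonneg (mul_nonneg (by norm_num) (sq_nonneg _)) (by first | exact hN0.le | exact hN0 | exact Nat.cast_nonneg _ | linarith))) hρ4
            have := mul_le_mul_of_nonneg_right this hl0.le
            rw [hm]; nlinarith
          linarith
        rw [abs_lt] at hA'
        have : 0 < c * l := by positivity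
        constructor <;> linarith
      have e2 : 2 * c * l = δ * R * lam^2 / 2000 * l := by rw [hc]; ring
      rw [e2] at hcase
      obtain ⟨G, g1, g2, g3⟩ := h.core hδ hδ1 hR hlR hl0 (hlρ.trans hρ2) hll (by rw [dist_comm]; exact hm1) hm2 hmx S (fun q hq => hdq q hq z hz) hsep hcase
      have := hi z (4 * l) (δ/400) G (by positivity) (by linarith) (by positivity) (by linarith) g2 g3
      have h5 : (S.card / δ) * (δ/400/192)^e ≤ G.card * (δ/400/192)^e := mul_le_mul_of_nonneg_right g1 (by positivity)
      linarith
    obtain ⟨q0, hq0, hq0'⟩ := hsp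
    have hsum : ∑ q ∈ S, (bmp lam A p q x + bmp lam A p q y)/2 ≤ ∑ q ∈ S, (bmp lam A p q z + m) - N * m := by
      classical
      rw [← Finset.add_sum_erase S _ hq0, ← Finset.add_sum_erase S (fun q => bmp lam A p q z + m) hq0]
      have := Finset.sum_le_sum (s := S.erase q0) (fun q hq => hall q (Finset.mem_of_mem_erase hq))
      linarith
    have e3 : ∑ q ∈ S, (bmp lam A p q x + bmp lam A p q y)/2 = (∑ q ∈ S, bmp lam A p q x + ∑ q ∈ S, bmp lam A p q y)/2 := by
      rw [← Finset.sum_div, Finset.sum_add_distrib]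
    rw [e3, Finset.sum_add_distrib, Finset.sum_const, nsmul_eq_mul] at hsum
    have hmpos : 0 < m := by positivity
    show (∑ q ∈ S, bmp lam A p q x + ∑ q ∈ S, bmp lam A p q y)/2 < ∑ q ∈ S, bmp lam A p q z
    have : N * m = S.card * m + m := by rw [hN]; ring
    linarith

end


section


/-- Data for the gradient flow. -/
structure FlowData (A : Type) [MetricSpace A] (f : A → ℝ) (L C s1 : ℝ) : Prop where
  Lpos : 0 < L
  Cnn : 0 ≤ C
  s1pos : 0 < s1
  lip : ∀ x y, |f x - f y| ≤ L * dist x y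
  btw : ∀ x y : A, ∀ t : ℝ, 0 ≤ t → t ≤ 1 → ∃ w, dist x w = t * dist x y ∧
    dist w y = (1 - t) * dist x y ∧ (1 - t) * f x + t * f y ≤ f w
  stew : ∀ x y Y m : A, ∀ D : ℝ, dist x y + dist y Y = dist x Y → dist x y ≤ D → dist y Y ≤ D →
    dist y m ≤ D → D ≤ s1 →
    dist x y * dist Y m ^ 2 + dist y Y * dist x m ^ 2 ≤
      (dist x y + dist y Y) * (dist y m ^ 2 + dist x y * dist y Y) + C * D ^ 5

theorem flow_aux_id (e β : ℝ) (he : 0 < e) (he1 : e ≤ 1) :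
    (1 + e ^ 2 / 16) * (e ^ 2 / 16 + e ^ 2 / 16) -
        e ^ 2 / 16 * (1 - e ^ 2 / 32 + e / 4 * β) ^ 2 + e ^ 4 / 512 ≤
      (e / 4 - e ^ 2 / 16 * (β - e / 2)) ^ 2 := by
  have : (e / 4 - e ^ 2 / 16 * (β - e / 2)) ^ 2 - ((1 + e ^ 2 / 16) * (e ^ 2 / 16 + e ^ 2 / 16) -
        e ^ 2 / 16 * (1 - e ^ 2 / 32 + e / 4 * β) ^ 2 + e ^ 4 / 512) =
        e ^ 4 * ((β - e / 2) ^ 2 / 256 + β ^ 2 / 256 + (1 / 64 - 1 / 128 - 1 / 256 - 1/512)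
          - β * e / 1024 + e ^ 2 / 16384) := by ring
  have h0 : 0 ≤ (β - e / 2) ^ 2 / 256 + β ^ 2 / 256 + (1 / 64 - 1 / 128 - 1 / 256 - 1/512)
          - β * e / 1024 + e ^ 2 / 16384 := by nlinarith [sq_nonneg (β - e), sq_nonneg (β - e / 2)]
  have h4 : 0 ≤ e ^ 4 := by positivity
  linarith [mul_nonneg h4 h0]

theorem flow_aux {s e β Ym xm C : ℝ} (hy : 0 < s) (he : 0 < e) (he1 : e ≤ 1)
    (hb : -1 < β - e / 2) (hβ2 : β ≤ 2) (hYm : 0 ≤ Ym)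
    (hsq : (s * (1 - e ^ 2 / 32 + e / 4 * β)) ^ 2 ≤ xm ^ 2)
    (hst : s * Ym ^ 2 + e ^ 2 / 16 * s * xm ^ 2 ≤
      (s + e ^ 2 / 16 * s) * ((e / 4 * s) ^ 2 + s * (e ^ 2 / 16 * s)) + C * s ^ 5)
    (hCs : C * s ^ 2 ≤ e ^ 4 / 512) : Ym ≤ s * (e / 4 - e ^ 2 / 16 * (β - e / 2)) := by
  have hpos : 0 ≤ s * (e / 4 - e ^ 2 / 16 * (β - e / 2)) := by
    apply mul_nonneg hy.le
    nlinarith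
  refine (abs_le_of_sq_le_sq' ?_ hpos).2
  have q1 : s ^ 3 * (C * s ^ 2) ≤ s ^ 3 * (e ^ 4 / 512) :=
    mul_le_mul_of_nonneg_left hCs (by positivity)
  have q2 : e ^ 2 / 16 * s * (s * (1 - e ^ 2 / 32 + e / 4 * β)) ^ 2 ≤
    e ^ 2 / 16 * s * xm ^ 2 := mul_le_mul_of_nonneg_left hsq (by positivity)
  have q3 := mul_le_mul_of_nonneg_left (flow_aux_id e β he he1) (show 0 ≤ s ^ 3 by positivity)
  have : s * Ym ^ 2 ≤ s * ((s * (e / 4 - e ^ 2 / 16 * (β - e / 2))) ^ 2) := by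
    linarith
  exact le_of_mul_le_mul_left this hy

variable {A : Type} [MetricSpace A] {f : A → ℝ} {L C s1 : ℝ}

set_option maxHeartbeats 1000000 in
theorem flow_step_one (h : FlowData A f L C s1) {x y Y z : A} {g e : ℝ} (hg : 0 < g)
    (he : 0 < e) (he1 : e ≤ 1) (hgx : ∀ w, f w - f x ≤ g * dist x w)
    (hy : 0 < dist x y) (hys : dist x y ≤ s1) (hCs : C * dist x y ^ 2 ≤ e ^ 4 / 512)
    (hsl : g * (1 - e ^ 2 / 32) * dist x y ≤ f y - f x)
    (h1 : dist x y + dist y Y = dist x Y) (h2 : dist y Y = e ^ 2 / 16 * dist x y)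
    (hz : dist x y ≤ dist y z) :
    dist Y z ≤ dist y z - dist y Y * ((f z - f y) / (g * dist y z) - e / 2) := by
  set s := dist x y with hs
  set β := (f z - f y) / (g * dist y z) with hβ
  have hyz : 0 < dist y z := lt_of_lt_of_le hy hz
  have hβ' : β * (g * dist y z) = f z - f y := by rw [hβ]; field_simp
  by_cases hb : β - e / 2 ≤ -1
  · have := dist_triangle_left Y z y
    have h0 : 0 ≤ dist y Y := dist_nonneg
    nlinarith
  push Not at hb
  obtain ⟨m, m1, m2, m3⟩ := h.btw y z (e / 4 * s / dist y z) (by positivity) (by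
    rw [div_le_one hyz]; nlinarith)
  have m1' : dist y m = e / 4 * s := by rw [m1]; field_simp
  have m2' : dist m z = dist y z - e / 4 * s := by rw [m2]; field_simp
  have m3' : f y + e / 4 * s * β * g ≤ f m := by
    have : (1 - e / 4 * s / dist y z) * f y + e / 4 * s / dist y z * f z =
      f y + e / 4 * s / dist y z * (f z - f y) := by ring
    rw [this, ← hβ'] at m3
    have e2 : e / 4 * s / dist y z * (β * (g * dist y z)) = e / 4 * s * β * g := by field_simp
    rw [e2] at m3; exact m3
  have hxm : s * (1 - e ^ 2 / 32 + e / 4 * β) ≤ dist x m := by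
    have := hgx m
    have h3 : g * (s * (1 - e ^ 2 / 32 + e / 4 * β)) ≤ g * dist x m := by nlinarith
    exact le_of_mul_le_mul_left h3 hg
  have hβ2 : β ≤ 2 := by
    have t1 := dist_triangle x y m
    have : s * (1 - e ^ 2 / 32 + e / 4 * β) ≤ s * (1 + e / 4) := by
      rw [← hs, m1'] at t1; linarith
    have := le_of_mul_le_mul_left this hy
    have : e * (β) ≤ e * (1 + e / 8) := by nlinarith
    have := le_of_mul_le_mul_left this he
    linarith
  have hnn : 0 ≤ 1 - e ^ 2 / 32 + e / 4 * β := by nlinarith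
  have hst := h.stew x y Y m s h1 le_rfl (by rw [h2]; nlinarith [mul_nonneg hy.le (show 0 ≤ 1 - e ^ 2 by nlinarith)])
    (by rw [m1']; nlinarith) hys
  rw [← hs, h2, m1'] at hst
  have hsq : (s * (1 - e ^ 2 / 32 + e / 4 * β)) ^ 2 ≤ dist x m ^ 2 :=
    pow_le_pow_left₀ (by positivity) hxm 2
  have hkey : dist Y m ≤ s * (e / 4 - e ^ 2 / 16 * (β - e / 2)) :=
    flow_aux hy he he1 hb hβ2 dist_nonneg hsq hst hCs
  have := dist_triangle Y m z
  rw [h2]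
  nlinarith

end


section


variable {A : Type} [MetricSpace A] {f : A → ℝ} {L C s1 : ℝ}

theorem flow_iter (h : FlowData A f L C s1) {x Y0 z : A} {g e b : ℝ} (hg : 0 < g)
    (he : 0 < e) (he1 : e ≤ 1) (hgx : ∀ w, f w - f x ≤ g * dist x w)
    (hy : 0 < dist x Y0) (hys : dist x Y0 ≤ s1) (hCs : C * dist x Y0 ^ 2 ≤ e ^ 4 / 512)
    (hsl : g * (1 - e ^ 2 / 32) * dist x Y0 ≤ f Y0 - f x)
    (hz : ∀ y, dist x y ≤ dist x Y0 → dist x y ≤ dist y z)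
    (hb : ∀ y, dist x y ≤ dist x Y0 → b ≤ (f z - f y) / (g * dist y z)) :
    dist Y0 z ≤ dist x z - dist x Y0 * (b - e / 2) := by
  set t : ℝ := (1 + e ^ 2 / 16)⁻¹ with ht
  have ht0 : 0 < t := by positivity
  have ht1 : t < 1 := by
    rw [ht]; apply inv_lt_one_of_one_lt₀; have : 0 < e ^ 2 := by positivity
    linarith
  have ht2 : 1 - t = e ^ 2 / 16 * t := by rw [ht]; field_simp; ring
  have hJ : ∀ J : ℕ, ∃ y, dist x y = dist x Y0 * t ^ J ∧
      g * (1 - e ^ 2 / 32) * dist x y ≤ f y - f x ∧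
      dist Y0 z ≤ dist y z - (dist x Y0 - dist x y) * (b - e / 2) := by
    intro J
    induction J with
    | zero => exact ⟨Y0, by simp, hsl, by simp⟩
    | succ J ih =>
      obtain ⟨Y, hY1, hY2, hY3⟩ := ih
      obtain ⟨y, y1, y2, y3⟩ := h.btw x Y t ht0.le ht1.le
      have hYle : dist x Y ≤ dist x Y0 := by
        rw [hY1]; exact mul_le_of_le_one_right hy.le (pow_le_one₀ ht0.le ht1.le)
      have hYpos : 0 < dist x Y := by rw [hY1]; positivity
      have hyle : dist x y ≤ dist x Y0 := by
        rw [y1]; exact le_trans (mul_le_of_le_one_left hYpos.le ht1.le) hYle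
      have hypos : 0 < dist x y := by rw [y1]; positivity
      have hsl' : g * (1 - e ^ 2 / 32) * dist x y ≤ f y - f x := by
        rw [y1]
        have := mul_le_mul_of_nonneg_left hY2 ht0.le
        linarith
      have hst := flow_step_one h (z := z) (Y := Y) hg he he1 hgx hypos (hyle.trans hys)
        (le_trans (mul_le_mul_of_nonneg_left (pow_le_pow_left₀ hypos.le hyle 2) h.Cnn) hCs) hsl'
        (by rw [y1, y2]; ring) (by rw [y2, y1, ht2]; ring) (hz y hyle)
      refine ⟨y, ?_, hsl', ?_⟩
      · rw [y1, hY1]; ring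
      · have hbb := hb y hyle
        have : dist y Y * (b - e / 2) ≤ dist y Y * ((f z - f y) / (g * dist y z) - e / 2) :=
          mul_le_mul_of_nonneg_left (by linarith) dist_nonneg
        have e1 : dist y Y = dist x Y - dist x y := by rw [y1, y2]; ring
        rw [e1] at this hst
        linarith
  have hlim : Filter.Tendsto (fun J : ℕ => dist x z + dist x Y0 * t ^ J -
      (dist x Y0 - dist x Y0 * t ^ J) * (b - e / 2)) Filter.atTop
      (nhds (dist x z + dist x Y0 * 0 - (dist x Y0 - dist x Y0 * 0) * (b - e / 2))) := by
    have := tendsto_pow_atTop_nhds_zero_of_lt_one ht0.le ht1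
    have h2 := this.const_mul (dist x Y0)
    exact (h2.const_add _).sub ((h2.const_sub _).mul_const _)
  simp only [mul_zero, add_zero, sub_zero] at hlim
  refine ge_of_tendsto' hlim fun J => ?_
  obtain ⟨y, y1, _, y3⟩ := hJ J
  rw [← y1]
  linarith [dist_triangle_left y z x]

/-- Single Euler step. -/
theorem flow_euler [CompactSpace A] (h : FlowData A f L C s1) (x : A) {D : ℝ}
    (hD : ∀ x y : A, dist x y ≤ D) (ε : ℝ) (hε : 0 < ε) :
    ∃ Y : A, ∃ τ : ℝ, 0 < τ ∧ τ < ε ∧ dist x Y ≤ L * τ ∧ f x ≤ f Y ∧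
      ∀ z, dist Y z ^ 2 ≤ dist x z ^ 2 + 2 * τ * (f x - f z) + ε * τ := by
  by_cases hmax : ∀ z, f z ≤ f x
  · refine ⟨x, ε / 2, by positivity, by linarith, ?_, le_rfl, fun z => ?_⟩
    · rw [dist_self]; have := h.Lpos; positivity
    · have := hmax z
      nlinarith
  push Not at hmax
  obtain ⟨z0, hz0⟩ := hmax
  have hL := h.Lpos
  have hD0 : 0 ≤ D := le_trans dist_nonneg (hD x x)
  -- the maximal slope
  set S : Set ℝ := {v | ∃ z, z ≠ x ∧ v = (f z - f x) / dist x z} with hS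
  have hz0x : z0 ≠ x := by rintro rfl; exact lt_irrefl _ hz0
  have hSne : S.Nonempty := ⟨_, z0, hz0x, rfl⟩
  have hSb : BddAbove S := by
    refine ⟨L, ?_⟩
    rintro v ⟨z, hz, rfl⟩
    have : 0 < dist x z := dist_pos.2 (Ne.symm hz)
    rw [div_le_iff₀ this]
    have := h.lip z x
    rw [dist_comm] at this
    exact (le_abs_self _).trans this
  set g := sSup S with hgdef
  have hgL : g ≤ L := by
    apply csSup_le hSne
    rintro v ⟨z, hz, rfl⟩
    have : 0 < dist x z := dist_pos.2 (Ne.symm hz)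
    rw [div_le_iff₀ this]
    have := h.lip z x
    rw [dist_comm] at this
    exact (le_abs_self _).trans this
  have hg : 0 < g := by
    have h1 : (f z0 - f x) / dist x z0 ≤ g := le_csSup hSb ⟨z0, hz0x, rfl⟩
    have : 0 < dist x z0 := dist_pos.2 (Ne.symm hz0x)
    have : 0 < (f z0 - f x) / dist x z0 := div_pos (by linarith) this
    linarith
  have hgx : ∀ w, f w - f x ≤ g * dist x w := by
    intro w
    by_cases hw : w = x
    · subst hw; simp
    have h1 : (f w - f x) / dist x w ≤ g := le_csSup hSb ⟨w, hw, rfl⟩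
    have : 0 < dist x w := dist_pos.2 (Ne.symm hw)
    rwa [div_le_iff₀ this] at h1
  -- parameters
  obtain ⟨e, he, he1, heε⟩ : ∃ e : ℝ, 0 < e ∧ e ≤ 1 ∧ 2 * D * L * e ≤ ε / 2 := by
    refine ⟨min 1 (ε / (4 * D * L + 1)), by positivity, min_le_left _ _, ?_⟩
    have h1 : min 1 (ε / (4 * D * L + 1)) ≤ ε / (4 * D * L + 1) := min_le_right _ _
    have h2 : (ε / (4 * D * L + 1)) * (4 * D * L + 1) = ε := by field_simp
    have h3 : 0 < ε / (4 * D * L + 1) := by positivity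
    have h4 : 0 ≤ 2 * D * L := by positivity
    nlinarith [mul_le_mul_of_nonneg_left h1 h4]
  obtain ⟨e2, he2, he2ε⟩ : ∃ e2 : ℝ, 0 < e2 ∧ 4 * L * e2 ≤ ε / 2 :=
    ⟨ε / (8 * L), by positivity, by field_simp; norm_num⟩
  obtain ⟨v, ⟨z1, hz1, rfl⟩, hv⟩ := exists_lt_of_lt_csSup hSne
    (show g * (1 - e ^ 2 / 32) < sSup S by
      rw [← hgdef]; have : 0 < e ^ 2 := by positivity
      nlinarith)
  have hd1 : 0 < dist x z1 := dist_pos.2 (Ne.symm hz1)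
  rw [lt_div_iff₀ hd1] at hv
  -- choice of s0
  obtain ⟨s0, hs0, k1, k2, k3, k4, k5, k6⟩ : ∃ s0 : ℝ, 0 < s0 ∧ s0 ≤ dist x z1 ∧ s0 ≤ s1 ∧
      C * s0 ^ 2 ≤ e ^ 4 / 512 ∧ s0 < g * ε ∧ 4 * L ^ 2 * (s0 / g) ≤ ε / 2 ∧
      s0 * (8 * L / (g * e2) / e + 2 / e2) ≤ 1 := by
    have hk := h.Cnn
    have hk' := h.s1pos
    have ev : ∀ᶠ s0 in nhdsWithin (0:ℝ) (Ioi 0), s0 < dist x z1 ∧ s0 < s1 ∧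
      C * s0 ^ 2 < e ^ 4 / 512 ∧ s0 < g * ε ∧ 4 * L ^ 2 * (s0 / g) < ε / 2 ∧
      s0 * (8 * L / (g * e2) / e + 2 / e2) < 1 := by
      have key : ∀ F : ℝ → ℝ, ∀ a : ℝ, Continuous F → F 0 < a →
          ∀ᶠ s0 in nhdsWithin (0:ℝ) (Ioi 0), F s0 < a := fun F a hF ha =>
        ((hF.tendsto 0).eventually (gt_mem_nhds ha)).filter_mono nhdsWithin_le_nhds
      refine (key _ _ continuous_id (by simpa using hd1)).and <|
        (key _ _ continuous_id (by simpa using hk')).and <|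
        (key (fun s => C * s ^ 2) _ (by fun_prop) (by simp; positivity)).and <|
        (key _ _ continuous_id (by simp; positivity)).and <|
        (key (fun s => 4 * L ^ 2 * (s / g)) _ (by fun_prop) (by simp; positivity)).and
        (key (fun s => s * (8 * L / (g * e2) / e + 2 / e2)) _ (by fun_prop) (by simp))
    obtain ⟨s0, hs, hs'⟩ := (ev.and self_mem_nhdsWithin).exists
    exact ⟨s0, hs', hs.1.le, hs.2.1.le, hs.2.2.1.le, hs.2.2.2.1, hs.2.2.2.2.1.le, hs.2.2.2.2.2.le⟩
  obtain ⟨Y, Y1, Y2, Y3⟩ := h.btw x z1 (s0 / dist x z1) (by positivity)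
    (by rw [div_le_one hd1]; exact k1)
  have Y1' : dist x Y = s0 := by rw [Y1]; field_simp
  have hslY : g * (1 - e ^ 2 / 32) * dist x Y ≤ f Y - f x := by
    have h1 : 0 ≤ s0 / dist x z1 := by positivity
    have := mul_le_mul_of_nonneg_left hv.le h1
    rw [Y1]; linarith
  have hτ : 0 < s0 / g := by positivity
  have hsg : g * (s0 / g) = s0 := by field_simp
  refine ⟨Y, s0 / g, hτ, by rw [div_lt_iff₀ hg]; linarith, ?_, ?_, ?_⟩
  · rw [Y1', ← hsg]
    have := mul_le_mul_of_nonneg_right hgL hτ.le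
    rw [hsg]; rw [hsg] at this; exact this
  · have h1 : 0 ≤ g * (1 - e ^ 2 / 32) * dist x Y := by
      apply mul_nonneg (mul_nonneg hg.le _) dist_nonneg
      nlinarith
    linarith
  set τ := s0 / g with hτd
  have hs0L : s0 ≤ L * τ := by
    have := mul_le_mul_of_nonneg_right hgL hτ.le
    rw [hsg] at this; exact this
  intro z
  by_cases hz : dist x z < e2
  · have t1 : dist Y z ≤ dist x z + s0 := by
      have := dist_triangle_left Y z x; linarith
    have t2 : dist Y z ^ 2 ≤ (dist x z + s0) ^ 2 := pow_le_pow_left₀ dist_nonneg t1 2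
    have t3 := h.lip z x
    rw [dist_comm z x] at t3
    have t4 : f z - f x ≤ L * dist x z := (le_abs_self _).trans t3
    have t5 : f z - f x ≤ L * e2 := t4.trans (mul_le_mul_of_nonneg_left hz.le hL.le)
    have t6 : s0 ^ 2 ≤ (L * τ) ^ 2 := pow_le_pow_left₀ hs0.le hs0L 2
    have t7 : dist x z * s0 ≤ e2 * (L * τ) := mul_le_mul hz.le hs0L hs0.le he2.le
    have t8 := mul_le_mul_of_nonneg_right t5 hτ.le
    have t9 := mul_le_mul_of_nonneg_right he2ε hτ.le
    have t10 := mul_le_mul_of_nonneg_right k5 hτ.le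
    nlinarith [mul_nonneg (sq_nonneg L) (sq_nonneg τ)]
  push Not at hz
  have hxz : 0 < dist x z := lt_of_lt_of_le he2 hz
  have k62 : 2 * s0 ≤ e2 := by
    have : s0 * (2 / e2) ≤ 1 := by
      refine le_trans (mul_le_mul_of_nonneg_left ?_ hs0.le) k6
      have : 0 ≤ 8 * L / (g * e2) / e := by positivity
      linarith
    rw [← mul_div_assoc, div_le_one he2] at this
    linarith
  have k61 : s0 * (8 * L) ≤ g * e2 * e := by
    have : s0 * (8 * L / (g * e2) / e) ≤ 1 := by
      refine le_trans (mul_le_mul_of_nonneg_left ?_ hs0.le) k6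
      have : 0 ≤ 2 / e2 := by positivity
      linarith
    rw [div_div, ← mul_div_assoc, div_le_one (by positivity)] at this
    linarith
  set b := (f z - f x) / (g * dist x z) with hb
  have hbe : b * (g * dist x z) = f z - f x := by rw [hb]; field_simp
  have hit := flow_iter h (b := b - e / 2) (z := z) hg he he1 hgx (by rw [Y1']; exact hs0)
    (by rw [Y1']; exact k2) (by rw [Y1']; exact k3) hslY
    (fun y hy => by rw [Y1'] at hy; linarith [dist_triangle x y z])
    (fun y hy => by
      rw [Y1'] at hy
      have t1 := dist_triangle x y z
      have t2 := dist_triangle_left y z x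
      have t0 : 0 < dist y z := by linarith
      rw [le_div_iff₀ (by positivity)]
      have t3 := h.lip y x
      rw [dist_comm y x] at t3
      have t4 : f y - f x ≤ L * s0 := (le_abs_self _).trans (t3.trans (mul_le_mul_of_nonneg_left hy hL.le))
      -- b bounded by L/g
      have t5 : |b * g| ≤ L := by
        have e1 : b * g = (f z - f x) / dist x z := by rw [hb]; field_simp
        rw [e1, abs_div, abs_of_pos hxz, div_le_iff₀ hxz, dist_comm]
        exact h.lip z x
      have t6 : b * g * (dist y z - dist x z) ≤ L * s0 := by
        refine (le_abs_self _).trans ?_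
        rw [abs_mul]
        exact mul_le_mul t5 (abs_le.2 ⟨by linarith, by linarith⟩) (abs_nonneg _) hL.le
      have t7 : e2 / 2 ≤ dist y z := by linarith
      have t8 : g * e * (e2 / 2) ≤ g * e * dist y z :=
        mul_le_mul_of_nonneg_left t7 (by positivity)
      linarith)
  rw [Y1'] at hit
  have hit' : dist Y z ≤ dist x z - s0 * (b - e) := by linarith
  have hsq := pow_le_pow_left₀ dist_nonneg hit' 2
  have e1 : dist x z * (s0 * b) = τ * (f z - f x) := by
    rw [← hbe, ← hsg]; ring
  have e2' : (s0 * (b - e)) ^ 2 ≤ (2 * L * τ) ^ 2 := by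
    apply sq_le_sq'
    · have t5 : -L ≤ b * g := by
        have e1 : b * g = (f z - f x) / dist x z := by rw [hb]; field_simp
        rw [e1, le_div_iff₀ hxz]
        have := (abs_le.1 (h.lip z x)).1
        rw [dist_comm] at this; linarith
      have t6 := mul_le_mul_of_nonneg_right t5 hτ.le
      have t7 : s0 * e ≤ L * τ := by nlinarith
      have t8 : s0 * b = b * g * τ := by rw [← hsg]; ring
      linarith
    · have t5 : b * g ≤ L := by
        have e1 : b * g = (f z - f x) / dist x z := by rw [hb]; field_simp
        rw [e1, div_le_iff₀ hxz]
        have := (abs_le.1 (h.lip z x)).2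
        rw [dist_comm] at this; linarith
      have t6 := mul_le_mul_of_nonneg_right t5 hτ.le
      have t7 : 0 ≤ s0 * e := by positivity
      have t8 : s0 * b = b * g * τ := by rw [← hsg]; ring
      have : 0 ≤ L * τ := by positivity
      linarith
  have e3 : dist x z * (s0 * e) ≤ D * (L * τ * e) :=
    mul_le_mul (hD x z) (mul_le_mul_of_nonneg_right hs0L he.le) (by positivity) hD0
  have t9 := mul_le_mul_of_nonneg_right heε hτ.le
  have t10 := mul_le_mul_of_nonneg_right k5 hτ.le
  have e4 : (dist x z - s0 * (b - e)) ^ 2 = dist x z ^ 2 - 2 * (dist x z * (s0 * b)) +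
    2 * (dist x z * (s0 * e)) + (s0 * (b - e)) ^ 2 := by ring
  rw [e4, e1] at hsq
  linarith

end


section


variable {A : Type} [MetricSpace A] {f : A → ℝ} {L C s1 : ℝ}

theorem flow_uniform [CompactSpace A] (h : FlowData A f L C s1) {D : ℝ}
    (hD : ∀ x y : A, dist x y ≤ D) (ε : ℝ) (hε : 0 < ε) :
    ∃ τm : ℝ, 0 < τm ∧ ∀ x : A, ∃ Y : A, ∃ τ : ℝ, τm ≤ τ ∧ τ < ε ∧ dist x Y ≤ (L + 1) * τ ∧
      f x - ε * τ ≤ f Y ∧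
      ∀ z, dist Y z ^ 2 ≤ dist x z ^ 2 + 2 * τ * (f x - f z) + ε * τ := by
  rcases isEmpty_or_nonempty A with hA | hA
  · exact ⟨1, one_pos, fun x => hA.elim x⟩
  have hL := h.Lpos
  have hD0 : 0 ≤ D := le_trans dist_nonneg (hD hA.some hA.some)
  choose Y τ h1 h2 h3 h4 h5 using fun x => flow_euler h x hD (ε / 2) (by positivity)
  set r : A → ℝ := fun x => min 1 (min 1 (ε / (2 * (2 * D + 2 * L * τ x + L + 1))) * τ x) with hr
  have hden : ∀ x, 0 < 2 * (2 * D + 2 * L * τ x + L + 1) := fun x => by have := h1 x; positivity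
  have hrpos : ∀ x, 0 < r x := fun x => by
    have := h1 x; have := hden x
    simp only [hr]; positivity
  have hr1 : ∀ x, r x ≤ τ x := fun x => by
    refine (min_le_right _ _).trans ?_
    exact mul_le_of_le_one_left (h1 x).le (min_le_left _ _)
  have hr2 : ∀ x, (2 * D + 2 * L * τ x + L + 1) * r x ≤ ε / 2 * τ x := fun x => by
    have hh := hden x
    have e1 : r x ≤ (ε / (2 * (2 * D + 2 * L * τ x + L + 1))) * τ x :=
      (min_le_right _ _).trans (mul_le_mul_of_nonneg_right (min_le_right _ _) (h1 x).le)
    calc (2 * D + 2 * L * τ x + L + 1) * r x ≤ (2 * D + 2 * L * τ x + L + 1) *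
        ((ε / (2 * (2 * D + 2 * L * τ x + L + 1))) * τ x) :=
          mul_le_mul_of_nonneg_left e1 (by linarith)
      _ = ε / 2 * τ x := by
        have hh' := hh.ne'
        generalize 2 * D + 2 * L * τ x + L + 1 = q at *
        have : q ≠ 0 := by rintro rfl; simp at hh'
        field_simp
  obtain ⟨F, hF⟩ := (isCompact_univ (X := A)).elim_finite_subcover (fun x => ball x (r x))
    (fun x => isOpen_ball) (fun x _ => mem_iUnion.2 ⟨x, mem_ball_self (hrpos x)⟩)
  have hFne : F.Nonempty := by
    obtain ⟨i, hi, _⟩ := mem_iUnion₂.1 (hF (mem_univ hA.some))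
    exact ⟨i, hi⟩
  refine ⟨F.inf' hFne τ, by rw [Finset.lt_inf'_iff]; exact fun i _ => h1 i, fun x => ?_⟩
  obtain ⟨a, ha, hxa⟩ := mem_iUnion₂.1 (hF (mem_univ x))
  rw [mem_ball] at hxa
  have ha1 := hr1 a
  have ha2 := hr2 a
  have hra := hrpos a
  have hta := h1 a
  have hlip := h.lip x a
  have hlip' := abs_le.1 (hlip.trans (mul_le_mul_of_nonneg_left hxa.le hL.le))
  have p1 : 0 ≤ D * r a := by positivity
  have p2 : 0 ≤ L * τ a * r a := by positivity
  have p3 : 0 ≤ L * r a := by positivity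
  have p4 : 0 < ε * τ a := by positivity
  refine ⟨Y a, τ a, Finset.inf'_le _ ha, by linarith [h2 a], ?_, ?_, fun z => ?_⟩
  · linarith [dist_triangle x a (Y a), h3 a]
  · have := h4 a
    nlinarith
  · have h5' := h5 a z
    have t1 := dist_triangle_left a z x
    have t2 : dist a z ^ 2 - dist x z ^ 2 ≤ 2 * D * r a := by
      have e1 : dist a z ^ 2 - dist x z ^ 2 = (dist a z - dist x z) * (dist a z + dist x z) := by ring
      rw [e1]
      have e2 : dist a z + dist x z ≤ 2 * D := by linarith [hD a z, hD x z]
      have e3 : dist a z - dist x z ≤ r a := by linarith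
      have e4 : 0 ≤ dist a z + dist x z := by positivity
      nlinarith [mul_le_mul_of_nonneg_right e3 e4, mul_le_mul_of_nonneg_left e2 hra.le]
    have t3 : τ a * (f a - f x) ≤ τ a * (L * r a) :=
      mul_le_mul_of_nonneg_left (by linarith [hlip'.1]) hta.le
    nlinarith

structure Chain (f : A → ℝ) (L e : ℝ) (x : ℕ → A) (t : ℕ → ℝ) : Prop where
  t0 : t 0 = 0
  mono : ∀ k, t k < t (k + 1)
  le : ∀ k, t (k + 1) ≤ t k + e
  dst : ∀ k, dist (x k) (x (k + 1)) ≤ (L + 1) * (t (k + 1) - t k)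
  fge : ∀ k, f (x k) - e * (t (k + 1) - t k) ≤ f (x (k + 1))
  star : ∀ k z, dist (x (k + 1)) z ^ 2 ≤ dist (x k) z ^ 2 +
    2 * (t (k + 1) - t k) * (f (x k) - f z) + e * (t (k + 1) - t k)

theorem Chain.weaken {e e' : ℝ} {x : ℕ → A} {t : ℕ → ℝ} (h : Chain f L e x t) (hee : e ≤ e') :
    Chain f L e' x t where
  t0 := h.t0
  mono := h.mono
  le k := (h.le k).trans (by linarith)
  dst := h.dst
  fge k := by
    have h1 := h.fge k; have h2 := h.mono k
    nlinarith [mul_le_mul_of_nonneg_right hee (sub_nonneg.2 h2.le)]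
  star k z := by
    have h1 := h.star k z; have h2 := h.mono k
    nlinarith [mul_le_mul_of_nonneg_right hee (sub_nonneg.2 h2.le)]

theorem Chain.nonneg {e : ℝ} {x : ℕ → A} {t : ℕ → ℝ} (h : Chain f L e x t) (k : ℕ) : 0 ≤ t k := by
  induction k with
  | zero => exact h.t0.ge
  | succ k ih => exact ih.trans (h.mono k).le

theorem chain_compare (hL : 0 < L) (hlip : ∀ x y, |f x - f y| ≤ L * dist x y) {e : ℝ} (he : 0 < e)
    {x y : ℕ → A} {t u : ℕ → ℝ}
    (hx : Chain f L e x t) (hy : Chain f L e y u) : ∀ N k j : ℕ, k + j = N → |t k - u j| ≤ e →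
    dist (x k) (y j) ^ 2 + 2 * (u j - t k) * (f (x k) - f (y j)) ≤
      dist (x 0) (y 0) ^ 2 + (1 + 2 * L * (L + 1)) * e * (t k + u j) := by
  have step : ∀ (x y : ℕ → A) (t u : ℕ → ℝ), Chain f L e x t → Chain f L e y u → ∀ k j,
      |t (k + 1) - u j| ≤ e →
      dist (x (k + 1)) (y j) ^ 2 + 2 * (u j - t (k + 1)) * (f (x (k + 1)) - f (y j)) ≤
      dist (x k) (y j) ^ 2 + 2 * (u j - t k) * (f (x k) - f (y j)) +
        (1 + 2 * L * (L + 1)) * e * (t (k + 1) - t k) := by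
    intro x y t u hx hy k j hkj
    have h1 := hx.star k (y j)
    have h2 : |f (x (k + 1)) - f (x k)| ≤ L * ((L + 1) * (t (k + 1) - t k)) := by
      refine (hlip _ _).trans (mul_le_mul_of_nonneg_left ?_ hL.le)
      rw [dist_comm]; exact hx.dst k
    have h3 : (u j - t (k + 1)) * (f (x (k + 1)) - f (x k)) ≤
        e * (L * ((L + 1) * (t (k + 1) - t k))) := by
      refine (le_abs_self _).trans ?_
      rw [abs_mul, abs_sub_comm]
      exact mul_le_mul hkj h2 (abs_nonneg _) he.le
    linarith
  intro N
  induction N with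
  | zero =>
    intro k j hkj _
    obtain ⟨rfl, rfl⟩ : k = 0 ∧ j = 0 := by omega
    simp [hx.t0, hy.t0]
  | succ N ih =>
    intro k j hkj hd
    have hd' := abs_le.1 hd
    by_cases hc : u j ≤ t k ∧ k ≠ 0
    · obtain ⟨k, rfl⟩ := Nat.exists_eq_succ_of_ne_zero hc.2
      have := step x y t u hx hy k j hd
      have h2 := ih k j (by omega) (by
        have := hx.le k; have := hx.mono k
        simp only [Nat.succ_eq_add_one] at *
        rw [abs_le]; constructor <;> linarith [hc.1])
      simp only [Nat.succ_eq_add_one] at *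
      linarith
    · have hj : j ≠ 0 := by
        rintro rfl
        have : k ≠ 0 := by omega
        rw [hy.t0] at hc
        exact hc ⟨hx.nonneg k, this⟩
      obtain ⟨j, rfl⟩ := Nat.exists_eq_succ_of_ne_zero hj
      have htu : t k ≤ u (j + 1) := by
        by_cases hk : k = 0
        · subst hk; rw [hx.t0]; exact hy.nonneg _
        · by_contra hcon
          push Not at hcon
          exact hc ⟨hcon.le, hk⟩
      have := step y x u t hy hx j k (by rw [abs_sub_comm]; exact hd)
      have h2 := ih k j (by omega) (by
        have := hy.le j; have := hy.mono j
        simp only [Nat.succ_eq_add_one] at *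
        rw [abs_le]; constructor <;> linarith)
      simp only [Nat.succ_eq_add_one] at *
      rw [dist_comm (y (j + 1)), dist_comm (y j)] at this
      linarith

/-- `w` is the position at time `T` of some `e`-chain starting at `x`. -/
def ChPos (f : A → ℝ) (L e : ℝ) (x : A) (T : ℝ) (w : A) : Prop :=
  ∃ (xs : ℕ → A) (ts : ℕ → ℝ), Chain f L e xs ts ∧ xs 0 = x ∧
    Filter.Tendsto ts Filter.atTop Filter.atTop ∧ ∃ k, w = xs k ∧ ts k ≤ T ∧ T ≤ ts k + e

theorem chain_exists [CompactSpace A] (h : FlowData A f L C s1) {D : ℝ}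
    (hD : ∀ x y : A, dist x y ≤ D) (e : ℝ) (he : 0 < e) (x : A) :
    ∃ (xs : ℕ → A) (ts : ℕ → ℝ), Chain f L e xs ts ∧ xs 0 = x ∧
    Filter.Tendsto ts Filter.atTop Filter.atTop := by
  obtain ⟨τm, hτm, H⟩ := flow_uniform h hD e he
  choose Y τ h1 h2 h3 h4 h5 using H
  set xs : ℕ → A := fun k => Y^[k] x with hxs
  set ts : ℕ → ℝ := fun k => ∑ i ∈ Finset.range k, τ (xs i) with hts
  have e1 : ∀ k, xs (k + 1) = Y (xs k) := fun k => by simp only [hxs, Function.iterate_succ_apply']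
  have e2 : ∀ k, ts (k + 1) = ts k + τ (xs k) := fun k => by simp only [hts, Finset.sum_range_succ]
  refine ⟨xs, ts, ⟨by simp [hts], fun k => ?_, fun k => ?_, fun k => ?_, fun k => ?_, fun k z => ?_⟩,
    by simp [hxs], ?_⟩
  · rw [e2]; linarith [h1 (xs k)]
  · rw [e2]; linarith [h2 (xs k)]
  · rw [e2, e1, add_sub_cancel_left]; exact h3 _
  · rw [e2, e1, add_sub_cancel_left]; exact h4 _
  · rw [e2, e1, add_sub_cancel_left]; exact h5 _ z
  · have hge : ∀ k : ℕ, (k : ℝ) * τm ≤ ts k := by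
      intro k
      induction k with
      | zero => simp [hts]
      | succ k ih => rw [e2]; push_cast; linarith [h1 (xs k)]
    refine Filter.tendsto_atTop_mono hge ?_
    exact tendsto_natCast_atTop_atTop.atTop_mul_const hτm

theorem chain_time {e : ℝ} {x : ℕ → A} {t : ℕ → ℝ} (h : Chain f L e x t)
    (ht : Filter.Tendsto t Filter.atTop Filter.atTop) (T : ℝ) (hT : 0 ≤ T) :
    ∃ k, t k ≤ T ∧ T ≤ t k + e := by
  obtain ⟨m, hm⟩ := (ht.eventually (Filter.eventually_gt_atTop T)).exists
  classical
  have hex : ∃ m, T < t m := ⟨m, hm⟩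
  have h1 := Nat.find_spec hex
  have hne : Nat.find hex ≠ 0 := by
    intro h0; rw [h0, h.t0] at h1; linarith
  obtain ⟨k, hk⟩ := Nat.exists_eq_succ_of_ne_zero hne
  have h2 : t k ≤ T := not_lt.1 (Nat.find_min hex (by omega))
  rw [hk] at h1
  exact ⟨k, h2, h1.le.trans (h.le k)⟩

theorem ChPos.exist [CompactSpace A] (h : FlowData A f L C s1) {D : ℝ}
    (hD : ∀ x y : A, dist x y ≤ D) (e : ℝ) (he : 0 < e) (x : A) (T : ℝ) (hT : 0 ≤ T) :
    ∃ w, ChPos f L e x T w := by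
  obtain ⟨xs, ts, h1, h2, h3⟩ := chain_exists h hD e he x
  obtain ⟨k, hk⟩ := chain_time h1 h3 T hT
  exact ⟨xs k, xs, ts, h1, h2, h3, k, rfl, hk⟩

theorem ChPos.weaken {e e' : ℝ} {x w : A} {T : ℝ} (h : ChPos f L e x T w) (hee : e ≤ e') :
    ChPos f L e' x T w := by
  obtain ⟨xs, ts, h1, h2, h3, k, h4, h5, h6⟩ := h
  exact ⟨xs, ts, h1.weaken hee, h2, h3, k, h4, h5, by linarith⟩

theorem ChPos.compare (hL : 0 < L) (hlip : ∀ x y, |f x - f y| ≤ L * dist x y) {D : ℝ}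
    (hD : ∀ x y : A, dist x y ≤ D) {e : ℝ} (he : 0 < e) {x y w v : A} {T : ℝ}
    (hx : ChPos f L e x T w) (hy : ChPos f L e y T v) :
    dist w v ^ 2 ≤ dist x y ^ 2 + (2 * (1 + 2 * L * (L + 1)) * T + 2 * L * D) * e := by
  obtain ⟨xs, ts, h1, rfl, h3, k, rfl, h5, h6⟩ := hx
  obtain ⟨ys, us, g1, rfl, g3, j, rfl, g5, g6⟩ := hy
  have hkj : |ts k - us j| ≤ e := by rw [abs_le]; constructor <;> linarith
  have hc := chain_compare hL hlip he h1 g1 (k + j) k j rfl hkj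
  have h2 : |f (xs k) - f (ys j)| ≤ L * D :=
    (hlip _ _).trans (mul_le_mul_of_nonneg_left (hD _ _) hL.le)
  have h7 : -(e * (L * D)) ≤ (us j - ts k) * (f (xs k) - f (ys j)) := by
    have : |(us j - ts k) * (f (xs k) - f (ys j))| ≤ e * (L * D) := by
      rw [abs_mul, abs_sub_comm]
      exact mul_le_mul hkj h2 (abs_nonneg _) he.le
    exact (abs_le.1 this).1
  have h8 : (1 + 2 * L * (L + 1)) * e * (ts k + us j) ≤ (1 + 2 * L * (L + 1)) * e * (T + T) :=
    mul_le_mul_of_nonneg_left (by linarith) (by positivity)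
  linarith

theorem ChPos.zero {e : ℝ} {x w : A} (h : ChPos f L e x 0 w) : w = x := by
  obtain ⟨xs, ts, h1, rfl, h3, k, rfl, h5, h6⟩ := h
  rcases Nat.eq_zero_or_pos k with rfl | hk
  · rfl
  · obtain ⟨k, rfl⟩ := Nat.exists_eq_succ_of_ne_zero hk.ne'
    have := h1.nonneg k; have := h1.mono k
    simp only [Nat.succ_eq_add_one] at *
    linarith

theorem ChPos.time (hL : 0 < L) {e : ℝ} {x w : A} {T T' : ℝ} (he : 0 < e)
    (h : ChPos f L e x T w) (hT : 0 ≤ T)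
    (hTT : T ≤ T') : ∃ w', ChPos f L e x T' w' ∧ dist w w' ≤ (L + 1) * (T' - T + e) := by
  obtain ⟨xs, ts, h1, rfl, h3, k, rfl, h5, h6⟩ := h
  obtain ⟨j, j1, j2⟩ := chain_time h1 h3 T' (by linarith)
  refine ⟨xs j, ⟨xs, ts, h1, rfl, h3, j, rfl, j1, j2⟩, ?_⟩
  have key : ∀ a b : ℕ, dist (xs a) (xs (a + b)) ≤ (L + 1) * (ts (a + b) - ts a) := by
    intro a b
    induction b with
    | zero => simp
    | succ b ih =>
      have := h1.dst (a + b)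
      have := dist_triangle (xs a) (xs (a + b)) (xs (a + b + 1))
      rw [← add_assoc]; linarith
  rcases le_total k j with hkj | hkj
  · obtain ⟨b, rfl⟩ := Nat.exists_eq_add_of_le hkj
    refine (key k b).trans (mul_le_mul_of_nonneg_left (by linarith) (by linarith))
  · obtain ⟨b, rfl⟩ := Nat.exists_eq_add_of_le hkj
    rw [dist_comm]
    refine (key j b).trans (mul_le_mul_of_nonneg_left (by linarith) (by linarith))

theorem ChPos.fge {e : ℝ} {x w : A} {T : ℝ} (he : 0 < e)
    (h : ChPos f L e x T w) : f x - e * T ≤ f w := by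
  obtain ⟨xs, ts, h1, rfl, h3, k, rfl, h5, h6⟩ := h
  have key : ∀ k, f (xs 0) - e * ts k ≤ f (xs k) := by
    intro k
    induction k with
    | zero => simp [h1.t0]
    | succ k ih => linarith [h1.fge k]
  have := key k
  have := mul_le_mul_of_nonneg_left h5 he.le
  linarith

theorem ChPos.fmax {e : ℝ} {x w p : A} {T : ℝ} (he : 0 < e) (hp : ∀ z, f z ≤ f p)
    (h : ChPos f L e x T w) : 2 * (T - e) * (f p - f w) ≤ dist x p ^ 2 + e * T * (1 + 2 * T) := by
  obtain ⟨xs, ts, h1, rfl, h3, k, rfl, h5, h6⟩ := h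
  have key : ∀ k, ts k ≤ T → dist (xs k) p ^ 2 + 2 * ts k * (f p - f (xs k)) ≤
      dist (xs 0) p ^ 2 + e * ts k * (1 + 2 * T) := by
    intro k
    induction k with
    | zero => simp [h1.t0]
    | succ k ih =>
      intro hk
      have hm := h1.mono k
      have ih := ih (by linarith)
      have s := h1.star k p
      have ff := h1.fge k
      have nn := h1.nonneg (k + 1)
      have q1 : ts (k + 1) * (f (xs k) - f (xs (k + 1))) ≤ T * (e * (ts (k + 1) - ts k)) := by
        refine (mul_le_mul_of_nonneg_left (show f (xs k) - f (xs (k + 1)) ≤ e * (ts (k + 1) - ts k) by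
          linarith) nn).trans (mul_le_mul_of_nonneg_right hk (mul_nonneg he.le (by linarith)))
      linarith
  have h7 := key k h5
  have h8 : (T - e) * (f p - f (xs k)) ≤ ts k * (f p - f (xs k)) :=
    mul_le_mul_of_nonneg_right (by linarith) (by linarith [hp (xs k)])
  have h0 := h1.nonneg k
  have h9 : e * ts k * (1 + 2 * T) ≤ e * T * (1 + 2 * T) :=
    mul_le_mul_of_nonneg_right (mul_le_mul_of_nonneg_left h5 he.le) (by linarith)
  have := sq_nonneg (dist (xs k) p)
  linarith

end


section


variable {A : Type} [MetricSpace A] {f : A → ℝ} {L C s1 : ℝ}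

theorem flow_limit [CompactSpace A] (h : FlowData A f L C s1) {D : ℝ}
    (hD : ∀ x y : A, dist x y ≤ D) (x : A) (T : ℝ) (hT : 0 ≤ T) :
    ∃ v, ∀ e > 0, ∀ w, ChPos f L e x T w →
      dist w v ^ 2 ≤ (2 * (1 + 2 * L * (L + 1)) * T + 2 * L * D) * e := by
  have hL := h.Lpos
  have hD0 : 0 ≤ D := le_trans dist_nonneg (hD x x)
  set K := 2 * (1 + 2 * L * (L + 1)) * T + 2 * L * D with hK
  have hK0 : 0 ≤ K := by positivity
  have hen : ∀ n : ℕ, (0:ℝ) < 1 / (n + 1) := fun n => by positivity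
  choose w hw using fun n : ℕ => ChPos.exist h hD (1 / (n + 1)) (hen n) x T hT
  have hcmp : ∀ e > 0, ∀ a b, ChPos f L e x T a → ChPos f L e x T b → dist a b ^ 2 ≤ K * e := by
    intro e he a b ha hb
    have := ChPos.compare hL h.lip hD he ha hb
    simpa using this
  have hanti : ∀ N n : ℕ, N ≤ n → (1:ℝ) / (n + 1) ≤ 1 / (N + 1) := fun N n hn => by
    apply one_div_le_one_div_of_le (by positivity)
    have : (N : ℝ) ≤ n := by exact_mod_cast hn
    linarith
  have hlim0 : Filter.Tendsto (fun n : ℕ => (1:ℝ) / (n + 1)) Filter.atTop (nhds 0) :=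
    tendsto_one_div_add_atTop_nhds_zero_nat
  have hc : CauchySeq w := by
    rw [Metric.cauchySeq_iff']
    intro ε hε
    have h1 : Filter.Tendsto (fun n : ℕ => K * ((1:ℝ) / (n + 1))) Filter.atTop (nhds (K * 0)) :=
      hlim0.const_mul K
    rw [mul_zero] at h1
    obtain ⟨N, hN⟩ := (h1.eventually (gt_mem_nhds (show 0 < ε ^ 2 by positivity))).exists
    refine ⟨N, fun n hn => ?_⟩
    have := hcmp _ (hen N) _ _ ((hw n).weaken (hanti N n hn)) (hw N)
    exact lt_of_pow_lt_pow_left₀ 2 hε.le (lt_of_le_of_lt this hN)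
  obtain ⟨v, hv⟩ := cauchySeq_tendsto_of_complete hc
  refine ⟨v, fun e he a ha => ?_⟩
  have h2 : Filter.Tendsto (fun n => dist a (w n) ^ 2) Filter.atTop (nhds (dist a v ^ 2)) :=
    (tendsto_const_nhds.dist hv).pow 2
  refine le_of_tendsto h2 ?_
  filter_upwards [hlim0.eventually (gt_mem_nhds he)] with n hn
  exact hcmp e he _ _ ha ((hw n).weaken hn.le)

theorem le_of_forall_eps {a b c : ℝ} (G : ℝ → ℝ) (hG : Filter.Tendsto G (nhdsWithin 0 (Ioi 0)) (nhds b))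
    (h : ∀ e > 0, a ≤ G e) : a ≤ b :=
  ge_of_tendsto hG (Filter.eventually_of_mem self_mem_nhdsWithin (fun e he => h e he))

theorem tend_eps (G : ℝ → ℝ) (hG : Continuous G) :
    Filter.Tendsto G (nhdsWithin 0 (Ioi 0)) (nhds (G 0)) :=
  (hG.tendsto 0).mono_left nhdsWithin_le_nhds

theorem flow_semigroup [CompactSpace A] (h : FlowData A f L C s1) {D : ℝ}
    (hD : ∀ x y : A, dist x y ≤ D) (p : A) (hp : ∀ z, f z ≤ f p) :
    ∃ S : ℝ → A → A, (∀ x, S 0 x = x) ∧ (∀ T x y, 0 ≤ T → dist (S T x) (S T y) ≤ dist x y) ∧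
      (∀ T T' x, 0 ≤ T → T ≤ T' → dist (S T x) (S T' x) ≤ (L + 1) * (T' - T)) ∧
      (∀ T x, 0 ≤ T → f x ≤ f (S T x)) ∧
      (∀ T x, 0 ≤ T → 2 * T * (f p - f (S T x)) ≤ dist x p ^ 2) := by
  have hL := h.Lpos
  have hD0 : 0 ≤ D := le_trans dist_nonneg (hD p p)
  set K : ℝ → ℝ := fun T => 2 * (1 + 2 * L * (L + 1)) * T + 2 * L * D with hK
  have hK0 : ∀ T, 0 ≤ T → 0 ≤ K T := fun T hT => by simp only [hK]; positivity
  have hex : ∀ (T : ℝ) (x : A), ∃ v, 0 ≤ T → ∀ e > 0, ∀ w, ChPos f L e x T w →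
      dist w v ≤ √(K T * e) := by
    intro T x
    by_cases hT : 0 ≤ T
    · obtain ⟨v, hv⟩ := flow_limit h hD x T hT
      exact ⟨v, fun _ e he w hw => Real.le_sqrt_of_sq_le (hv e he w hw)⟩
    · exact ⟨x, fun h => absurd h hT⟩
  choose S hS using hex
  have hW := fun e he x T hT => ChPos.exist h hD e he x T hT
  have hflip : ∀ e > 0, ∀ T x w, 0 ≤ T → ChPos f L e x T w → f w - L * √(K T * e) ≤ f (S T x) := by
    intro e he T x w hT hw
    have h1 := hS T x hT e he w hw
    have h2 := (abs_le.1 (h.lip w (S T x))).2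
    have := mul_le_mul_of_nonneg_left h1 hL.le
    linarith
  refine ⟨S, fun x => ?_, fun T x y hT => ?_, fun T T' x hT hTT => ?_, fun T x hT => ?_,
    fun T x hT => ?_⟩
  · have : dist x (S 0 x) ≤ 0 := by
      refine le_of_forall_eps (c := 0) (fun e => √(K 0 * e)) ?_ (fun e he => ?_)
      · have := tend_eps (fun e => √(K 0 * e)) (by fun_prop)
        simpa using this
      · obtain ⟨w, hw⟩ := hW e he x 0 le_rfl
        have := hS 0 x le_rfl e he w hw
        rw [hw.zero] at this; exact this
    exact (dist_le_zero.1 this).symm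
  · refine le_of_forall_eps (c := 0) (fun e => 2 * √(K T * e) + √(dist x y ^ 2 + K T * e)) ?_
      (fun e he => ?_)
    · have := tend_eps (fun e => 2 * √(K T * e) + √(dist x y ^ 2 + K T * e)) (by fun_prop)
      simpa [Real.sqrt_sq dist_nonneg] using this
    · obtain ⟨w, hw⟩ := hW e he x T hT
      obtain ⟨w', hw'⟩ := hW e he y T hT
      have h1 := hS T x hT e he w hw
      have h2 := hS T y hT e he w' hw'
      have h3 : dist w w' ≤ √(dist x y ^ 2 + K T * e) :=
        Real.le_sqrt_of_sq_le (ChPos.compare hL h.lip hD he hw hw')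
      have h4 := dist_triangle4 (S T x) w w' (S T y)
      rw [dist_comm (S T x) w] at h4
      linarith
  · have hT' : 0 ≤ T' := hT.trans hTT
    refine le_of_forall_eps (c := 0)
      (fun e => √(K T * e) + √(K T' * e) + (L + 1) * (T' - T + e)) ?_ (fun e he => ?_)
    · have := tend_eps (fun e => √(K T * e) + √(K T' * e) + (L + 1) * (T' - T + e)) (by fun_prop)
      simpa using this
    · obtain ⟨w, hw⟩ := hW e he x T hT
      obtain ⟨w', hw', h3⟩ := hw.time hL he hT hTT
      have h1 := hS T x hT e he w hw
      have h2 := hS T' x hT' e he w' hw'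
      have h4 := dist_triangle4 (S T x) w w' (S T' x)
      rw [dist_comm (S T x) w] at h4
      linarith
  · refine le_of_forall_eps (c := 0)
      (fun e => f (S T x) + L * √(K T * e) + e * T) ?_ (fun e he => ?_)
    · have := tend_eps (fun e => f (S T x) + L * √(K T * e) + e * T) (by fun_prop)
      simpa using this
    · obtain ⟨w, hw⟩ := hW e he x T hT
      have h1 := hflip e he T x w hT hw
      have h2 := hw.fge he
      linarith
  · refine le_of_forall_eps (c := 0)
      (fun e => dist x p ^ 2 + e * T * (1 + 2 * T) + 2 * T * (L * √(K T * e)) +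
        2 * e * (f p - f x + e * T)) ?_ (fun e he => ?_)
    · have := tend_eps (fun e => dist x p ^ 2 + e * T * (1 + 2 * T) + 2 * T * (L * √(K T * e)) +
        2 * e * (f p - f x + e * T)) (by fun_prop)
      simpa using this
    · obtain ⟨w, hw⟩ := hW e he x T hT
      have h1 := hflip e he T x w hT hw
      have h2 := hw.fge he
      have h3 := hw.fmax he hp
      have h4 := mul_le_mul_of_nonneg_left (show f p - f (S T x) ≤ f p - f w + L * √(K T * e) by
        linarith) (show 0 ≤ 2 * T by linarith)
      have h5 : e * (f p - f w) ≤ e * (f p - f x + e * T) :=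
        mul_le_mul_of_nonneg_left (by linarith) he.le
      linarith

theorem flow_contract [CompactSpace A] (h : FlowData A f L C s1) (p : A) (hp : ∀ z, f z ≤ f p)
    (huniq : ∀ z, f z = f p → z = p) :
    ∃ H : A × ℝ → A, ContinuousOn H (univ ×ˢ Icc 0 1) ∧ (∀ x, H (x, 0) = x) ∧
      (∀ x, H (x, 1) = p) ∧ ∀ x, ∀ s ∈ Icc (0:ℝ) 1, f x ≤ f (H (x, s)) := by
  obtain ⟨D, hD⟩ : ∃ D, ∀ x y : A, dist x y ≤ D := by
    obtain ⟨D, hD⟩ := Metric.isBounded_iff.1 (isCompact_univ (X := A)).isBounded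
    exact ⟨D, fun x y => hD (mem_univ x) (mem_univ y)⟩
  obtain ⟨S, S0, S1, S2, S3, S4⟩ := flow_semigroup h hD p hp
  have hL := h.Lpos
  have hfc : Continuous f := by
    have : LipschitzWith ⟨L, hL.le⟩ f := LipschitzWith.of_dist_le_mul (fun x y => by
      rw [Real.dist_eq]; exact h.lip x y)
    exact this.continuous
  refine ⟨fun q => if q.2 < 1 then S (q.2 / (1 - q.2)) q.1 else p, ?_, fun x => by simp [S0],
    fun x => by simp, ?_⟩
  · rintro ⟨x, s⟩ ⟨-, hs0, hs1⟩
    simp only at hs0 hs1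
    rcases hs1.lt_or_eq with hs | rfl
    · -- interior
      have hdv : ContinuousAt (fun q : A × ℝ => q.2 / (1 - q.2)) (x, s) := by
        apply ContinuousAt.div (by fun_prop) (by fun_prop)
        simp; linarith
      rw [Metric.continuousWithinAt_iff']
      intro ε hε
      have hT0 : 0 ≤ s / (1 - s) := div_nonneg hs0 (by linarith)
      have e1 : ∀ᶠ q : A × ℝ in nhds (x, s), q.2 < 1 :=
        (continuous_snd.tendsto (x, s)).eventually (gt_mem_nhds hs)
      have hcont : ContinuousAt (fun q : A × ℝ => dist q.1 x +
          (L + 1) * |q.2 / (1 - q.2) - s / (1 - s)|) (x, s) := by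
        fun_prop
      have e2 : ∀ᶠ q : A × ℝ in nhds (x, s), dist q.1 x +
          (L + 1) * |q.2 / (1 - q.2) - s / (1 - s)| < ε := by
        refine hcont.eventually (gt_mem_nhds ?_)
        simpa using hε
      filter_upwards [nhdsWithin_le_nhds e1, nhdsWithin_le_nhds e2, self_mem_nhdsWithin]
        with q q1 q2 q3
      obtain ⟨-, q30, q31⟩ := q3
      simp only [if_pos q1, if_pos hs]
      have hT1 : 0 ≤ q.2 / (1 - q.2) := div_nonneg q30 (by linarith)
      refine lt_of_le_of_lt ?_ q2
      refine (dist_triangle _ (S (q.2 / (1 - q.2)) x) _).trans (add_le_add (S1 _ _ _ hT1) ?_)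
      rcases le_total (q.2 / (1 - q.2)) (s / (1 - s)) with hh | hh
      · rw [abs_of_nonpos (by linarith)]
        refine (S2 _ _ x hT1 hh).trans (by linarith)
      · rw [abs_of_nonneg (by linarith), dist_comm]
        exact S2 _ _ x hT0 hh
    · rw [Metric.continuousWithinAt_iff']
      intro ε hε
      simp only [lt_irrefl, if_false]
      -- f-gap
      obtain ⟨η, hη, hgap⟩ : ∃ η > 0, ∀ z, f p - η < f z → dist z p < ε := by
        by_cases hne : ({z | ε ≤ dist z p} : Set A).Nonempty
        · have hcl : IsClosed ({z | ε ≤ dist z p} : Set A) :=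
            isClosed_le continuous_const (by fun_prop)
          obtain ⟨z, hz, hzm⟩ := hcl.isCompact.exists_isMaxOn hne hfc.continuousOn
          have hlt : f z < f p := by
            refine lt_of_le_of_ne (hp z) (fun hh => ?_)
            have := huniq z hh
            subst this
            simp at hz; linarith
          refine ⟨f p - f z, by linarith, fun w hw => ?_⟩
          by_contra hcon
          push Not at hcon
          have := hzm (show w ∈ _ from hcon)
          simp only [mem_setOf_eq] at this
          linarith
        · refine ⟨1, one_pos, fun z _ => ?_⟩
          by_contra hcon
          exact hne ⟨z, not_lt.1 hcon⟩
      have e2 : ∀ᶠ q : A × ℝ in nhds (x, (1:ℝ)), D ^ 2 * (1 - q.2) < 2 * q.2 * η := by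
        have : ContinuousAt (fun q : A × ℝ => 2 * q.2 * η - D ^ 2 * (1 - q.2)) (x, 1) := by fun_prop
        have := this.eventually (lt_mem_nhds (show 0 < _ by simpa using hη))
        filter_upwards [this] with q hq
        linarith
      filter_upwards [nhdsWithin_le_nhds e2, self_mem_nhdsWithin] with q q2 q3
      obtain ⟨-, q30, q31⟩ := q3
      split_ifs with hq
      · apply hgap
        have hpos : 0 < 1 - q.2 := by linarith
        have hT1 : 0 ≤ q.2 / (1 - q.2) := div_nonneg q30 hpos.le
        have h4 := S4 _ q.1 hT1
        have h5 : dist q.1 p ^ 2 ≤ D ^ 2 := pow_le_pow_left₀ dist_nonneg (hD _ _) 2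
        set G := f p - f (S (q.2 / (1 - q.2)) q.1) with hG
        have h6 : 2 * q.2 * G ≤ D ^ 2 * (1 - q.2) := by
          have h7 := mul_le_mul_of_nonneg_right (h4.trans h5) hpos.le
          calc 2 * q.2 * G = 2 * (q.2 / (1 - q.2)) * G * (1 - q.2) := by field_simp
            _ ≤ _ := h7
        have h8 : 2 * q.2 * G < 2 * q.2 * η := by linarith
        have h9 : 0 ≤ 2 * q.2 := by linarith
        have := lt_of_mul_lt_mul_left h8 h9
        linarith
      · simpa using hε
  · rintro x s ⟨hs0, hs1⟩
    simp only
    split_ifs with hs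
    · exact S3 _ _ (div_nonneg hs0 (by linarith))
    · exact hp x

end


section


/-- A set contractible inside itself. -/
def SetContr {X : Type} [TopologicalSpace X] (W : Set X) : Prop :=
  ∃ o ∈ W, ∃ G : X × ℝ → X, ContinuousOn G (W ×ˢ Icc 0 1) ∧ (∀ x ∈ W, G (x, 0) = x) ∧
    (∀ x ∈ W, G (x, 1) = o) ∧ ∀ x ∈ W, ∀ s ∈ Icc (0:ℝ) 1, G (x, s) ∈ W

theorem cone_ext {E X ι : Type} [NormedAddCommGroup E] [NormedSpace ℝ E] [TopologicalSpace X]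
    [Fintype ι] [Nonempty ι] (ℓ : ι → E → ℝ) (hℓc : ∀ i, Continuous (ℓ i))
    (hℓa : ∀ i z w (s : ℝ), ℓ i ((1 - s) • z + s • w) = (1 - s) * ℓ i z + s * ℓ i w)
    (M : Set E) (hM : ∀ z ∈ M, ∀ w ∈ M, ∀ s : ℝ, (1 - s) • z + s • w ∈ M)
    (o : E) (ho : o ∈ M) (hℓo : ∀ i, ℓ i o = 1)
    (hcp : IsCompact {z | z ∈ M ∧ ∀ i, 0 ≤ ℓ i z})
    (hle : ∀ z ∈ M, ∃ i, ℓ i z ≤ 1)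
    (heq : ∀ z ∈ M, (∀ i, 1 ≤ ℓ i z) → z = o)
    (W : Set X) (hW : SetContr W) (H : E → X)
    (hH : ContinuousOn H {z | (z ∈ M ∧ ∀ i, 0 ≤ ℓ i z) ∧ ∃ i, ℓ i z = 0})
    (hHW : ∀ z, (z ∈ M ∧ ∀ i, 0 ≤ ℓ i z) → (∃ i, ℓ i z = 0) → H z ∈ W) :
    ∃ H' : E → X, ContinuousOn H' {z | z ∈ M ∧ ∀ i, 0 ≤ ℓ i z} ∧
      (∀ z, (z ∈ M ∧ ∀ i, 0 ≤ ℓ i z) → H' z ∈ W) ∧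
      (∀ z, (z ∈ M ∧ ∀ i, 0 ≤ ℓ i z) → (∃ i, ℓ i z = 0) → H' z = H z) := by
  obtain ⟨q, hq, G, hG, G0, G1, GW⟩ := hW
  set Q : Set E := {z | z ∈ M ∧ ∀ i, 0 ≤ ℓ i z} with hQ
  set B : Set E := {z | (z ∈ M ∧ ∀ i, 0 ≤ ℓ i z) ∧ ∃ i, ℓ i z = 0} with hB
  have hBQ : B ⊆ Q := fun z hz => hz.1
  set μ : E → ℝ := fun z => Finset.univ.inf' Finset.univ_nonempty (fun i => ℓ i z) with hμ
  have hμc : Continuous μ := Continuous.finset_inf'_apply _ (fun i _ => hℓc i)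
  have hμ0 : ∀ z ∈ Q, 0 ≤ μ z := fun z hz => by
    rw [hμ, Finset.le_inf'_iff]; exact fun i _ => hz.2 i
  have hμle : ∀ z i, μ z ≤ ℓ i z := fun z i => Finset.inf'_le _ (Finset.mem_univ i)
  have hμ1 : ∀ z ∈ Q, μ z ≤ 1 := fun z hz => by
    obtain ⟨i, hi⟩ := hle z hz.1
    exact (hμle z i).trans hi
  have hμex : ∀ z, ∃ i, ℓ i z = μ z := fun z => by
    obtain ⟨i, _, hi⟩ := Finset.exists_mem_eq_inf' Finset.univ_nonempty (fun i => ℓ i z)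
    exact ⟨i, hi.symm⟩
  have hμo : ∀ z ∈ Q, μ z = 1 → z = o := fun z hz h1 => heq z hz.1 (fun i => h1 ▸ hμle z i)
  have hoQ : o ∈ Q := ⟨ho, fun i => by rw [hℓo]; exact zero_le_one⟩
  have hBμ : ∀ z, z ∈ B ↔ z ∈ Q ∧ μ z = 0 := by
    intro z
    constructor
    · rintro ⟨hz, i, hi⟩
      exact ⟨hz, le_antisymm (hi ▸ hμle z i) (hμ0 z hz)⟩
    · rintro ⟨hz, h0⟩
      obtain ⟨i, hi⟩ := hμex z
      exact ⟨hz, i, hi.trans h0⟩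
  set r : E → E := fun z => (1 - μ z)⁻¹ • (z - μ z • o) with hr
  have hreq : ∀ z, r z = (1 - (-(μ z) / (1 - μ z))) • z + (-(μ z) / (1 - μ z)) • o ∨ μ z = 1 := by
    intro z
    by_cases h1 : μ z = 1
    · exact Or.inr h1
    left
    have h1' : 1 - μ z ≠ 0 := fun h => h1 (by linarith)
    simp only [hr]
    rw [smul_sub, smul_smul, sub_eq_add_neg, ← neg_smul]
    congr 2
    · field_simp; ring
    · field_simp
  have hrB : ∀ z ∈ Q, μ z < 1 → r z ∈ B := by
    intro z hz h1
    have h1' : 0 < 1 - μ z := by linarith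
    have he := (hreq z).resolve_right h1.ne
    have hl : ∀ i, ℓ i (r z) = (ℓ i z - μ z) / (1 - μ z) := by
      intro i
      rw [he, hℓa, hℓo]; field_simp; ring
    refine ⟨⟨?_, fun i => ?_⟩, ?_⟩
    · rw [he]; exact hM z hz.1 o ho _
    · rw [hl]; exact div_nonneg (by linarith [hμle z i]) h1'.le
    · obtain ⟨i, hi⟩ := hμex z
      exact ⟨i, by rw [hl, hi]; simp⟩
  refine ⟨fun z => if μ z < 1 then G (H (r z), μ z) else q, ?_, ?_, ?_⟩
  · intro z hz
    by_cases h1 : μ z < 1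
    · have hev : ∀ᶠ y in nhdsWithin z Q, μ y < 1 :=
        ((hμc.tendsto z).eventually (gt_mem_nhds h1)).filter_mono nhdsWithin_le_nhds
      have hrc : ContinuousAt r z := by
        apply ContinuousAt.smul
        · exact ContinuousAt.inv₀ (by fun_prop) (by intro h; linarith)
        · fun_prop
      have hmaps : Filter.Tendsto (fun y => (H (r y), μ y)) (nhdsWithin z Q)
          (nhdsWithin (H (r z), μ z) (W ×ˢ Icc 0 1)) := by
        refine tendsto_nhdsWithin_iff.2 ⟨?_, ?_⟩
        · refine Filter.Tendsto.prodMk_nhds ?_ (hμc.continuousAt.tendsto.mono_left nhdsWithin_le_nhds)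
          have hHr := hH (r z) (hrB z hz h1)
          refine hHr.tendsto.comp ?_
          refine tendsto_nhdsWithin_iff.2 ⟨hrc.tendsto.mono_left nhdsWithin_le_nhds, ?_⟩
          filter_upwards [hev, self_mem_nhdsWithin] with y h2 h3
          exact hrB y h3 h2
        · filter_upwards [hev, self_mem_nhdsWithin] with y h2 h3
          have := hrB y h3 h2
          exact ⟨hHW _ this.1 this.2, hμ0 y h3, h2.le⟩
      have hzr := hrB z hz h1
      have hGz := hG (H (r z), μ z) ⟨hHW _ hzr.1 hzr.2, hμ0 z hz, h1.le⟩
      have := hGz.tendsto.comp hmaps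
      refine (Filter.Tendsto.congr' ?_ this : Filter.Tendsto _ _ _)
        |> fun hh => (by simpa [ContinuousWithinAt, h1] using hh)
      filter_upwards [hev] with y hy
      simp [hy]
    · have hz1 : μ z = 1 := le_antisymm (hμ1 z hz) (not_lt.1 h1)
      have : ContinuousWithinAt (fun z => if μ z < 1 then G (H (r z), μ z) else q) Q z := by
        rw [ContinuousWithinAt]
        simp only [h1, if_false]
        intro N hN
        -- compactness
        have hBc : IsCompact (H '' B) := by
          apply IsCompact.image_of_continuousOn _ hH
          have : B = Q ∩ μ ⁻¹' {0} := by ext z; rw [hBμ]; rfl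
          rw [this]
          exact hcp.inter_right (isClosed_singleton.preimage hμc)
        have hloc : ∀ y ∈ H '' B, ∃ u ∈ nhdsWithin y (H '' B), ∀ᶠ s in nhdsWithin (1:ℝ) (Icc 0 1),
            ∀ y' ∈ u, G (y', s) ∈ N := by
          rintro y ⟨b, hb, rfl⟩
          have hyW := hHW _ hb.1 hb.2
          have hc := hG (H b, 1) ⟨hyW, by norm_num⟩
          rw [ContinuousWithinAt, G1 _ hyW] at hc
          have := hc hN
          rw [nhdsWithin_prod_eq, Filter.mem_map, Filter.mem_prod_iff] at this
          obtain ⟨u, hu, v, hv, huv⟩ := this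
          have hsub : H '' B ⊆ W := by
            rintro _ ⟨b, hb, rfl⟩; exact hHW _ hb.1 hb.2
          refine ⟨u, nhdsWithin_mono _ hsub hu, ?_⟩
          filter_upwards [hv] with s hs y' hy'
          exact huv ⟨hy', hs⟩
        have hall : ∀ᶠ s in nhdsWithin (1:ℝ) (Icc 0 1), ∀ y' ∈ H '' B, G (y', s) ∈ N := by
          refine hBc.induction_on (p := fun S => ∀ᶠ s in nhdsWithin (1:ℝ) (Icc 0 1),
            ∀ y' ∈ S, G (y', s) ∈ N) (by simp) ?_ ?_ hloc
          · intro s t hst ht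
            filter_upwards [ht] with a ha y hy using ha y (hst hy)
          · intro s t hs ht
            filter_upwards [hs, ht] with a ha hb y hy
            rcases hy with hy | hy
            · exact ha y hy
            · exact hb y hy
        have hμt : Filter.Tendsto μ (nhdsWithin z Q) (nhdsWithin 1 (Icc 0 1)) := by
          refine tendsto_nhdsWithin_iff.2 ⟨?_, ?_⟩
          · rw [← hz1]; exact (hμc.tendsto z).mono_left nhdsWithin_le_nhds
          · filter_upwards [self_mem_nhdsWithin] with y hy
            exact ⟨hμ0 y hy, hμ1 y hy⟩
        have h2 := hμt.eventually hall
        rw [Filter.mem_map]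
        filter_upwards [h2, self_mem_nhdsWithin] with y h3 h4
        simp only [mem_preimage]
        split_ifs with h5
        · exact h3 _ ⟨r y, hrB y h4 h5, rfl⟩
        · exact mem_of_mem_nhds hN
      exact this
  · intro z hz
    simp only
    split_ifs with h1
    · have := hrB z hz h1
      exact GW _ (hHW _ this.1 this.2) _ ⟨hμ0 z hz, h1.le⟩
    · exact hq
  · intro z hz hz0
    have h0 : μ z = 0 := ((hBμ z).1 ⟨hz, hz0⟩).2
    have hrz : r z = z := by simp [hr, h0]
    simp only [h0, hrz, zero_lt_one, if_true]
    exact G0 _ (hHW z hz hz0)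

end


section


variable {V : ℕ}

/-- lower and upper codes of a point with respect to the grid of mesh `1/m` -/
def cd (m : ℕ) (x : Fin V → ℝ) : (Fin V → ℤ) × (Fin V → ℤ) :=
  (fun i => ⌊(m:ℝ) * x i⌋, fun i => ⌈(m:ℝ) * x i⌉)

/-- number of free coordinates -/
def dl (c : (Fin V → ℤ) × (Fin V → ℤ)) : ℕ := (Finset.univ.filter (fun i => c.1 i ≠ c.2 i)).card

/-- closed grid cell -/
def PC (m : ℕ) (c : (Fin V → ℤ) × (Fin V → ℤ)) : Set (Fin V → ℝ) :=
  {x | ∑ i, x i = 1 ∧ ∀ i, (c.1 i : ℝ) ≤ m * x i ∧ (m:ℝ) * x i ≤ c.2 i}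

theorem PC_closed (m : ℕ) (c : (Fin V → ℤ) × (Fin V → ℤ)) : IsClosed (PC m c) := by
  have : PC m c = {x | ∑ i, x i = 1} ∩ ⋂ i, ({x | (c.1 i : ℝ) ≤ m * x i} ∩ {x | (m:ℝ) * x i ≤ c.2 i}) := by
    ext x; simp [PC]
  rw [this]
  refine (isClosed_eq (by fun_prop) (by fun_prop)).inter (isClosed_iInter fun i => ?_)
  exact (isClosed_le (by fun_prop) (by fun_prop)).inter (isClosed_le (by fun_prop) (by fun_prop))

theorem mem_PC_cd (m : ℕ) {x : Fin V → ℝ} (hx : ∑ i, x i = 1) : x ∈ PC m (cd m x) :=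
  ⟨hx, fun i => ⟨Int.floor_le _, Int.le_ceil _⟩⟩

theorem cd_le (m : ℕ) {x : Fin V → ℝ} {c : (Fin V → ℤ) × (Fin V → ℤ)} (hx : x ∈ PC m c) (i : Fin V) :
    c.1 i ≤ (cd m x).1 i ∧ (cd m x).2 i ≤ c.2 i :=
  ⟨Int.le_floor.2 (hx.2 i).1, Int.ceil_le.2 (hx.2 i).2⟩

theorem PC_sub (m : ℕ) {x : Fin V → ℝ} {c : (Fin V → ℤ) × (Fin V → ℤ)} (hx : x ∈ PC m c) :
    PC m (cd m x) ⊆ PC m c := by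
  intro y hy
  refine ⟨hy.1, fun i => ?_⟩
  have h1 := hy.2 i
  have h2 := cd_le m hx i
  have h3 : ((c.1 i : ℤ) : ℝ) ≤ ((cd m x).1 i : ℤ) := by exact_mod_cast h2.1
  have h4 : (((cd m x).2 i : ℤ) : ℝ) ≤ (c.2 i : ℤ) := by exact_mod_cast h2.2
  exact ⟨h3.trans h1.1, h1.2.trans h4⟩

theorem cd_cases (m : ℕ) {x o : Fin V → ℝ} (hx : x ∈ PC m (cd m o)) (i : Fin V) :
    (cd m x).1 i = (cd m x).2 i ∨
      ((cd m x).1 i = (cd m o).1 i ∧ (cd m x).2 i = (cd m o).2 i) := by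
  have h2 := cd_le m hx i
  have h3 : (cd m o).2 i ≤ (cd m o).1 i + 1 := Int.ceil_le_floor_add_one _
  have h4 : (cd m x).1 i ≤ (cd m x).2 i := Int.floor_le_ceil _
  omega

theorem dl_lt (m : ℕ) {x o : Fin V → ℝ} (hx : x ∈ PC m (cd m o)) (hne : cd m x ≠ cd m o) :
    dl (cd m x) < dl (cd m o) := by
  apply Finset.card_lt_card
  rw [Finset.ssubset_iff_of_subset]
  · have : ∃ i, ¬ ((cd m x).1 i = (cd m o).1 i ∧ (cd m x).2 i = (cd m o).2 i) := by
      by_contra hcon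
      push Not at hcon
      exact hne (Prod.ext (funext fun i => (hcon i).1) (funext fun i => (hcon i).2))
    obtain ⟨i, hi⟩ := this
    have h1 := (cd_cases m hx i).resolve_right hi
    have h2 := cd_le m hx i
    refine ⟨i, ?_, by simp [h1]⟩
    simp only [Finset.mem_filter, Finset.mem_univ, true_and]
    omega
  · intro i hi
    simp only [Finset.mem_filter, Finset.mem_univ, true_and] at hi ⊢
    have h1 := (cd_cases m hx i).resolve_left hi
    rw [← h1.1, ← h1.2]; exact hi

theorem dl_eq (m : ℕ) {x o : Fin V → ℝ} (hx : x ∈ PC m (cd m o)) :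
    cd m x = cd m o ∨ dl (cd m x) < dl (cd m o) := by
  by_cases h : cd m x = cd m o
  · exact Or.inl h
  · exact Or.inr (dl_lt m hx h)

theorem PC_space (K : FinSimpComplex V) {m : ℕ} (hm : 0 < m) {o : Fin V → ℝ} (ho : o ∈ K.space) :
    PC m (cd m o) ⊆ K.space := by
  intro x hx
  obtain ⟨h0, h1, s, hs, hss⟩ := ho
  have hm' : (0:ℝ) < m := by exact_mod_cast hm
  have hx0 : ∀ i, 0 ≤ x i := fun i => by
    have := (hx.2 i).1
    have h2 : (0:ℤ) ≤ (cd m o).1 i := Int.floor_nonneg.2 (mul_nonneg hm'.le (h0 i))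
    have h3 : (0:ℝ) ≤ ((cd m o).1 i : ℤ) := by exact_mod_cast h2
    exact nonneg_of_mul_nonneg_right (h3.trans this) hm'
  refine ⟨hx0, hx.1, Finset.univ.filter (fun i => x i ≠ 0), ?_, fun i => by simp⟩
  refine K.down s hs _ ?_ ?_
  · intro i hi
    simp only [Finset.mem_filter, Finset.mem_univ, true_and] at hi
    rw [← hss]
    intro hoi
    apply hi
    have := (hx.2 i).2
    have h2 : (cd m o).2 i = 0 := by simp [cd, hoi]
    rw [h2] at this
    push_cast at this
    nlinarith [hx0 i]
  · by_contra hcon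
    rw [Finset.not_nonempty_iff_eq_empty] at hcon
    have : ∀ i, x i = 0 := fun i => by
      by_contra hne
      have : i ∈ Finset.univ.filter (fun i => x i ≠ 0) := by simp [hne]
      rw [hcon] at this; simp at this
    have h3 := hx.1
    simp [this] at h3

theorem codes_finite (K : FinSimpComplex V) (m : ℕ) : (cd m '' K.space).Finite := by
  have : (cd m '' K.space) ⊆ (Set.Icc (fun _ => (0:ℤ)) (fun _ => (m:ℤ))) ×ˢ
      (Set.Icc (fun _ => (0:ℤ)) (fun _ => (m:ℤ))) := by
    rintro _ ⟨x, ⟨h0, h1, _⟩, rfl⟩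
    have hx1 : ∀ i, x i ≤ 1 := fun i => by
      rw [← h1]; exact Finset.single_le_sum (f := x) (fun j _ => h0 j) (Finset.mem_univ i)
    have hm0 : (0:ℝ) ≤ m := by positivity
    have a1 : ∀ i, 0 ≤ (m:ℝ) * x i := fun i => mul_nonneg hm0 (h0 i)
    have a2 : ∀ i, (m:ℝ) * x i ≤ m := fun i => mul_le_of_le_one_right hm0 (hx1 i)
    refine ⟨⟨fun i => Int.floor_nonneg.2 (a1 i), fun i => ?_⟩, ⟨fun i => Int.ceil_nonneg (a1 i), fun i => ?_⟩⟩
    · have : ⌊(m:ℝ) * x i⌋ ≤ ⌊((m:ℤ):ℝ)⌋ := Int.floor_mono (by exact_mod_cast a2 i)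
      rwa [Int.floor_intCast] at this
    · exact Int.ceil_le.2 (by exact_mod_cast a2 i)
  exact ((Set.finite_Icc _ _).prod (Set.finite_Icc _ _)).subset this

theorem space_eq (K : FinSimpComplex V) {m : ℕ} (hm : 0 < m) :
    K.space = ⋃ c ∈ cd m '' K.space, PC m c := by
  apply Set.Subset.antisymm
  · intro x hx
    exact mem_biUnion ⟨x, hx, rfl⟩ (mem_PC_cd m hx.2.1)
  · refine iUnion₂_subset ?_
    rintro _ ⟨o, ho, rfl⟩
    exact PC_space K hm ho

theorem space_closed (K : FinSimpComplex V) : IsClosed K.space := by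
  rw [space_eq K one_pos]
  exact (codes_finite K 1).isClosed_biUnion (fun c _ => PC_closed 1 c)

theorem space_compact (K : FinSimpComplex V) : IsCompact K.space := by
  refine (isCompact_univ_pi (fun _ : Fin V => isCompact_Icc (a := (0:ℝ)) (b := 1))).of_isClosed_subset
    (space_closed K) ?_
  rintro x ⟨h0, h1, _⟩ i -
  refine ⟨h0 i, ?_⟩
  rw [← h1]; exact Finset.single_le_sum (f := x) (fun j _ => h0 j) (Finset.mem_univ i)

theorem space_mono {K L : FinSimpComplex V} (h : L.faces ⊆ K.faces) : L.space ⊆ K.space := by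
  rintro x ⟨h0, h1, s, hs, h2⟩
  exact ⟨h0, h1, s, h hs, h2⟩

end


section

variable {V : ℕ}

theorem cd_strict (m : ℕ) (o : Fin V → ℝ) (i : Fin V) (h : (cd m o).1 i ≠ (cd m o).2 i) :
    ((cd m o).1 i : ℝ) < m * o i ∧ (m:ℝ) * o i < (cd m o).2 i := by
  have h1 : ((cd m o).1 i : ℝ) ≤ m * o i := Int.floor_le _
  have h2 : (m:ℝ) * o i ≤ (cd m o).2 i := Int.le_ceil _
  constructor
  · refine lt_of_le_of_ne h1 fun he => h ?_
    change ⌊(m:ℝ) * o i⌋ = ⌈(m:ℝ) * o i⌉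
    rw [← he]; simp
  · refine lt_of_le_of_ne h2 fun he => h ?_
    change ⌊(m:ℝ) * o i⌋ = ⌈(m:ℝ) * o i⌉
    rw [he]; simp

theorem cd_eq_of (m : ℕ) {x o : Fin V → ℝ} (hx : x ∈ PC m (cd m o))
    (h : ∀ i, (cd m o).1 i ≠ (cd m o).2 i → ((cd m o).1 i : ℝ) < m * x i ∧ (m:ℝ) * x i < (cd m o).2 i) :
    cd m x = cd m o := by
  have key : ∀ i, (cd m x).1 i = (cd m o).1 i ∧ (cd m x).2 i = (cd m o).2 i := by
    intro i
    have h3 : (cd m o).2 i ≤ (cd m o).1 i + 1 := Int.ceil_le_floor_add_one _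
    have h4 : (cd m o).1 i ≤ (cd m o).2 i := Int.floor_le_ceil _
    have h5 : (cd m x).1 i ≤ (cd m x).2 i := Int.floor_le_ceil _
    have h6 := cd_le m hx i
    by_cases he : (cd m o).1 i = (cd m o).2 i
    · constructor <;> omega
    · obtain ⟨h1, h2⟩ := h i he
      have h7 : (cd m x).1 i < (cd m o).2 i := Int.floor_lt.2 h2
      have h8 : (cd m o).1 i < (cd m x).2 i := Int.lt_ceil.2 h1
      constructor <;> omega
  exact Prod.ext (funext fun i => (key i).1) (funext fun i => (key i).2)

theorem cell_ext {X : Type} [TopologicalSpace X] {m : ℕ} (hm : 0 < m) {o : Fin V → ℝ}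
    (hos : ∑ i, o i = 1) (W : Set X) (hW : SetContr W) (H : (Fin V → ℝ) × ℝ → X)
    (hH : ContinuousOn H {z | (z.1 ∈ PC m (cd m o) ∧ z.2 ∈ Icc (0:ℝ) 1) ∧
      (cd m z.1 ≠ cd m o ∨ z.2 = 0 ∨ z.2 = 1)})
    (hHW : ∀ z : (Fin V → ℝ) × ℝ, z.1 ∈ PC m (cd m o) → z.2 ∈ Icc (0:ℝ) 1 →
      (cd m z.1 ≠ cd m o ∨ z.2 = 0 ∨ z.2 = 1) → H z ∈ W) :
    ∃ H' : (Fin V → ℝ) × ℝ → X,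
      ContinuousOn H' {z | z.1 ∈ PC m (cd m o) ∧ z.2 ∈ Icc (0:ℝ) 1} ∧
      (∀ z : (Fin V → ℝ) × ℝ, z.1 ∈ PC m (cd m o) → z.2 ∈ Icc (0:ℝ) 1 → H' z ∈ W) ∧
      (∀ z : (Fin V → ℝ) × ℝ, z.1 ∈ PC m (cd m o) → z.2 ∈ Icc (0:ℝ) 1 →
      (cd m z.1 ≠ cd m o ∨ z.2 = 0 ∨ z.2 = 1) → H' z = H z) := by
  have hm' : (0:ℝ) < m := by exact_mod_cast hm
  set a := (cd m o).1 with ha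
  set b := (cd m o).2 with hb
  have hst : ∀ i, a i ≠ b i → (a i : ℝ) < m * o i ∧ (m:ℝ) * o i < b i := cd_strict m o
  let ι := ({i : Fin V // a i ≠ b i} × Bool) ⊕ Bool
  let ℓ : ι → (Fin V → ℝ) × ℝ → ℝ := fun j z => match j with
    | Sum.inl (i, true) => (m * z.1 i.1 - a i.1) / (m * o i.1 - a i.1)
    | Sum.inl (i, false) => (b i.1 - m * z.1 i.1) / (b i.1 - m * o i.1)
    | Sum.inr true => 2 * z.2
    | Sum.inr false => 2 * (1 - z.2)
  let M : Set ((Fin V → ℝ) × ℝ) := {z | ∑ i, z.1 i = 1 ∧ ∀ i, a i = b i → (m:ℝ) * z.1 i = a i}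
  have hoM : ∀ i, a i = b i → (m:ℝ) * o i = a i := fun i hi => by
    have h1 : (a i : ℝ) ≤ m * o i := Int.floor_le _
    have h2 : (m:ℝ) * o i ≤ b i := Int.le_ceil _
    rw [← hi] at h2; linarith
  have hset : ∀ z, (z ∈ M ∧ ∀ i, 0 ≤ ℓ i z) ↔ (z.1 ∈ PC m (cd m o) ∧ z.2 ∈ Icc (0:ℝ) 1) := by
    intro z
    constructor
    · rintro ⟨⟨h1, h2⟩, h3⟩
      refine ⟨⟨h1, fun i => ?_⟩, ?_, ?_⟩
      · by_cases hi : a i = b i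
        · have := h2 i hi
          constructor
          · exact this.ge
          · have h4 : (cd m o).2 i = a i := hi.symm
            rw [h4]; exact this.le
        · have h4 := h3 (Sum.inl (⟨i, hi⟩, true))
          have h5 := h3 (Sum.inl (⟨i, hi⟩, false))
          have h6 := hst i hi
          simp only [ℓ] at h4 h5
          rw [div_nonneg_iff] at h4 h5
          constructor
          · change (a i : ℝ) ≤ _
            rcases h4 with h | h <;> linarith [h.1, h.2, h6.1]
          · change _ ≤ (b i : ℝ)
            rcases h5 with h | h <;> linarith [h.1, h.2, h6.2]
      · have := h3 (Sum.inr true); simp only [ℓ] at this; linarith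
      · have := h3 (Sum.inr false); simp only [ℓ] at this; linarith
    · rintro ⟨h1, h2⟩
      refine ⟨⟨h1.1, fun i hi => ?_⟩, ?_⟩
      · have := h1.2 i
        have h3 : (a i : ℝ) ≤ m * z.1 i := this.1
        have h4 : (m:ℝ) * z.1 i ≤ b i := this.2
        rw [← hi] at h4; linarith
      · rintro (⟨⟨i, hi⟩, _ | _⟩ | _ | _)
        · simp only [ℓ]
          have h4 : (m:ℝ) * z.1 i ≤ b i := (h1.2 i).2
          exact div_nonneg (by linarith) (by linarith [(hst i hi).2])
        · simp only [ℓ]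
          have h4 : (a i:ℝ) ≤ (m:ℝ) * z.1 i := (h1.2 i).1
          exact div_nonneg (by linarith) (by linarith [(hst i hi).1])
        · simp only [ℓ]; linarith [h2.2]
        · simp only [ℓ]; linarith [h2.1]
  have hzero : ∀ z, (z ∈ M ∧ ∀ i, 0 ≤ ℓ i z) →
      ((∃ i, ℓ i z = 0) ↔ (cd m z.1 ≠ cd m o ∨ z.2 = 0 ∨ z.2 = 1)) := by
    intro z hz
    have hz' := (hset z).1 hz
    constructor
    · rintro ⟨(⟨⟨i, hi⟩, _ | _⟩ | _ | _), h⟩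
      · left
        simp only [ℓ] at h
        intro hcd
        have h6 := hst i hi
        rw [div_eq_zero_iff] at h
        have h7 := (cd_strict m z.1 i (by rw [hcd]; exact hi)).2
        rw [hcd] at h7
        change _ < (b i : ℝ) at h7
        rcases h with h | h <;> linarith
      · left
        simp only [ℓ] at h
        intro hcd
        have h6 := hst i hi
        rw [div_eq_zero_iff] at h
        have h7 := (cd_strict m z.1 i (by rw [hcd]; exact hi)).1
        rw [hcd] at h7
        change (a i : ℝ) < _ at h7
        rcases h with h | h <;> linarith
      · simp only [ℓ] at h; right; right; linarith
      · simp only [ℓ] at h; right; left; linarith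
    · intro h
      by_contra hcon
      push Not at hcon
      rcases h with h | h | h
      · apply h
        apply cd_eq_of m hz'.1
        intro i hi
        have h4 := hz'.1.2 i
        constructor
        · refine lt_of_le_of_ne h4.1 fun he => hcon (Sum.inl (⟨i, hi⟩, true)) ?_
          change (_ - (a i:ℝ)) / _ = 0
          change (a i:ℝ) = _ at he
          rw [he]; simp
        · refine lt_of_le_of_ne h4.2 fun he => hcon (Sum.inl (⟨i, hi⟩, false)) ?_
          change ((b i:ℝ) - _) / _ = 0
          change _ = (b i:ℝ) at he
          rw [he]; simp
      · exact hcon (Sum.inr true) (by simp [ℓ, h])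
      · exact hcon (Sum.inr false) (by simp [ℓ, h])
  have hs1 : {z | z ∈ M ∧ ∀ i, 0 ≤ ℓ i z} = {z | z.1 ∈ PC m (cd m o) ∧ z.2 ∈ Icc (0:ℝ) 1} := by
    ext z; exact hset z
  have hs2 : {z | (z ∈ M ∧ ∀ i, 0 ≤ ℓ i z) ∧ ∃ i, ℓ i z = 0} =
      {z | (z.1 ∈ PC m (cd m o) ∧ z.2 ∈ Icc (0:ℝ) 1) ∧ (cd m z.1 ≠ cd m o ∨ z.2 = 0 ∨ z.2 = 1)} := by
    ext z
    constructor
    · rintro ⟨h1, h2⟩; exact ⟨(hset z).1 h1, (hzero z h1).1 h2⟩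
    · rintro ⟨h1, h2⟩; exact ⟨(hset z).2 h1, (hzero z ((hset z).2 h1)).2 h2⟩
  have hcp : IsCompact {z : (Fin V → ℝ) × ℝ | z.1 ∈ PC m (cd m o) ∧ z.2 ∈ Icc (0:ℝ) 1} := by
    have hPC : IsCompact (PC m (cd m o)) := by
      refine (isCompact_univ_pi (fun i : Fin V => isCompact_Icc (a := (a i:ℝ)/m) (b := (b i:ℝ)/m))).of_isClosed_subset
        (PC_closed m _) ?_
      rintro x ⟨-, h⟩ i -
      constructor
      · rw [div_le_iff₀ hm']; linarith [(h i).1]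
      · rw [le_div_iff₀ hm']; linarith [(h i).2]
    exact hPC.prod isCompact_Icc
  obtain ⟨H', c1, c2, c3⟩ := cone_ext ℓ (by
      rintro (⟨⟨i, hi⟩, _ | _⟩ | _ | _) <;> simp only [ℓ] <;> fun_prop) (by
      rintro (⟨⟨i, hi⟩, _ | _⟩ | _ | _) z w s
      · simp only [ℓ, Prod.fst_add, Prod.smul_fst, Pi.add_apply, Pi.smul_apply, smul_eq_mul]
        ring
      · simp only [ℓ, Prod.fst_add, Prod.smul_fst, Pi.add_apply, Pi.smul_apply, smul_eq_mul]
        ring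
      · simp only [ℓ, Prod.snd_add, Prod.smul_snd, smul_eq_mul]; ring
      · simp only [ℓ, Prod.snd_add, Prod.smul_snd, smul_eq_mul]; ring) M (by
      rintro z ⟨hz1, hz2⟩ w ⟨hw1, hw2⟩ s
      refine ⟨?_, fun i hi => ?_⟩
      · simp only [Prod.fst_add, Prod.smul_fst, Pi.add_apply, Pi.smul_apply, smul_eq_mul,
          Finset.sum_add_distrib, ← Finset.mul_sum, hz1, hw1]; ring
      · simp only [Prod.fst_add, Prod.smul_fst, Pi.add_apply, Pi.smul_apply, smul_eq_mul]
        have := hz2 i hi; have := hw2 i hi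
        calc (m:ℝ) * ((1 - s) * z.1 i + s * w.1 i) = (1-s) * (m * z.1 i) + s * (m * w.1 i) := by ring
          _ = a i := by rw [hz2 i hi, hw2 i hi]; ring) (o, 1/2) ⟨hos, hoM⟩ (by
      rintro (⟨⟨i, hi⟩, _ | _⟩ | _ | _)
      · simp only [ℓ]; exact div_self (by linarith [(hst i hi).2])
      · simp only [ℓ]; exact div_self (by linarith [(hst i hi).1])
      · simp only [ℓ]; norm_num
      · simp only [ℓ]; norm_num) (by rw [hs1]; exact hcp) (by
      intro z _
      rcases le_total z.2 (1/2) with h | h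
      · exact ⟨Sum.inr true, by simp only [ℓ]; linarith⟩
      · exact ⟨Sum.inr false, by simp only [ℓ]; linarith⟩) (by
      rintro z ⟨hz1, hz2⟩ h
      refine Prod.ext (funext fun i => ?_) ?_
      · simp only
        by_cases hi : a i = b i
        · have h1 := hz2 i hi; have h2 := hoM i hi
          exact mul_left_cancel₀ hm'.ne' (h1.trans h2.symm)
        · have h1 := h (Sum.inl (⟨i, hi⟩, true)); have h2 := h (Sum.inl (⟨i, hi⟩, false))
          have h6 := hst i hi
          simp only [ℓ] at h1 h2
          rw [le_div_iff₀ (by linarith)] at h1 h2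
          apply mul_left_cancel₀ hm'.ne'; linarith
      · have h1 := h (Sum.inr true); have h2 := h (Sum.inr false)
        simp only [ℓ] at h1 h2
        simp only; linarith) W hW H (by rw [hs2]; exact hH) (by
      intro z hz hi
      exact hHW z ((hset z).1 hz).1 ((hset z).1 hz).2 ((hzero z hz).1 hi))
  rw [hs1] at c1
  refine ⟨H', c1, fun z h1 h2 => c2 z ((hset z).2 ⟨h1, h2⟩), fun z h1 h2 h3 => ?_⟩
  exact c3 z ((hset z).2 ⟨h1, h2⟩) ((hzero z ((hset z).2 ⟨h1, h2⟩)).2 h3)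

end


section

variable {V : ℕ}

theorem contOn_fin_union {α β ι : Type} [TopologicalSpace α] [TopologicalSpace β] [Finite ι]
    {f : α → β} (Z : ι → Set α) (hc : ∀ i, IsClosed (Z i)) (hf : ∀ i, ContinuousOn f (Z i)) :
    ContinuousOn f (⋃ i, Z i) :=
  (locallyFinite_of_finite Z).continuousOn_iUnion hc (fun {i} => hf i)

def Zk (K L : FinSimpComplex V) (m k : ℕ) : Set ((Fin V → ℝ) × ℝ) :=
  {z | z.1 ∈ K.space ∧ z.2 ∈ Icc (0:ℝ) 1 ∧ (dl (cd m z.1) < k ∨ z.2 = 0 ∨ z.2 = 1 ∨ z.1 ∈ L.space)}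

theorem Zk_closed (K L : FinSimpComplex V) {m : ℕ} (hm : 0 < m) (k : ℕ) : IsClosed (Zk K L m k) := by
  have h1 : {x | x ∈ K.space ∧ dl (cd m x) < k} = ⋃ c ∈ {c | c ∈ cd m '' K.space ∧ dl c < k}, PC m c := by
    ext x
    simp only [mem_iUnion, exists_prop]
    constructor
    · rintro ⟨hx, hd⟩
      exact ⟨cd m x, ⟨⟨x, hx, rfl⟩, hd⟩, mem_PC_cd m hx.2.1⟩
    · rintro ⟨_, ⟨⟨o, ho, rfl⟩, hd⟩, hx⟩
      refine ⟨PC_space K hm ho hx, ?_⟩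
      rcases dl_eq m hx with h | h
      · rw [h]; exact hd
      · omega
  have h2 : IsClosed {x | x ∈ K.space ∧ dl (cd m x) < k} := by
    rw [h1]
    exact ((codes_finite K m).subset (fun c hc => hc.1)).isClosed_biUnion (fun c _ => PC_closed m c)
  have h3 : Zk K L m k = (Prod.fst ⁻¹' K.space ∩ Prod.snd ⁻¹' (Icc (0:ℝ) 1)) ∩
      (Prod.fst ⁻¹' {x | x ∈ K.space ∧ dl (cd m x) < k} ∪ (Prod.snd ⁻¹' {0} ∪
        (Prod.snd ⁻¹' {1} ∪ Prod.fst ⁻¹' L.space))) := by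
    ext z
    simp only [Zk, mem_setOf_eq, mem_inter_iff, mem_union, mem_preimage, mem_singleton_iff]
    tauto
  rw [h3]
  have hK := space_closed K
  have hL := space_closed L
  exact ((hK.preimage continuous_fst).inter (isClosed_Icc.preimage continuous_snd)).inter
    ((h2.preimage continuous_fst).union ((isClosed_singleton.preimage continuous_snd).union
      ((isClosed_singleton.preimage continuous_snd).union (hL.preimage continuous_fst))))

theorem grid_step {X ι : Type} [TopologicalSpace X] (U : ι → Set X)
    (hU : ∀ S : Set ι, S.Nonempty → (⋂ i ∈ S, U i).Nonempty → SetContr (⋂ i ∈ S, U i))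
    (K L : FinSimpComplex V) (hLK : L.faces ⊆ K.faces) {m : ℕ} (hm : 0 < m) (p : X)
    (s0 s1 : (Fin V → ℝ) → X) (h0 : ContinuousOn s0 K.space) (h1 : ContinuousOn s1 K.space)
    (h0L : ∀ x ∈ L.space, s0 x = p) (h1L : ∀ x ∈ L.space, s1 x = p)
    (hS : ∀ o ∈ K.space, ∃ i, ∀ x ∈ PC m (cd m o), s0 x ∈ U i ∧ s1 x ∈ U i) (k : ℕ) :
    ∃ H : (Fin V → ℝ) × ℝ → X, ContinuousOn H (Zk K L m k) ∧
      (∀ z ∈ Zk K L m k, ∀ i, (∀ x ∈ PC m (cd m z.1), s0 x ∈ U i ∧ s1 x ∈ U i) → H z ∈ U i) ∧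
      (∀ x ∈ K.space, H (x, 0) = s0 x) ∧ (∀ x ∈ K.space, H (x, 1) = s1 x) ∧
      (∀ x ∈ L.space, ∀ t ∈ Icc (0:ℝ) 1, H (x, t) = p) := by
  classical
  induction k with
  | zero =>
    let H : (Fin V → ℝ) × ℝ → X := fun z => if z.2 = 0 then s0 z.1 else if z.2 = 1 then s1 z.1 else p
    have e0 : ∀ x, H (x, 0) = s0 x := fun x => by simp [H]
    have e1 : ∀ x, H (x, 1) = s1 x := fun x => by simp [H]
    have eL : ∀ x ∈ L.space, ∀ t, H (x, t) = p := fun x hx t => by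
      simp only [H]; split_ifs
      · exact h0L x hx
      · exact h1L x hx
      · rfl
    have hK := space_closed K
    have hL := space_closed L
    refine ⟨H, ?_, ?_, fun x _ => e0 x, fun x _ => e1 x, fun x hx t _ => eL x hx t⟩
    · have hsub : Zk K L m 0 ⊆ (K.space ×ˢ {0} ∪ K.space ×ˢ {1}) ∪ L.space ×ˢ univ := by
        rintro ⟨x, t⟩ ⟨a1, a2, a3⟩
        simp only at a1 a2 a3
        simp only [mem_union, mem_prod, mem_singleton_iff, mem_univ, and_true]
        rcases a3 with h | h | h | h
        · omega
        · exact Or.inl (Or.inl ⟨a1, h⟩)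
        · exact Or.inl (Or.inr ⟨a1, h⟩)
        · exact Or.inr h
      refine ContinuousOn.mono ?_ hsub
      refine ContinuousOn.union_of_isClosed (ContinuousOn.union_of_isClosed ?_ ?_ (hK.prod isClosed_singleton) (hK.prod isClosed_singleton))
        ?_ ((hK.prod isClosed_singleton).union (hK.prod isClosed_singleton)) (hL.prod isClosed_univ)
      · refine ContinuousOn.congr (f := fun z => s0 z.1) (h0.comp (f := Prod.fst) continuousOn_fst (fun z hz => hz.1)) ?_
        rintro ⟨x, t⟩ ⟨_, ht⟩
        simp only [mem_singleton_iff] at ht; subst ht; exact e0 x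
      · refine ContinuousOn.congr (f := fun z => s1 z.1) (h1.comp (f := Prod.fst) continuousOn_fst (fun z hz => hz.1)) ?_
        rintro ⟨x, t⟩ ⟨_, ht⟩
        simp only [mem_singleton_iff] at ht; subst ht; exact e1 x
      · refine ContinuousOn.congr (f := fun z => p) continuousOn_const ?_
        rintro ⟨x, t⟩ ⟨hx, _⟩
        exact eL x hx t
    · rintro ⟨x, t⟩ ⟨hx, ht, h⟩ i hi
      simp only at hx ht h
      have hi' := hi x (mem_PC_cd m hx.2.1)
      rcases h with h | h | h | h
      · omega
      · subst h; rw [e0]; exact hi'.1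
      · subst h; rw [e1]; exact hi'.2
      · rw [eL x h]; rw [← h0L x h]; exact hi'.1
  | succ k ih =>
    obtain ⟨H, hHc, hHU, hH0, hH1, hHL⟩ := ih
    have hmono : Zk K L m k ⊆ Zk K L m (k+1) := by
      rintro z ⟨a1, a2, a3⟩
      refine ⟨a1, a2, ?_⟩
      rcases a3 with h | h
      · left; omega
      · right; exact h
    have hex : ∀ c : (Fin V → ℤ) × (Fin V → ℤ), ∃ H' : (Fin V → ℝ) × ℝ → X, ∀ o ∈ K.space, o ∉ L.space →
        cd m o = c → dl c = k →
        ContinuousOn H' {z | z.1 ∈ PC m c ∧ z.2 ∈ Icc (0:ℝ) 1} ∧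
        (∀ z : (Fin V → ℝ) × ℝ, z.1 ∈ PC m c → z.2 ∈ Icc (0:ℝ) 1 → ∀ i,
          (∀ x ∈ PC m c, s0 x ∈ U i ∧ s1 x ∈ U i) → H' z ∈ U i) ∧
        (∀ z : (Fin V → ℝ) × ℝ, z.1 ∈ PC m c → z.2 ∈ Icc (0:ℝ) 1 →
          (cd m z.1 ≠ c ∨ z.2 = 0 ∨ z.2 = 1) → H' z = H z) := by
      intro c
      by_cases hc : ∃ o ∈ K.space, o ∉ L.space ∧ cd m o = c ∧ dl c = k
      swap
      · refine ⟨H, fun o h1 h2 h3 h4 => absurd ⟨o, h1, h2, h3, h4⟩ hc⟩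
      obtain ⟨o, ho, hoL, rfl, hk⟩ := hc
      have hZ : ∀ z : (Fin V → ℝ) × ℝ, z.1 ∈ PC m (cd m o) → z.2 ∈ Icc (0:ℝ) 1 →
          (cd m z.1 ≠ cd m o ∨ z.2 = 0 ∨ z.2 = 1) → z ∈ Zk K L m k := by
        intro z a1 a2 a3
        refine ⟨PC_space K hm ho a1, a2, ?_⟩
        rcases a3 with h | h | h
        · left; rw [← hk]; exact dl_lt m a1 h
        · right; left; exact h
        · right; right; left; exact h
      let S : Set ι := {i | ∀ x ∈ PC m (cd m o), s0 x ∈ U i ∧ s1 x ∈ U i}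
      obtain ⟨H', q1, q2, q3⟩ := cell_ext hm ho.2.1 (⋂ i ∈ S, U i) (hU S (hS o ho) ⟨s0 o, by
        simp only [mem_iInter]; intro i hi; exact (hi o (mem_PC_cd m ho.2.1)).1⟩) H
        (hHc.mono (fun z hz => hZ z hz.1.1 hz.1.2 hz.2)) (by
          intro z a1 a2 a3
          simp only [mem_iInter]; intro i hi
          exact hHU z (hZ z a1 a2 a3) i (fun x hx => hi x (PC_sub m a1 hx)))
      refine ⟨H', fun o' _ _ _ _ => ⟨q1, fun z a1 a2 i hi => ?_, q3⟩⟩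
      have := q2 z a1 a2
      simp only [mem_iInter] at this
      exact this i hi
    choose Hc hHcc using hex
    let H' : (Fin V → ℝ) × ℝ → X := fun z => if z ∈ Zk K L m k then H z else Hc (cd m z.1) z
    have eZ : ∀ z ∈ Zk K L m k, H' z = H z := fun z hz => by simp [H', hz]
    have ecell : ∀ o ∈ K.space, o ∉ L.space → dl (cd m o) = k → ∀ z : (Fin V → ℝ) × ℝ,
        z.1 ∈ PC m (cd m o) → z.2 ∈ Icc (0:ℝ) 1 → H' z = Hc (cd m o) z := by
      intro o ho hoL hk z a1 a2
      have hq := hHcc (cd m o) o ho hoL rfl hk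
      by_cases hz : z ∈ Zk K L m k
      · rw [eZ z hz]
        symm
        apply hq.2.2 z a1 a2
        by_contra hcon
        push Not at hcon
        obtain ⟨b1, b2, b3⟩ := hcon
        obtain ⟨_, _, d⟩ := hz
        rcases d with d | d | d | d
        · rw [b1] at d; omega
        · exact b2 d
        · exact b3 d
        · apply hoL
          apply PC_space L hm d
          rw [b1]; exact mem_PC_cd m ho.2.1
      · simp only [H', hz, if_false]
        have : cd m z.1 = cd m o := by
          rcases dl_eq m a1 with h | h
          · exact h
          · exact absurd ⟨PC_space K hm ho a1, a2, Or.inl (by omega)⟩ hz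
        rw [this]
    refine ⟨H', ?_, ?_, ?_, ?_, ?_⟩
    · let T : Set ((Fin V → ℤ) × (Fin V → ℤ)) := {c | ∃ o ∈ K.space, o ∉ L.space ∧ cd m o = c ∧ dl c = k}
      have hT : T.Finite := (codes_finite K m).subset (by rintro c ⟨o, ho, _, rfl, _⟩; exact ⟨o, ho, rfl⟩)
      have := hT.to_subtype
      have hclo : ∀ c : T, IsClosed {z : (Fin V → ℝ) × ℝ | z.1 ∈ PC m c.1 ∧ z.2 ∈ Icc (0:ℝ) 1} := fun c =>
        ((PC_closed m c.1).preimage continuous_fst).inter (isClosed_Icc.preimage continuous_snd)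
      have hsub : Zk K L m (k+1) ⊆ Zk K L m k ∪ ⋃ c : T, {z : (Fin V → ℝ) × ℝ | z.1 ∈ PC m c.1 ∧ z.2 ∈ Icc (0:ℝ) 1} := by
        rintro z ⟨a1, a2, a3⟩
        by_cases hz : z ∈ Zk K L m k
        · exact Or.inl hz
        · right
          have hL : z.1 ∉ L.space := fun h => hz ⟨a1, a2, Or.inr (Or.inr (Or.inr h))⟩
          have hd : dl (cd m z.1) = k := by
            rcases a3 with h | h
            · have : ¬ dl (cd m z.1) < k := fun h => hz ⟨a1, a2, Or.inl h⟩
              omega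
            · exact absurd ⟨a1, a2, Or.inr h⟩ hz
          exact mem_iUnion.2 ⟨⟨cd m z.1, z.1, a1, hL, rfl, hd⟩, mem_PC_cd m a1.2.1, a2⟩
      refine ContinuousOn.mono ?_ hsub
      refine ContinuousOn.union_of_isClosed (hHc.congr eZ) ?_ (Zk_closed K L hm k) (isClosed_iUnion_of_finite hclo)
      refine contOn_fin_union _ hclo ?_
      rintro ⟨_, o, ho, hoL, rfl, hk⟩
      exact (hHcc (cd m o) o ho hoL rfl hk).1.congr (fun z hz => ecell o ho hoL hk z hz.1 hz.2)
    · rintro z hz' i hi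
      by_cases hz : z ∈ Zk K L m k
      · rw [eZ z hz]; exact hHU z hz i hi
      · obtain ⟨a1, a2, a3⟩ := hz'
        have hL : z.1 ∉ L.space := fun h => hz ⟨a1, a2, Or.inr (Or.inr (Or.inr h))⟩
        have hd : dl (cd m z.1) = k := by
          rcases a3 with h | h
          · have : ¬ dl (cd m z.1) < k := fun h => hz ⟨a1, a2, Or.inl h⟩
            omega
          · exact absurd ⟨a1, a2, Or.inr h⟩ hz
        rw [ecell z.1 a1 hL hd z (mem_PC_cd m a1.2.1) a2]
        exact (hHcc (cd m z.1) z.1 a1 hL rfl hd).2.1 z (mem_PC_cd m a1.2.1) a2 i hi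
    · intro x hx
      rw [eZ (x, 0) ⟨hx, by simp, by simp⟩]; exact hH0 x hx
    · intro x hx
      rw [eZ (x, 1) ⟨hx, by simp, by simp⟩]; exact hH1 x hx
    · intro x hx t ht
      rw [eZ (x, t) ⟨space_mono hLK hx, ht, by simp [hx]⟩]; exact hHL x hx t ht

theorem close_of_cover {X ι : Type} [MetricSpace X] [CompactSpace X] (U : ι → Set X)
    (hUo : ∀ i, IsOpen (U i)) (hUc : ∀ x, ∃ i, x ∈ U i)
    (hU : ∀ S : Set ι, S.Nonempty → (⋂ i ∈ S, U i).Nonempty → SetContr (⋂ i ∈ S, U i)) :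
    ∃ R₀ > (0 : ℝ),
      ∀ (V : ℕ) (K L : FinSimpComplex V), L.faces ⊆ K.faces →
        ∀ (p : X) (σ₀ σ₁ : C(↥K.space, X)),
          (∀ x : ↥K.space, (x : Fin V → ℝ) ∈ L.space → σ₀ x = p) →
          (∀ x : ↥K.space, (x : Fin V → ℝ) ∈ L.space → σ₁ x = p) →
          (∀ x : ↥K.space, dist (σ₀ x) (σ₁ x) < R₀) →
          Nonempty (ContinuousMap.HomotopyRel σ₀ σ₁
            {x : ↥K.space | (x : Fin V → ℝ) ∈ L.space}) := by
  classical
  obtain ⟨δ, hδ, hleb⟩ := lebesgue_number_lemma_of_metric (isCompact_univ (X := X)) hUo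
    (fun x _ => mem_iUnion.2 (hUc x))
  refine ⟨δ / 2, by linarith, ?_⟩
  intro V K L hLK p σ₀ σ₁ hp0 hp1 hd
  let e : C(↥K.space, X) → (Fin V → ℝ) → X := fun σ x => if h : x ∈ K.space then σ ⟨x, h⟩ else p
  have ee : ∀ σ (x : K.space), e σ x.1 = σ x := fun σ x => by simp [e, x.2]
  have ec : ∀ σ, ContinuousOn (e σ) K.space := fun σ => by
    rw [continuousOn_iff_continuous_restrict]
    have : K.space.domRestrict (e σ) = σ := by ext x; exact ee σ x
    rw [this]; exact σ.continuous
  have hu : ∀ σ, ∃ η > 0, ∀ x ∈ K.space, ∀ y ∈ K.space, dist x y < η → dist (e σ x) (e σ y) < δ / 2 := fun σ =>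
    Metric.uniformContinuousOn_iff.1 ((space_compact K).uniformContinuousOn_of_continuous (ec σ)) (δ/2) (by linarith)
  obtain ⟨η0, hη0, u0⟩ := hu σ₀
  obtain ⟨η1, hη1, u1⟩ := hu σ₁
  obtain ⟨m, hm⟩ := exists_nat_gt (2 / min η0 η1)
  have hη : 0 < min η0 η1 := lt_min hη0 hη1
  have hm0 : (0:ℝ) < m := lt_trans (by positivity) hm
  have hm' : 0 < m := by exact_mod_cast hm0
  have hclose : ∀ o x : Fin V → ℝ, x ∈ PC m (cd m o) → (∑ i, o i = 1) → dist x o < min η0 η1 := by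
    intro o x hx ho
    rw [div_lt_iff₀ hη] at hm
    rw [dist_pi_lt_iff hη]
    intro i
    have h1 := hx.2 i
    have h2 := (mem_PC_cd m ho).2 i
    have h3 : (cd m o).2 i ≤ (cd m o).1 i + 1 := Int.ceil_le_floor_add_one _
    have h3' : ((cd m o).2 i : ℝ) ≤ (cd m o).1 i + 1 := by exact_mod_cast h3
    rw [Real.dist_eq]
    have : (m:ℝ) * |x i - o i| ≤ 1 := by
      rw [← abs_of_pos hm0, ← abs_mul, abs_le]; constructor <;> nlinarith
    by_contra hcon
    push Not at hcon
    have := mul_le_mul_of_nonneg_left hcon hm0.le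
    linarith
  obtain ⟨H, hHc, _, hH0, hH1, hHL⟩ := grid_step U hU K L hLK hm' p (e σ₀) (e σ₁) (ec _) (ec _)
    (fun x hx => by rw [ee σ₀ ⟨x, space_mono hLK hx⟩]; exact hp0 _ hx)
    (fun x hx => by rw [ee σ₁ ⟨x, space_mono hLK hx⟩]; exact hp1 _ hx)
    (by
      intro o ho
      obtain ⟨i, hi⟩ := hleb (e σ₀ o) (mem_univ _)
      refine ⟨i, fun x hx => ?_⟩
      have hc := hclose o x hx ho.2.1
      have hxK := PC_space K hm' ho hx
      have a0 := u0 x hxK o ho (lt_of_lt_of_le hc (min_le_left _ _))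
      have a1 := u1 x hxK o ho (lt_of_lt_of_le hc (min_le_right _ _))
      have a2 := hd ⟨o, ho⟩
      rw [← ee σ₀ ⟨o, ho⟩, ← ee σ₁ ⟨o, ho⟩, dist_comm] at a2
      constructor
      · apply hi; rw [mem_ball]; linarith
      · apply hi; rw [mem_ball]
        have := dist_triangle (e σ₁ x) (e σ₁ o) (e σ₀ o)
        linarith) (V+1)
  have hall : ∀ x ∈ K.space, ∀ t ∈ Icc (0:ℝ) 1, (x, t) ∈ Zk K L m (V+1) := by
    intro x hx t ht
    refine ⟨hx, ht, Or.inl ?_⟩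
    have : dl (cd m x) ≤ Fintype.card (Fin V) := Finset.card_le_univ _
    simp at this; simp only; omega
  refine ⟨{ toFun := fun z => H (z.2.1, z.1.1), continuous_toFun := ?_, map_zero_left := ?_, map_one_left := ?_, prop' := ?_ }⟩
  · refine hHc.comp_continuous (by fun_prop) (fun z => hall _ z.2.2 _ z.1.2)
  · intro x; change H (x.1, 0) = _
    rw [← ee σ₀ x]; exact hH0 x.1 x.2
  · intro x; change H (x.1, 1) = _
    rw [← ee σ₁ x]; exact hH1 x.1 x.2
  · intro t x hx
    have := hHL x.1 hx t.1 t.2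
    have h2 := hp0 x hx
    simp only [ContinuousMap.coe_mk]
    rw [h2]; exact this

end


section

variable {X : Type} [MetricSpace X] {lam : ℝ}

def GoodF (p : X) (T : X → Prop) : Prop :=
  ∃ (f : X → ℝ) (ρ L c : ℝ), 0 < ρ ∧ 0 ≤ L ∧ 0 < c ∧ (∀ x y, |f x - f y| ≤ L * dist x y) ∧ f p = 0 ∧
    (∀ x, dist p x ≤ ρ → T x → f x ≤ -c * dist p x) ∧
    (∀ x y z, dist p x ≤ ρ → dist p y ≤ ρ → dist p z ≤ ρ → x ≠ y → dist x z = dist x y / 2 →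
      dist z y = dist x y / 2 → (f x + f y)/2 < f z)

theorem GoodF.mono {p : X} {T T' : X → Prop} (h : GoodF p T) (hT : ∀ x, T' x → T x) : GoodF p T' := by
  obtain ⟨f, ρ, L, c, h1, h2, h3, h4, h5, h6, h7⟩ := h
  exact ⟨f, ρ, L, c, h1, h2, h3, h4, h5, fun x hx ht => h6 x hx (hT x ht), h7⟩

theorem GoodF.inf {p : X} {T T' : X → Prop} (h : GoodF p T) (h' : GoodF p T') : GoodF p (fun x => T x ∨ T' x) := by
  obtain ⟨f, ρ, L, c, h1, h2, h3, h4, h5, h6, h7⟩ := h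
  obtain ⟨f', ρ', L', c', h1', h2', h3', h4', h5', h6', h7'⟩ := h'
  refine ⟨fun x => min (f x) (f' x), min ρ ρ', max L L', min c c', lt_min h1 h1', le_max_of_le_left h2, lt_min h3 h3', ?_, ?_, ?_, ?_⟩
  · intro x y
    refine (abs_min_sub_min_le_max _ _ _ _).trans (max_le ?_ ?_)
    · exact (h4 x y).trans (mul_le_mul_of_nonneg_right (le_max_left _ _) dist_nonneg)
    · exact (h4' x y).trans (mul_le_mul_of_nonneg_right (le_max_right _ _) dist_nonneg)
  · simp [h5, h5']
  · intro x hx ht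
    have hd : 0 ≤ dist p x := dist_nonneg
    rcases ht with ht | ht
    · have := h6 x (hx.trans (min_le_left _ _)) ht
      have h8 : min c c' * dist p x ≤ c * dist p x := mul_le_mul_of_nonneg_right (min_le_left _ _) hd
      exact (min_le_left _ _).trans (by linarith)
    · have := h6' x (hx.trans (min_le_right _ _)) ht
      have h8 : min c c' * dist p x ≤ c' * dist p x := mul_le_mul_of_nonneg_right (min_le_right _ _) hd
      exact (min_le_right _ _).trans (by linarith)
  · intro x y z hx hy hz hne hm1 hm2
    have a := h7 x y z (hx.trans (min_le_left _ _)) (hy.trans (min_le_left _ _)) (hz.trans (min_le_left _ _)) hne hm1 hm2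
    have b := h7' x y z (hx.trans (min_le_right _ _)) (hy.trans (min_le_right _ _)) (hz.trans (min_le_right _ _)) hne hm1 hm2
    have e1 := min_le_left (f x) (f' x)
    have e2 := min_le_right (f x) (f' x)
    have e3 := min_le_left (f y) (f' y)
    have e4 := min_le_right (f y) (f' y)
    exact lt_min (by linarith) (by linarith)

theorem GoodF.finset {p : X} {B : Finset X} (hB : B.Nonempty) (T : X → X → Prop) (h : ∀ α ∈ B, GoodF p (T α)) :
    GoodF p (fun x => ∃ α ∈ B, T α x) := by
  induction hB using Finset.Nonempty.cons_induction with
  | singleton a => exact (h a (by simp)).mono (by simp)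
  | cons a s ha hs ih =>
    have := (h a (by simp)).inf (ih (fun α hα => h α (by simp [hα])))
    refine this.mono ?_
    intro x hx
    simpa using hx

theorem Loc.bump [CompactSpace X] (h : Loc X lam) {d : ℕ} (hd : dimH (Set.univ : Set X) < d) (p : X) :
    ∃ (f : X → ℝ) (ρ L c : ℝ), 0 < ρ ∧ 0 ≤ L ∧ 0 < c ∧ (∀ x y, |f x - f y| ≤ L * dist x y) ∧ f p = 0 ∧
    (∀ x, dist p x ≤ ρ → f x ≤ -c * dist p x) ∧
    (∀ x y z, dist p x ≤ ρ → dist p y ≤ ρ → dist p z ≤ ρ → x ≠ y → dist x z = dist x y / 2 →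
      dist z y = dist x y / 2 → (f x + f y)/2 < f z) := by
  classical
  have hl := h.pos
  obtain ⟨ρc, A, cls, hρc, hcls, hcol⟩ := h.coloring hd p
  obtain ⟨r, hr, hlr⟩ : ∃ r : ℝ, 0 < r ∧ lam * (4 * r) ≤ 1/2 := ⟨1/(8*lam), by positivity, by field_simp; norm_num⟩
  obtain ⟨e, hi, hii⟩ := h.expo hd p hr hlr
  obtain ⟨δ, F, hδ, hδ1, hFr, hFs, hFC⟩ := hii (A.card * (128*400*192)^e)
  set δ1 := δ/128 with hδ1def
  set ρ1 := min r (ρc/2) with hρ1def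
  have hρ1 : 0 < ρ1 := lt_min hr (by linarith)
  have hρ1r : ρ1 ≤ r := min_le_left _ _
  have hρ1c : ρ1 ≤ ρc/2 := min_le_right _ _
  let Q : X → X → Finset X → Prop := fun α x S => S.Nonempty ∧ (∀ q ∈ S, dist x q ≤ dist p x / 8 ∧ cls q = α) ∧
    Sepd S (δ1 * dist p x) ∧ F.card ≤ A.card * S.card
  have hrich : ∀ x, 0 < dist p x → dist p x ≤ ρ1 → ∃ α ∈ A, ∃ S, Q α x S := by
    intro x hx0 hx1
    obtain ⟨G, hG1, hG2, hG3⟩ := h.transport' (z := p) (w := x) (R := r) (D := r) (θ := dist p x/8) hFr (by positivity) hFs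
      (hx1.trans hρ1r) (by linarith) (by positivity) (by linarith)
    have hs : δ * r * (dist p x / 8) / (8 * (r + r)) = δ1 * dist p x := by rw [hδ1def]; field_simp; ring
    rw [hs] at hG3
    have hmaps : ∀ q ∈ G, cls q ∈ A := by
      intro q hq
      have h1 := hG2 q hq
      have h2 := dist_triangle p x q
      have h3 := dist_triangle_right p x q
      rw [dist_comm x q] at h1 h2
      rw [dist_comm x q] at h3
      exact hcls q (by linarith) (by linarith)
    have hF0 : 0 < F.card := by
      by_contra hc
      have : F.card = 0 := by omega
      rw [this] at hFC
      have : (0:ℝ) ≤ A.card * (128*400*192)^e * δ := by positivity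
      simp at hFC
      linarith
    by_contra hcon
    push Not at hcon
    have hlt : ∀ α ∈ A, A.card * (G.filter (fun q => cls q = α)).card < F.card := by
      intro α hα
      by_contra hge
      push Not at hge
      refine hcon α hα (G.filter (fun q => cls q = α)) ⟨?_, ?_, ?_, hge⟩
      · rw [← Finset.card_pos]
        rcases Nat.eq_zero_or_pos (G.filter (fun q => cls q = α)).card with h0 | h0
        · rw [h0] at hge; omega
        · exact h0
      · intro q hq
        rw [Finset.mem_filter] at hq
        exact ⟨hG2 q hq.1, hq.2⟩
      · intro a ha b hb hab
        exact hG3 a (Finset.mem_filter.1 ha).1 b (Finset.mem_filter.1 hb).1 hab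
    have hsum := Finset.card_eq_sum_card_fiberwise (f := cls) (s := G) (t := A) (by intro q hq; exact hmaps q hq)
    have hAne : A.Nonempty := by
      have : 0 < G.card := by omega
      obtain ⟨q, hq⟩ := Finset.card_pos.1 this
      exact ⟨_, hmaps q hq⟩
    have := Finset.sum_lt_sum_of_nonempty hAne hlt
    rw [← Finset.mul_sum, ← hsum, hG1, Finset.sum_const, smul_eq_mul] at this
    exact lt_irrefl _ this
  let Rich : X → Prop := fun α => ∃ x, 0 < dist p x ∧ dist p x ≤ ρ1 ∧ ∃ S, Q α x S
  have hfam : ∀ α, Rich α → GoodF p (fun x => dist p x ≤ ρ1 ∧ (∃ S, Q α x S)) := by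
    rintro α ⟨x0, hx0, hx1, S, hSne, hS, hSs, hSc⟩
    have hSd : ∀ q ∈ S, 7/8*dist p x0 ≤ dist p q ∧ dist p q ≤ 9/8*dist p x0 := by
      intro q hq
      have h1 := (hS q hq).1
      have h2 := dist_triangle p x0 q
      have h3 := dist_triangle_right p x0 q
      constructor <;> linarith
    have hcount : 1 < S.card/δ1*(δ1/400/192)^e := by
      have hAp : 0 < A.card := by
        rcases Nat.eq_zero_or_pos A.card with h0 | h0
        · exfalso
          rw [h0] at hSc hFC
          have : F.card = 0 := by omega
          rw [this] at hFC
          simp at hFC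
        · exact h0
      have hAp' : (0:ℝ) < A.card := by exact_mod_cast hAp
      have hSc' : (F.card:ℝ) ≤ A.card * S.card := by exact_mod_cast hSc
      have h1 : A.card * (128*400*192)^e * δ < A.card * S.card * δ^e :=
        hFC.trans_le (mul_le_mul_of_nonneg_right hSc' (by positivity))
      have h2 : (128*400*192)^e * δ < S.card * δ^e := by
        refine lt_of_mul_lt_mul_left ?_ hAp'.le
        linarith
      have h3 : δ1/400/192 = δ / (128*400*192) := by rw [hδ1def]; field_simp
      rw [h3, div_pow, div_mul_div_comm, one_lt_div (by positivity)]
      have h4 : 0 < (128*400*192:ℝ)^e := by positivity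
      have h5 : δ1 * (128*400*192)^e ≤ (128*400*192)^e * δ := by
        rw [hδ1def, mul_comm]; exact mul_le_mul_of_nonneg_left (by linarith) h4.le
      exact h5.trans_lt h2
    obtain ⟨f, ρ, L, c, hρ, hρR, hL, hc, hlip, hfp, hdec, hcon⟩ :=
      h.fam p hr hi (δ := δ1) (R := dist p x0) (by positivity) (by linarith) hx0 (by nlinarith) S hSne hSd hSs hcount
    refine ⟨f, ρ, L, c, hρ, hL, hc, hlip, hfp, ?_, hcon⟩
    rintro x hx ⟨hx2, S', hne', hS', -, -⟩
    rcases eq_or_lt_of_le (dist_nonneg (x := p) (y := x)) with h0 | h0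
    · have : p = x := dist_eq_zero.1 h0.symm
      rw [← this, hfp, dist_self]; simp
    refine hdec x hx ?_
    intro q hq
    obtain ⟨q', hq'⟩ := hne'
    obtain ⟨h1, h2⟩ := hS' q' hq'
    obtain ⟨h3, h4⟩ := hSd q hq
    have h5 := dist_triangle p x q'
    have h6 := dist_triangle_right p x q'
    have h7 := hcol q q' (by linarith) (by linarith) (by linarith) ((hS q hq).2.trans h2.symm)
    have h8 := dist_triangle q q' x
    rw [dist_comm q' x] at h8
    linarith
  by_cases hB : (A.filter Rich).Nonempty
  · obtain ⟨f, ρ, L, c, h1, h2, h3, h4, h5, h6, h7⟩ := GoodF.finset hB _ (fun α hα => hfam α (Finset.mem_filter.1 hα).2)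
    refine ⟨f, min ρ ρ1, L, c, lt_min h1 hρ1, h2, h3, h4, h5, ?_, ?_⟩
    · intro x hx
      rcases eq_or_lt_of_le (dist_nonneg (x := p) (y := x)) with h0 | h0
      · have : p = x := dist_eq_zero.1 h0.symm
        rw [← this, h5, dist_self]; simp
      · have hx1 := hx.trans (min_le_right _ _)
        obtain ⟨α, hα, S, hQ⟩ := hrich x h0 hx1
        exact h6 x (hx.trans (min_le_left _ _)) ⟨α, Finset.mem_filter.2 ⟨hα, x, h0, hx1, S, hQ⟩, hx1, S, hQ⟩
    · intro x y z hx hy hz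
      exact h7 x y z (hx.trans (min_le_left _ _)) (hy.trans (min_le_left _ _)) (hz.trans (min_le_left _ _))
  · have hp : ∀ x, dist p x ≤ ρ1 → p = x := by
      intro x hx
      by_contra hne
      obtain ⟨α, hα, S, hQ⟩ := hrich x (dist_pos.2 hne) hx
      exact hB ⟨α, Finset.mem_filter.2 ⟨hα, x, dist_pos.2 hne, hx, S, hQ⟩⟩
    refine ⟨fun _ => 0, ρ1, 0, 1, hρ1, le_rfl, one_pos, by simp, rfl, ?_, ?_⟩
    · intro x hx
      rw [← hp x hx, dist_self]; simp
    · intro x y z hx hy _ hne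
      exact absurd ((hp x hx).symm.trans (hp y hy)) hne

end


section

variable {X : Type} [MetricSpace X] {lam : ℝ}

def Cvx (W : Set X) : Prop :=
  ∃ (f : X → ℝ) (L : ℝ) (A : Set X), 0 < L ∧ IsClosed A ∧ (∀ x y, |f x - f y| ≤ L * dist x y) ∧
    W = {x | x ∈ A ∧ 0 < f x} ∧
    ∀ x ∈ A, ∀ y ∈ A, ∀ z, dist x z = dist x y / 2 → dist z y = dist x y / 2 → z ∈ A ∧ (x ≠ y → (f x + f y)/2 < f z)

theorem Cvx.inter {W W' : Set X} (h : Cvx W) (h' : Cvx W') : Cvx (W ∩ W') := by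
  obtain ⟨f, L, A, h1, h2, h3, h4, h5⟩ := h
  obtain ⟨f', L', A', h1', h2', h3', h4', h5'⟩ := h'
  refine ⟨fun x => min (f x) (f' x), max L L', A ∩ A', lt_max_of_lt_left h1, h2.inter h2', ?_, ?_, ?_⟩
  · intro x y
    refine (abs_min_sub_min_le_max _ _ _ _).trans (max_le ?_ ?_)
    · exact (h3 x y).trans (mul_le_mul_of_nonneg_right (le_max_left _ _) dist_nonneg)
    · exact (h3' x y).trans (mul_le_mul_of_nonneg_right (le_max_right _ _) dist_nonneg)
  · rw [h4, h4']
    ext x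
    simp only [mem_inter_iff, mem_setOf_eq, lt_min_iff]
    tauto
  · rintro x ⟨hx, hx'⟩ y ⟨hy, hy'⟩ z m1 m2
    obtain ⟨a, b⟩ := h5 x hx y hy z m1 m2
    obtain ⟨a', b'⟩ := h5' x hx' y hy' z m1 m2
    refine ⟨⟨a, a'⟩, fun hne => ?_⟩
    have b := b hne
    have b' := b' hne
    have e1 := min_le_left (f x) (f' x)
    have e2 := min_le_right (f x) (f' x)
    have e3 := min_le_left (f y) (f' y)
    have e4 := min_le_right (f y) (f' y)
    exact lt_min (by linarith) (by linarith)

theorem Cvx.finset {ι : Type} {B : Finset ι} (hB : B.Nonempty) (U : ι → Set X) (h : ∀ i ∈ B, Cvx (U i)) :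
    Cvx (⋂ i ∈ B, U i) := by
  induction hB using Finset.Nonempty.cons_induction with
  | singleton a => simpa using h a (by simp)
  | cons a s ha hs ih =>
    have := (h a (by simp)).inter (ih (fun α hα => h α (by simp [hα])))
    simpa using this

theorem Loc.cvx_contr [CompactSpace X] (h : Loc X lam) {W : Set X} (hW : Cvx W) (hne : W.Nonempty) : SetContr W := by
  classical
  have hl := h.pos
  obtain ⟨f, L, A, hL, hA, hlip, rfl, hmid⟩ := hW
  obtain ⟨w, hwA, hw0⟩ := hne
  haveI : CompactSpace A := isCompact_iff_compactSpace.1 hA.isCompact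
  let g : A → ℝ := fun x => f x
  have hglip : ∀ x y : A, |g x - g y| ≤ L * dist x y := fun x y => hlip x y
  have hgc : Continuous g := by
    refine (LipschitzWith.of_dist_le_mul (K := ⟨L, hL.le⟩) ?_).continuous
    intro x y
    rw [Real.dist_eq]
    exact hglip x y
  have hm : ∀ x y : A, ∃ m : A, dist x m = dist x y / 2 ∧ dist m y = dist x y / 2 ∧ (x ≠ y → (g x + g y)/2 < g m) := by
    intro x y
    obtain ⟨m, m1, m2⟩ := h.mid x y
    obtain ⟨a, b⟩ := hmid x x.2 y y.2 m m1 m2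
    exact ⟨⟨m, a⟩, m1, m2, fun hne => b (fun e => hne (Subtype.ext e))⟩
  have hFD : FlowData A g L (10 * lam^2) (1/(2*lam)) := by
    refine ⟨hL, by positivity, by positivity, hglip, ?_, ?_⟩
    · refine btw_of_mid hgc ?_
      intro x y
      by_cases hxy : x = y
      · subst hxy
        exact ⟨x, by simp, by simp, by linarith⟩
      · obtain ⟨m, m1, m2, m3⟩ := hm x y
        exact ⟨m, m1, m2, (m3 hxy).le⟩
    · intro x y Y m D h1 h2 h3 h4 h5
      refine h.estew (x := (x:X)) (y := y) (Y := Y) (m := m) h1 h2 h3 h4 ?_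
      rw [le_div_iff₀ (by positivity)] at h5
      linarith
  obtain ⟨p, -, hp⟩ := (isCompact_univ (X := A)).exists_isMaxOn ⟨⟨w, hwA⟩, mem_univ _⟩ hgc.continuousOn
  have hp' : ∀ z, g z ≤ g p := fun z => hp (mem_univ z)
  have huniq : ∀ z, g z = g p → z = p := by
    intro z hz
    by_contra hne
    obtain ⟨m, -, -, m3⟩ := hm z p
    have := m3 hne
    have := hp' m
    linarith
  obtain ⟨H, H1, H2, H3, H4⟩ := flow_contract hFD p hp' huniq
  refine ⟨p, ⟨p.2, lt_of_lt_of_le hw0 (hp' ⟨w, hwA⟩)⟩, fun z => if hz : z.1 ∈ A then (H (⟨z.1, hz⟩, z.2) : X) else z.1, ?_, ?_, ?_, ?_⟩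
  · rw [continuousOn_iff_continuous_restrict]
    have hc : Continuous (fun z : ↥({x | x ∈ A ∧ 0 < f x} ×ˢ Icc (0:ℝ) 1) =>
        (H (⟨z.1.1, z.2.1.1⟩, z.1.2) : X)) := by
      refine continuous_subtype_val.comp ?_
      refine H1.comp_continuous (f := fun z : ↥({x | x ∈ A ∧ 0 < f x} ×ˢ Icc (0:ℝ) 1) => ((⟨z.1.1, z.2.1.1⟩ : A), z.1.2)) ?_ ?_
      · exact (Continuous.subtype_mk (continuous_fst.comp continuous_subtype_val) _).prodMk (continuous_snd.comp continuous_subtype_val)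
      · intro z
        exact ⟨mem_univ _, z.2.2⟩
    convert hc using 1
    funext z
    have : z.1.1 ∈ A := z.2.1.1
    simp [this]
  · rintro x ⟨hx, -⟩
    simp [hx, H2]
  · rintro x ⟨hx, -⟩
    simp [hx, H3]
  · rintro x ⟨hx, hx0⟩ s hs
    have := H4 ⟨x, hx⟩ s hs
    simp only [hx, dite_true]
    exact ⟨(H (⟨x, hx⟩, s)).2, lt_of_lt_of_le hx0 this⟩

theorem Loc.nbhd [CompactSpace X] (h : Loc X lam) {d : ℕ} (hd : dimH (Set.univ : Set X) < d) (p : X) :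
    ∃ U : Set X, IsOpen U ∧ p ∈ U ∧ Cvx U := by
  obtain ⟨f, ρ, L, c, hρ, hL, hc, hlip, hfp, hdec, hcon⟩ := h.bump hd p
  have hfc : Continuous f := by
    refine (LipschitzWith.of_dist_le_mul (K := ⟨L, hL⟩) ?_).continuous
    intro x y
    rw [Real.dist_eq]
    exact hlip x y
  have hsm : ∀ x, dist p x ≤ ρ → -(c*ρ/4) ≤ f x → dist p x ≤ ρ/4 := by
    intro x hx hfx
    have h1 := hdec x hx
    by_contra hgt
    push Not at hgt
    nlinarith
  refine ⟨{x | dist p x < ρ ∧ -(c*ρ/4) < f x}, ?_, ?_, ?_⟩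
  · exact (isOpen_lt (continuous_const.dist continuous_id) continuous_const).inter (isOpen_lt continuous_const hfc)
  · simp only [mem_setOf_eq, dist_self, hfp]
    exact ⟨hρ, by have := mul_pos hc hρ; linarith⟩
  refine ⟨fun x => f x + c*ρ/4, L + 1, {x | dist p x ≤ ρ ∧ -(c*ρ/4) ≤ f x}, by linarith, ?_, ?_, ?_, ?_⟩
  · exact (isClosed_le (continuous_const.dist continuous_id) continuous_const).inter (isClosed_le continuous_const hfc)
  · intro x y
    have := hlip x y
    have h0 : 0 ≤ dist x y := dist_nonneg
    rw [show f x + c*ρ/4 - (f y + c*ρ/4) = f x - f y by ring]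
    linarith
  · ext x
    simp only [mem_setOf_eq]
    constructor
    · rintro ⟨a, b⟩
      exact ⟨⟨a.le, b.le⟩, by linarith⟩
    · rintro ⟨⟨a, b⟩, e⟩
      have := hsm x a b
      exact ⟨by linarith, by linarith⟩
  · rintro x ⟨hx, hx'⟩ y ⟨hy, hy'⟩ z m1 m2
    have hx4 := hsm x hx hx'
    have hy4 := hsm y hy hy'
    have t1 := dist_triangle_left x y p
    have t2 := dist_triangle p x z
    have hz : dist p z ≤ ρ := by linarith
    by_cases hxy : x = y
    · subst hxy
      rw [dist_self] at m1
      have : x = z := dist_eq_zero.1 (by linarith)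
      subst this
      exact ⟨⟨hx, hx'⟩, fun hne => absurd rfl hne⟩
    · have := hcon x y z hx hy hz hxy m1 m2
      exact ⟨⟨hz, by linarith⟩, fun _ => by linarith⟩

theorem main_aux (n : ℕ) (κ : ℝ)
    (X : Type) [MetricSpace X] [CompactSpace X] (hX : IsAlexandrovSpace X n κ) :
    ∃ R₀ > (0 : ℝ),
      ∀ (V : ℕ) (K L : FinSimpComplex V), L.faces ⊆ K.faces →
        ∀ (p : X) (σ₀ σ₁ : C(↥K.space, X)),
          (∀ x : ↥K.space, (x : Fin V → ℝ) ∈ L.space → σ₀ x = p) →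
          (∀ x : ↥K.space, (x : Fin V → ℝ) ∈ L.space → σ₁ x = p) →
          (∀ x : ↥K.space, dist (σ₀ x) (σ₁ x) < R₀) →
          Nonempty (ContinuousMap.HomotopyRel σ₀ σ₁
            {x : ↥K.space | (x : Fin V → ℝ) ∈ L.space}) := by
  classical
  obtain ⟨lam, h⟩ := loc_of_alexandrov hX
  have hd : dimH (Set.univ : Set X) < ((n+1 : ℕ) : ENNReal) := by
    rw [hX.dim]
    exact_mod_cast Nat.lt_succ_self n
  choose U hUo hUp hUc using fun p => h.nbhd hd p
  obtain ⟨t, ht⟩ := isCompact_univ.elim_finite_subcover U hUo (fun x _ => mem_iUnion.2 ⟨x, hUp x⟩)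
  refine close_of_cover (ι := ↥t) (fun i => U i) (fun i => hUo i) ?_ ?_
  · intro x
    have := ht (mem_univ x)
    simp only [mem_iUnion] at this
    obtain ⟨i, hi, hx⟩ := this
    exact ⟨⟨i, hi⟩, hx⟩
  · intro S hS hne
    have := Cvx.finset (B := S.toFinset) (by simpa using hS) (fun i : ↥t => U i) (fun i _ => hUc i)
    simp only [Set.mem_toFinset] at this
    exact h.cvx_contr this hne

end

/-- There is a constant `R₀ > 0` depending only on the compact Alexandrov
space `X` such that any two continuous maps `σ₀, σ₁ : (K, L) → (X, p)` from a finite simplicial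
pair which are pointwise `R₀`-close are homotopic relative to `L`. -/
theorem close_maps_homotopic_rel (n : ℕ) (κ : ℝ)
    (X : Type) [MetricSpace X] [CompactSpace X] (hX : IsAlexandrovSpace X n κ) :
    ∃ R₀ > (0 : ℝ),
      ∀ (V : ℕ) (K L : FinSimpComplex V), L.faces ⊆ K.faces →
        ∀ (p : X) (σ₀ σ₁ : C(↥K.space, X)),
          (∀ x : ↥K.space, (x : Fin V → ℝ) ∈ L.space → σ₀ x = p) →
          (∀ x : ↥K.space, (x : Fin V → ℝ) ∈ L.space → σ₁ x = p) →
          (∀ x : ↥K.space, dist (σ₀ x) (σ₁ x) < R₀) →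
          Nonempty (ContinuousMap.HomotopyRel σ₀ σ₁
            {x : ↥K.space | (x : Fin V → ℝ) ∈ L.space}) := by
  exact main_aux n κ X hX

end Collapse
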